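/- For every x ∈ ℝ, |P((I − E[I])/√Var(I) ≤ x) − Φ(x)| ≤ c(x)/√λ, where c(x) = (m_{H³}/(m_{H²})^{3/2}) · (∫₀^∞ G³(t) p(t) dt / (∫₀^∞ G²(t) p(t) dt)^{3/2}) · min(0.4785, 31.935/(1+|x|³)). -/

import Mathlib

open MeasureTheory ProbabilityTheory Filter
open scoped Topology ENNReal

/-! ### The Beurling–Vaaler approximation of the sign function -/

/-- The Fejér kernel on the line, `(sin (π w) / (π w)) ^ 2`, written through its Fourier
transform. -/
noncomputable def fejerKernel (w : ℝ) : ℝ :=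
  2 * ∫ v in (0:ℝ)..1, (1 - v) * Real.cos (2 * Real.pi * w * v)

/-- The Fourier weight of Vaaler's approximation of the sign function. -/
noncomputable def vaalerWeight (v : ℝ) : ℝ :=
  (1 - v) * Real.cos (Real.pi * v) / Real.sin (Real.pi * v) + 1 / Real.pi

/-- Vaaler's approximation of the sign function. -/
noncomputable def vaalerSign (w : ℝ) : ℝ :=
  2 * ∫ v in (0:ℝ)..1, vaalerWeight v * Real.sin (2 * Real.pi * w * v)

lemma integral_one_sub_mul_cos {a : ℝ} (ha : a ≠ 0) :
    ∫ v in (0:ℝ)..1, (1 - v) * Real.cos (a * v) = (1 - Real.cos a) / a ^ 2 := by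
  have h : ∀ v ∈ Set.uIcc (0:ℝ) 1, HasDerivAt
      (fun v => (1 - v) * Real.sin (a * v) / a - Real.cos (a * v) / a ^ 2)
      ((1 - v) * Real.cos (a * v)) v := by
    intro v _
    have h1 : HasDerivAt (fun v : ℝ => a * v) a v := by
      simpa using (hasDerivAt_id v).const_mul a
    have h2 : HasDerivAt (fun v : ℝ => 1 - v) (-1) v := by
      simpa using (hasDerivAt_id v).const_sub 1
    have := ((h2.mul h1.sin).div_const a).sub (h1.cos.div_const (a ^ 2))
    refine this.congr_deriv ?_
    field_simp
    ring
  rw [intervalIntegral.integral_eq_sub_of_hasDerivAt h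
    (Continuous.intervalIntegrable (by fun_prop) _ _)]
  simp
  field_simp
  ring

lemma integral_sin_mul {a : ℝ} (ha : a ≠ 0) :
    ∫ v in (0:ℝ)..1, Real.sin (a * v) = (1 - Real.cos a) / a := by
  rw [intervalIntegral.integral_comp_mul_left (fun x => Real.sin x) ha]
  simp
  field_simp

lemma pi_mul_sq_mul_fejerKernel (w : ℝ) :
    (Real.pi * w) ^ 2 * fejerKernel w = Real.sin (Real.pi * w) ^ 2 := by
  rcases eq_or_ne w 0 with rfl | hw
  · simp
  have ha : 2 * Real.pi * w ≠ 0 := by positivity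
  have hc : Real.cos (2 * Real.pi * w) = 1 - 2 * Real.sin (Real.pi * w) ^ 2 := by
    rw [mul_assoc, Real.cos_two_mul, Real.cos_sq']
    ring
  rw [fejerKernel, integral_one_sub_mul_cos ha, hc]
  field_simp
  ring

lemma fejerKernel_zero : fejerKernel 0 = 1 := by
  have : ∫ v in (0:ℝ)..1, (1 - v) = 1 / 2 := by
    rw [intervalIntegral.integral_sub (by simp) (by simp)]
    simp
    norm_num
  simp [fejerKernel, this]

lemma fejerKernel_neg (w : ℝ) : fejerKernel (-w) = fejerKernel w := by
  simp [fejerKernel]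

lemma vaalerSign_neg (w : ℝ) : vaalerSign (-w) = -vaalerSign w := by
  simp [vaalerSign]

lemma fejerKernel_eq_div {w : ℝ} (hw : w ≠ 0) :
    fejerKernel w = Real.sin (Real.pi * w) ^ 2 / Real.pi ^ 2 / w ^ 2 := by
  rw [← pi_mul_sq_mul_fejerKernel]
  field_simp

lemma fejerKernel_nonneg (w : ℝ) : 0 ≤ fejerKernel w := by
  rcases eq_or_ne w 0 with rfl | hw
  · simp [fejerKernel_zero]
  · rw [fejerKernel_eq_div hw]
    positivity

lemma fejerKernel_natCast {n : ℕ} (hn : n ≠ 0) : fejerKernel n = 0 := by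
  rw [fejerKernel_eq_div (by exact_mod_cast hn), mul_comm, Real.sin_nat_mul_pi]
  simp

lemma two_mul_mul_fejerKernel (w : ℝ) :
    2 * w * fejerKernel w = 2 / Real.pi * ∫ v in (0:ℝ)..1, Real.sin (2 * Real.pi * w * v) := by
  rcases eq_or_ne w 0 with rfl | hw
  · simp
  have ha : 2 * Real.pi * w ≠ 0 := by positivity
  rw [fejerKernel, integral_one_sub_mul_cos ha, integral_sin_mul ha]
  field_simp

lemma two_mul_one_sub_le_sin_pi_mul {v : ℝ} (h0 : 0 ≤ v) (h1 : v ≤ 1) :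
    2 * (v * (1 - v)) ≤ Real.sin (Real.pi * v) := by
  have hpi := Real.pi_pos
  rcases le_total v (1 / 2) with h | h
  · have := Real.mul_le_sin (x := Real.pi * v) (by positivity) (by nlinarith)
    have h2 : 2 / Real.pi * (Real.pi * v) = 2 * v := by field_simp
    nlinarith
  · have := Real.mul_le_sin (x := Real.pi * (1 - v)) (by nlinarith) (by nlinarith)
    have h2 : 2 / Real.pi * (Real.pi * (1 - v)) = 2 * (1 - v) := by field_simp
    have h3 : Real.sin (Real.pi * (1 - v)) = Real.sin (Real.pi * v) := by
      rw [mul_sub, mul_one, Real.sin_pi_sub]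
    nlinarith

lemma sin_pi_mul_pos {v : ℝ} (h0 : 0 < v) (h1 : v < 1) : 0 < Real.sin (Real.pi * v) :=
  lt_of_lt_of_le (by have := sub_pos.2 h1; positivity)
    (two_mul_one_sub_le_sin_pi_mul h0.le h1.le)

lemma sin_pi_mul_mul_dirichlet (θ v : ℝ) (N : ℕ) :
    Real.sin (Real.pi * v) * (Real.cos θ + 2 * ∑ n ∈ Finset.range N,
      Real.cos (θ + 2 * Real.pi * (n + 1) * v)) =
      Real.sin (θ + (2 * N + 1) * Real.pi * v) - Real.sin θ * Real.cos (Real.pi * v) := by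
  induction N with
  | zero => simp [Real.sin_add]; ring
  | succ N ih =>
    rw [Finset.sum_range_succ]
    have h1 : Real.sin (θ + (2 * ((N + 1 : ℕ) : ℝ) + 1) * Real.pi * v) =
        Real.sin ((θ + 2 * Real.pi * (N + 1) * v) + Real.pi * v) := by
      push_cast; ring_nf
    have h2 : Real.sin (θ + (2 * N + 1) * Real.pi * v) =
        Real.sin ((θ + 2 * Real.pi * (N + 1) * v) - Real.pi * v) := by
      ring_nf
    rw [h1, Real.sin_add]
    rw [h2, Real.sin_sub] at ih
    linear_combination ih

lemma abs_vaaler_quotient_le {v s x : ℝ} (h0 : 0 < v) (h1 : v < 1) (hs : |s| ≤ |x| * v) :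
    |(1 - v) * s / Real.sin (Real.pi * v)| ≤ |x| := by
  have h2 := sin_pi_mul_pos h0 h1
  have h3 := two_mul_one_sub_le_sin_pi_mul h0.le h1.le
  rw [abs_div, abs_of_pos h2, div_le_iff₀ h2, abs_mul, abs_of_pos (sub_pos.2 h1)]
  have h4 : (1 - v) * |s| ≤ (1 - v) * (|x| * v) :=
    mul_le_mul_of_nonneg_left hs (sub_pos.2 h1).le
  have h5 : 0 ≤ v * (1 - v) := mul_nonneg h0.le (sub_pos.2 h1).le
  nlinarith [abs_nonneg x, mul_nonneg (abs_nonneg x) h5]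

lemma intervalIntegrable_of_bounded {f : ℝ → ℝ} (hf : Measurable f) {C : ℝ}
    (h : ∀ v, 0 < v → v < 1 → |f v| ≤ C) : IntervalIntegrable f volume 0 1 := by
  rw [intervalIntegrable_iff_integrableOn_Ioo_of_le zero_le_one]
  refine Measure.integrableOn_of_bounded (M := C) (by simp) hf.aestronglyMeasurable ?_
  filter_upwards [ae_restrict_mem measurableSet_Ioo] with v hv
  exact h v hv.1 hv.2

lemma tendsto_integral_mul_trig {f : ℝ → ℝ} (hf : IntervalIntegrable f volume 0 1) :
    Tendsto (fun N : ℕ => ∫ v in (0:ℝ)..1, f v * Real.cos ((2 * N + 1) * Real.pi * v)) atTop (𝓝 0) ∧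
    Tendsto (fun N : ℕ => ∫ v in (0:ℝ)..1, f v * Real.sin ((2 * N + 1) * Real.pi * v)) atTop (𝓝 0) := by
  rw [intervalIntegrable_iff_integrableOn_Ioo_of_le zero_le_one] at hf
  set g : ℝ → ℂ := (Set.Ioo (0:ℝ) 1).indicator (fun v => (f v : ℂ)) with hg
  have hgi : Integrable g := (integrable_indicator_iff measurableSet_Ioo).2 hf.ofReal
  have h1 := Real.tendsto_integral_exp_smul_cocompact g
  have h2 : Tendsto (fun N : ℕ => ((2 * N + 1 : ℝ) / 2)) atTop (cocompact ℝ) := by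
    refine Tendsto.mono_right ?_ atTop_le_cocompact
    refine tendsto_atTop_mono (fun N => ?_) tendsto_natCast_atTop_atTop
    linarith
  have h3 := h1.comp h2
  have h4 : ∀ N : ℕ, ∫ v, Real.fourierChar (-(v * ((2 * N + 1 : ℝ) / 2))) • g v =
      ∫ v in Set.Ioo (0:ℝ) 1, Complex.exp (-((2 * N + 1) * Real.pi * v : ℝ) * Complex.I) * f v := by
    intro N
    rw [← integral_indicator measurableSet_Ioo]
    congr 1
    ext v
    by_cases hv : v ∈ Set.Ioo (0:ℝ) 1
    · simp only [hg, Set.indicator_of_mem hv, Circle.smul_def, Real.fourierChar_apply, smul_eq_mul]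
      congr 2
      push_cast
      ring
    · simp [hg, Set.indicator_of_notMem hv]
  have hI : ∀ N : ℕ, Integrable (fun v : ℝ =>
      Complex.exp (-((2 * N + 1) * Real.pi * v : ℝ) * Complex.I) * f v)
      (volume.restrict (Set.Ioo (0:ℝ) 1)) := by
    intro N
    refine Integrable.bdd_mul (c := 1) hf.ofReal (by fun_prop) ?_
    filter_upwards with v
    rw [← Complex.ofReal_neg, Complex.norm_exp_ofReal_mul_I]
  have h5 : Tendsto (fun N : ℕ => ∫ v in Set.Ioo (0:ℝ) 1,
      Complex.exp (-((2 * N + 1) * Real.pi * v : ℝ) * Complex.I) * f v) atTop (𝓝 0) := by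
    refine h3.congr fun N => ?_
    exact h4 N
  constructor
  · have h6 := (Complex.continuous_re.tendsto 0).comp h5
    refine (h6.congr fun N => ?_)
    simp only [Function.comp]
    rw [intervalIntegral.integral_of_le zero_le_one, integral_Ioc_eq_integral_Ioo,
      ← Complex.reCLM_apply, ← ContinuousLinearMap.integral_comp_comm _ (hI N)]
    congr 1
    ext v
    rw [Complex.reCLM_apply, Complex.re_mul_ofReal, ← Complex.ofReal_neg, Complex.exp_ofReal_mul_I_re,
      Real.cos_neg, mul_comm]
  · have h6 := (Complex.continuous_im.tendsto 0).comp h5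
    have h7 := h6.neg
    simp only [Complex.zero_im, neg_zero] at h7
    refine (h7.congr fun N => ?_)
    simp only [Function.comp]
    rw [intervalIntegral.integral_of_le zero_le_one, integral_Ioc_eq_integral_Ioo,
      ← Complex.imCLM_apply, ← ContinuousLinearMap.integral_comp_comm _ (hI N), ← integral_neg]
    congr 1
    ext v
    rw [Complex.imCLM_apply, Complex.im_mul_ofReal, ← Complex.ofReal_neg, Complex.exp_ofReal_mul_I_im,
      Real.sin_neg, mul_comm]
    ring

lemma abs_sin_mul_le (w v : ℝ) (hv : 0 ≤ v) :
    |Real.sin (2 * Real.pi * w * v)| ≤ |2 * Real.pi * w| * v := by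
  refine Real.abs_sin_le_abs.trans ?_
  rw [abs_mul, abs_of_nonneg hv]

lemma abs_cos_sub_one_le (x : ℝ) : |Real.cos x - 1| ≤ |x| := by
  have := Real.abs_cos_sub_cos_le x 0
  simpa using this

lemma tendsto_fejerKernel_sum (w : ℝ) :
    Tendsto (fun N : ℕ => fejerKernel w + 2 * ∑ n ∈ Finset.range N, fejerKernel (w + (n + 1))
      - 2 * w * fejerKernel w) atTop (𝓝 (1 - vaalerSign w)) := by
  set f₁ : ℝ → ℝ := fun v => (1 - v) * Real.sin (2 * Real.pi * w * v) / Real.sin (Real.pi * v)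
  set f₂ : ℝ → ℝ := fun v =>
    (1 - v) * (Real.cos (2 * Real.pi * w * v) - 1) / Real.sin (Real.pi * v)
  have hf₁ : IntervalIntegrable f₁ volume 0 1 :=
    intervalIntegrable_of_bounded (by fun_prop)
      fun v h0 h1 => abs_vaaler_quotient_le h0 h1 (abs_sin_mul_le w v h0.le)
  have hf₂ : IntervalIntegrable f₂ volume 0 1 :=
    intervalIntegrable_of_bounded (by fun_prop)
      fun v h0 h1 => abs_vaaler_quotient_le h0 h1 (x := 2 * Real.pi * w) (by
        refine (abs_cos_sub_one_le _).trans ?_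
        rw [abs_mul, abs_of_nonneg h0.le])
  have hlim := ((tendsto_integral_mul_trig hf₁).1.const_mul 2).add
    ((tendsto_integral_mul_trig hf₂).2.const_mul 2)
  have hlim2 := hlim.add_const (1 - vaalerSign w)
  simp only [mul_zero, add_zero, zero_add] at hlim2
  refine hlim2.congr fun N => ?_
  have hsum : ∀ w' : ℝ, fejerKernel w' + 2 * ∑ n ∈ Finset.range N, fejerKernel (w' + (n + 1)) =
      2 * ∫ v in (0:ℝ)..1, (1 - v) * (Real.cos (2 * Real.pi * w' * v) + 2 * ∑ n ∈ Finset.range N,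
        Real.cos (2 * Real.pi * w' * v + 2 * Real.pi * (n + 1) * v)) := by
    intro w'
    have : ∀ v : ℝ, (1 - v) * (Real.cos (2 * Real.pi * w' * v) + 2 * ∑ n ∈ Finset.range N,
        Real.cos (2 * Real.pi * w' * v + 2 * Real.pi * (n + 1) * v)) =
        (1 - v) * Real.cos (2 * Real.pi * w' * v) + 2 * ∑ n ∈ Finset.range N,
          (1 - v) * Real.cos (2 * Real.pi * (w' + (n + 1)) * v) := by
      intro v
      rw [mul_add, ← Finset.mul_sum]
      have : ∀ n : ℕ, 2 * Real.pi * w' * v + 2 * Real.pi * (n + 1) * v =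
        2 * Real.pi * (w' + (n + 1)) * v := fun n => by ring
      simp only [this]
      ring
    simp only [this]
    rw [intervalIntegral.integral_add (Continuous.intervalIntegrable (by fun_prop) _ _)
      (Continuous.intervalIntegrable (by fun_prop) _ _), intervalIntegral.integral_const_mul,
      intervalIntegral.integral_finsetSum
        (fun i _ => Continuous.intervalIntegrable (by fun_prop) _ _)]
    simp only [fejerKernel, Finset.mul_sum, mul_add]
  have h1 : (1:ℝ) = 2 * ∫ v in (0:ℝ)..1, (1 - v) * (Real.cos (2 * Real.pi * 0 * v) +
      2 * ∑ n ∈ Finset.range N, Real.cos (2 * Real.pi * 0 * v + 2 * Real.pi * (n + 1) * v)) := by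
    rw [← hsum 0, fejerKernel_zero, Finset.sum_eq_zero]
    · simp
    · intro n _
      have := fejerKernel_natCast (n := n + 1) (by simp)
      simpa using this
  have hH : vaalerSign w - 2 * w * fejerKernel w =
      2 * ∫ v in (0:ℝ)..1, (1 - v) * Real.sin (2 * Real.pi * w * v) / Real.sin (Real.pi * v)
        * Real.cos (Real.pi * v) := by
    rw [two_mul_mul_fejerKernel, vaalerSign]
    have : ∀ v : ℝ, vaalerWeight v * Real.sin (2 * Real.pi * w * v) =
        f₁ v * Real.cos (Real.pi * v) + 1 / Real.pi * Real.sin (2 * Real.pi * w * v) := by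
      intro v
      simp only [vaalerWeight, f₁]
      ring
    simp only [this]
    rw [intervalIntegral.integral_add (hf₁.mul_continuousOn (by fun_prop))
      (Continuous.intervalIntegrable (by fun_prop) _ _), intervalIntegral.integral_const_mul]
    ring
  have key : (2 * ∫ v in (0:ℝ)..1, (1 - v) * (Real.cos (2 * Real.pi * w * v) +
      2 * ∑ n ∈ Finset.range N, Real.cos (2 * Real.pi * w * v + 2 * Real.pi * (n + 1) * v))) =
      2 * (∫ v in (0:ℝ)..1, (1 - v) * (Real.cos (2 * Real.pi * 0 * v) +
      2 * ∑ n ∈ Finset.range N, Real.cos (2 * Real.pi * 0 * v + 2 * Real.pi * (n + 1) * v)))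
      + 2 * (∫ v in (0:ℝ)..1, f₁ v * Real.cos ((2 * N + 1) * Real.pi * v))
      + 2 * (∫ v in (0:ℝ)..1, f₂ v * Real.sin ((2 * N + 1) * Real.pi * v))
      - 2 * (∫ v in (0:ℝ)..1, f₁ v * Real.cos (Real.pi * v)) := by
    have i1 : IntervalIntegrable (fun v => f₁ v * Real.cos ((2 * N + 1) * Real.pi * v))
      volume 0 1 := hf₁.mul_continuousOn (by fun_prop)
    have i2 : IntervalIntegrable (fun v => f₂ v * Real.sin ((2 * N + 1) * Real.pi * v))
      volume 0 1 := hf₂.mul_continuousOn (by fun_prop)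
    have i3 : IntervalIntegrable (fun v => f₁ v * Real.cos (Real.pi * v))
      volume 0 1 := hf₁.mul_continuousOn (by fun_prop)
    have i0 : IntervalIntegrable (fun v => (1 - v) * (Real.cos (2 * Real.pi * 0 * v) +
      2 * ∑ n ∈ Finset.range N, Real.cos (2 * Real.pi * 0 * v + 2 * Real.pi * (n + 1) * v)))
      volume 0 1 := Continuous.intervalIntegrable (by fun_prop) _ _
    rw [← mul_add, ← mul_add, ← mul_sub, ← intervalIntegral.integral_add i0 i1,
      ← intervalIntegral.integral_add (i0.add i1) i2,
      ← intervalIntegral.integral_sub ((i0.add i1).add i2) i3]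
    congr 1
    rw [intervalIntegral.integral_of_le zero_le_one, intervalIntegral.integral_of_le zero_le_one,
      integral_Ioc_eq_integral_Ioo, integral_Ioc_eq_integral_Ioo]
    refine setIntegral_congr_fun measurableSet_Ioo fun v hv => ?_
    have hs := (sin_pi_mul_pos hv.1 hv.2).ne'
    have e1 := sin_pi_mul_mul_dirichlet (2 * Real.pi * w * v) v N
    have e0 := sin_pi_mul_mul_dirichlet (2 * Real.pi * 0 * v) v N
    simp only [f₁, f₂]
    rw [eq_div_of_mul_eq hs ((mul_comm _ _).trans e1),
      eq_div_of_mul_eq hs ((mul_comm _ _).trans e0), Real.sin_add]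
    simp only [mul_zero, zero_mul, zero_add, Real.sin_zero]
    field_simp
    ring
  rw [hsum w, key, ← h1]
  linarith

lemma abs_one_sub_vaalerSign_le {w : ℝ} (hw : 0 < w) : |1 - vaalerSign w| ≤ fejerKernel w := by
  set s : ℝ := Real.sin (Real.pi * w) ^ 2 / Real.pi ^ 2 with hs
  have hs0 : 0 ≤ s := by positivity
  have hK : ∀ n : ℕ, fejerKernel (w + (n + 1)) = s / (w + (n + 1)) ^ 2 := by
    intro n
    rw [fejerKernel_eq_div (by positivity), hs, mul_add]
    have : Real.sin (Real.pi * w + Real.pi * (n + 1)) ^ 2 = Real.sin (Real.pi * w) ^ 2 := by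
      have h := Real.sin_add_nat_mul_pi (Real.pi * w) (n + 1)
      rw [mul_comm Real.pi ((n:ℝ) + 1)]
      push_cast at h
      rw [h, mul_pow, ← pow_mul, mul_comm (n + 1) 2, pow_mul]
      simp
    rw [this]
  have hK0 : fejerKernel w = s / w ^ 2 := fejerKernel_eq_div hw.ne'
  have up : ∀ N : ℕ, ∑ n ∈ Finset.range N, s / (w + (n + 1)) ^ 2 ≤ s / w - s / (w + N) := by
    intro N
    induction N with
    | zero => simp
    | succ N ih =>
      rw [Finset.sum_range_succ]
      have : s / (w + (N + 1)) ^ 2 ≤ s / (w + N) - s / (w + (N + 1)) := by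
        have h : s / (w + N) - s / (w + (N + 1)) = s / ((w + N) * (w + (N + 1))) := by
          field_simp; ring
        rw [h]
        gcongr
        nlinarith [(Nat.cast_nonneg N : (0:ℝ) ≤ N)]
      push_cast
      linarith
  have lo : ∀ N : ℕ, s / w - s / (w + (N + 1)) ≤
      s / w ^ 2 + ∑ n ∈ Finset.range N, s / (w + (n + 1)) ^ 2 := by
    intro N
    induction N with
    | zero =>
      simp
      have h : s / w - s / (w + 1) = s / (w * (w + 1)) := by field_simp; ring
      rw [← sub_le_iff_le_add, h]
      gcongr
      nlinarith
    | succ N ih =>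
      rw [Finset.sum_range_succ]
      have : s / (w + (N + 1)) - s / (w + (N + 1 + 1)) ≤ s / (w + (N + 1)) ^ 2 := by
        have h : s / (w + (N + 1)) - s / (w + (N + 1 + 1)) =
            s / ((w + (N + 1)) * (w + (N + 1 + 1))) := by
          field_simp; ring
        rw [h]
        gcongr
        nlinarith [(Nat.cast_nonneg N : (0:ℝ) ≤ N)]
      push_cast
      linarith
  have hlim := tendsto_fejerKernel_sum w
  simp only [hK] at hlim
  have hwK : 2 * w * fejerKernel w = 2 * (s / w) := by
    rw [hK0]; field_simp
  rw [hwK, hK0] at hlim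
  rw [hK0, abs_le]
  constructor
  · have h2 : Tendsto (fun N : ℕ => -(s / w ^ 2) - 2 * (s / (w + (N + 1)))) atTop
        (𝓝 (-(s / w ^ 2) - 2 * 0)) := by
      refine Tendsto.const_sub _ (Tendsto.const_mul _ ?_)
      refine Tendsto.div_atTop tendsto_const_nhds ?_
      exact tendsto_atTop_add_const_left _ _
        (tendsto_atTop_add_const_right _ _ tendsto_natCast_atTop_atTop)
    have h3 := le_of_tendsto_of_tendsto' h2 hlim (fun N => by linarith [lo N])
    linarith
  · refine le_of_tendsto' hlim fun N => ?_
    have := up N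
    have : 0 ≤ s / (w + N) := by positivity
    linarith

/-- Vaaler's approximation of the indicator of the half line, with Fejér kernel error. -/
lemma abs_indicator_sub_vaaler_le (w : ℝ) :
    |(Set.Ici (0:ℝ)).indicator 1 w - (1 + vaalerSign w) / 2| ≤ fejerKernel w / 2 := by
  rcases lt_trichotomy w 0 with hw | rfl | hw
  · have h := abs_one_sub_vaalerSign_le (w := -w) (by linarith)
    rw [vaalerSign_neg, fejerKernel_neg] at h
    rw [Set.indicator_of_notMem (by simpa using hw), abs_le]
    rw [abs_le] at h
    constructor <;> linarith [h.1, h.2]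
  · have h : vaalerSign 0 = 0 := by simp [vaalerSign]
    rw [h, fejerKernel_zero]
    simp
    norm_num [abs_le]
  · have h := abs_one_sub_vaalerSign_le hw
    rw [Set.indicator_of_mem (by simpa using hw.le), abs_le, Pi.one_apply]
    rw [abs_le] at h
    constructor <;> linarith [h.1, h.2]

/-! ### The smoothing inequality -/

lemma measurable_vaalerWeight : Measurable vaalerWeight := by
  unfold vaalerWeight
  fun_prop

lemma measurable_fejerKernel : Measurable fejerKernel := by
  have h : StronglyMeasurable (Function.uncurry
      (fun w v : ℝ => (1 - v) * Real.cos (2 * Real.pi * w * v))) :=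
    (Continuous.stronglyMeasurable (by fun_prop))
  have := (h.integral_prod_right (ν := volume.restrict (Set.Ioc (0:ℝ) 1))).measurable
  unfold fejerKernel
  simp only [intervalIntegral.integral_of_le zero_le_one]
  exact this.const_mul 2

lemma measurable_vaalerSign : Measurable vaalerSign := by
  have h : StronglyMeasurable (Function.uncurry
      (fun w v : ℝ => vaalerWeight v * Real.sin (2 * Real.pi * w * v))) :=
    Measurable.stronglyMeasurable (by
      have := measurable_vaalerWeight
      fun_prop)
  have := (h.integral_prod_right (ν := volume.restrict (Set.Ioc (0:ℝ) 1))).measurable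
  unfold vaalerSign
  simp only [intervalIntegral.integral_of_le zero_le_one]
  exact this.const_mul 2

/-- The Fourier kernel of the majorant (`ε = 1`) and the minorant (`ε = -1`) of the indicator
of the half line. -/
noncomputable def vaalerFourier (ε y v : ℝ) : ℝ :=
  vaalerWeight v * Real.sin (2 * Real.pi * y * v) + ε * ((1 - v) * Real.cos (2 * Real.pi * y * v))

lemma abs_vaalerWeight_le {v : ℝ} (h0 : 0 < v) (h1 : v < 1) : |vaalerWeight v| ≤ 1 / v := by
  have h2 := sin_pi_mul_pos h0 h1
  have h3 := two_mul_one_sub_le_sin_pi_mul h0.le h1.le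
  have h4 : |(1 - v) * Real.cos (Real.pi * v) / Real.sin (Real.pi * v)| ≤ 1 / (2 * v) := by
    rw [abs_div, abs_of_pos h2, div_le_div_iff₀ h2 (by positivity), abs_mul,
      abs_of_pos (sub_pos.2 h1)]
    have : (1 - v) * |Real.cos (Real.pi * v)| ≤ 1 - v :=
      mul_le_of_le_one_right (by linarith) (Real.abs_cos_le_one _)
    nlinarith
  have h5 : 1 / Real.pi ≤ 1 / 2 := one_div_le_one_div_of_le (by norm_num) Real.two_le_pi
  have h6 : (1:ℝ) / 2 ≤ 1 / (2 * v) := by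
    apply one_div_le_one_div_of_le (by positivity); linarith
  have h7 : 1 / v = 1 / (2 * v) + 1 / (2 * v) := by field_simp; norm_num
  unfold vaalerWeight
  refine (abs_add_le _ _).trans ?_
  rw [abs_of_pos (by positivity : 0 < 1 / Real.pi)]
  linarith

lemma abs_vaalerWeight_mul_sin_le {v : ℝ} (h0 : 0 < v) (h1 : v < 1) (y : ℝ) :
    |vaalerWeight v * Real.sin (2 * Real.pi * y * v)| ≤ |2 * Real.pi * y| := by
  rw [abs_mul]
  calc _ ≤ 1 / v * (|2 * Real.pi * y| * v) :=
        mul_le_mul (abs_vaalerWeight_le h0 h1) (abs_sin_mul_le y v h0.le) (abs_nonneg _)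
          (by positivity)
    _ = _ := by field_simp

lemma abs_vaalerFourier_le {ε v : ℝ} (hε : |ε| = 1) (h0 : 0 < v) (h1 : v < 1) (y : ℝ) :
    |vaalerFourier ε y v| ≤ |2 * Real.pi * y| + 1 := by
  refine (abs_add_le _ _).trans (add_le_add (abs_vaalerWeight_mul_sin_le h0 h1 y) ?_)
  rw [abs_mul, hε, one_mul, abs_mul, abs_of_pos (sub_pos.2 h1)]
  have := Real.abs_cos_le_one (2 * Real.pi * y * v)
  nlinarith [abs_nonneg (Real.cos (2 * Real.pi * y * v))]

lemma measurable_uncurry_vaalerFourier (ε : ℝ) :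
    Measurable (fun z : ℝ × ℝ => vaalerFourier ε z.1 z.2) := by
  have := measurable_vaalerWeight
  unfold vaalerFourier
  fun_prop

lemma integral_vaalerFourier (ε y : ℝ) :
    ∫ v in (0:ℝ)..1, vaalerFourier ε y v = (vaalerSign y + ε * fejerKernel y) / 2 := by
  unfold vaalerFourier
  rw [intervalIntegral.integral_add _ (Continuous.intervalIntegrable (by fun_prop) _ _),
    intervalIntegral.integral_const_mul, vaalerSign, fejerKernel]
  · ring
  · refine intervalIntegrable_of_bounded ?_ fun v h0 h1 => abs_vaalerWeight_mul_sin_le h0 h1 y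
    have := measurable_vaalerWeight
    fun_prop

/-- The signed error of the Vaaler majorant (`ε = 1`) or minorant (`ε = -1`). -/
noncomputable def vaalerError (ε y : ℝ) : ℝ :=
  ε * (1 / 2 + (∫ v in (0:ℝ)..1, vaalerFourier ε y v) - (Set.Ici (0:ℝ)).indicator 1 y)

lemma vaalerError_eq {ε : ℝ} (hε : |ε| = 1) (y : ℝ) :
    vaalerError ε y = fejerKernel y / 2 -
      ε * ((Set.Ici (0:ℝ)).indicator 1 y - (1 + vaalerSign y) / 2) := by
  have h : ε * ε = 1 := by rw [← abs_mul_abs_self, hε, one_mul]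
  rw [vaalerError, integral_vaalerFourier]
  linear_combination fejerKernel y / 2 * h

lemma vaalerError_nonneg {ε : ℝ} (hε : |ε| = 1) (y : ℝ) : 0 ≤ vaalerError ε y := by
  rw [vaalerError_eq hε]
  have h := abs_indicator_sub_vaaler_le y
  have h2 := le_abs_self (ε * ((Set.Ici (0:ℝ)).indicator 1 y - (1 + vaalerSign y) / 2))
  rw [abs_mul, hε, one_mul] at h2
  linarith

lemma abs_fejerKernel_le (w : ℝ) : |fejerKernel w| ≤ 2 := by
  have : ‖∫ v in (0:ℝ)..1, (1 - v) * Real.cos (2 * Real.pi * w * v)‖ ≤ 1 * |1 - 0| := by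
    refine intervalIntegral.norm_integral_le_of_norm_le_const fun v hv => ?_
    rw [Set.uIoc_of_le zero_le_one] at hv
    rw [norm_mul, Real.norm_eq_abs, Real.norm_eq_abs, abs_of_nonneg (by linarith [hv.2])]
    have := Real.abs_cos_le_one (2 * Real.pi * w * v)
    nlinarith [abs_nonneg (Real.cos (2 * Real.pi * w * v)), hv.1, hv.2]
  rw [fejerKernel, abs_mul]
  norm_num at this ⊢
  linarith

lemma lintegral_fejerKernel_le_one : ∫⁻ w, ENNReal.ofReal (fejerKernel w) ≤ 1 := by
  have hg : ∀ n : ℕ, ∫⁻ w, ENNReal.ofReal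
      (fejerKernel w * Real.exp (-w ^ 2 / (2 * ((n:ℝ) + 1) ^ 2))) ≤ 1 := by
    intro n
    set s : NNReal := (((n:NNReal) + 1) ^ 2) with hs
    have hs0 : s ≠ 0 := by positivity
    have hsr : (s:ℝ) = ((n:ℝ) + 1) ^ 2 := by simp [hs]
    set κ : ℝ := (√(2 * Real.pi * s))⁻¹ with hκ
    have hκ0 : 0 < κ := by positivity
    have h1 : ∫ w, fejerKernel w ∂(gaussianReal 0 s) =
        2 * ∫ v in (0:ℝ)..1, (1 - v) * Real.exp (-(s * (2 * Real.pi * v) ^ 2 / 2)) := by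
      unfold fejerKernel
      simp only [intervalIntegral.integral_of_le zero_le_one]
      rw [integral_const_mul]
      congr 1
      rw [integral_integral_swap]
      · refine setIntegral_congr_fun measurableSet_Ioc fun v _ => ?_
        rw [integral_const_mul]
        congr 1
        have h := charFun_gaussianReal (μ := 0) (v := s) (2 * Real.pi * v)
        rw [charFun_apply_real] at h
        have h2 := congrArg Complex.re h
        rw [← Complex.reCLM_apply, ← ContinuousLinearMap.integral_comp_comm] at h2
        · simp only [Complex.reCLM_apply] at h2
          have e1 : ∀ x : ℝ, (Complex.exp (((2 * Real.pi * v : ℝ) : ℂ) * x * Complex.I)).re =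
              Real.cos (2 * Real.pi * x * v) := by
            intro x
            rw [← Complex.ofReal_mul, Complex.exp_ofReal_mul_I_re]
            ring_nf
          simp only [e1] at h2
          rw [h2]
          have : (((2 * Real.pi * v : ℝ) : ℂ) * ((0:ℝ) : ℂ) * Complex.I -
            ((s:ℝ) : ℂ) * ((2 * Real.pi * v : ℝ) : ℂ) ^ 2 / 2) =
            ((-(s * (2 * Real.pi * v) ^ 2 / 2) : ℝ) : ℂ) := by
            push_cast; ring
          rw [this, Complex.exp_ofReal_re]
        · refine Integrable.of_bound (Continuous.aestronglyMeasurable (by fun_prop)) (C := 1) ?_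
          filter_upwards with x
          rw [← Complex.ofReal_mul, Complex.norm_exp_ofReal_mul_I]
      · refine Integrable.of_bound (Continuous.aestronglyMeasurable (by
          unfold Function.uncurry; fun_prop)) (C := 1) ?_
        have : ∀ᵐ z : ℝ × ℝ ∂((gaussianReal 0 s).prod (volume.restrict (Set.Ioc 0 1))),
            z.2 ∈ Set.Ioc (0:ℝ) 1 :=
          Measure.quasiMeasurePreserving_snd.ae (ae_restrict_mem measurableSet_Ioc)
        filter_upwards [this] with z hz
        simp only [Function.uncurry]
        rw [norm_mul, Real.norm_eq_abs, Real.norm_eq_abs, abs_of_nonneg (by linarith [hz.2])]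
        have := Real.abs_cos_le_one (2 * Real.pi * z.1 * z.2)
        nlinarith [abs_nonneg (Real.cos (2 * Real.pi * z.1 * z.2)), hz.1, hz.2]
    have h2 : ∫ w, fejerKernel w ∂(gaussianReal 0 s) ≤ κ := by
      rw [h1]
      have hb : (0:ℝ) < s * (2 * Real.pi) ^ 2 / 2 := by positivity
      have : ∫ v in (0:ℝ)..1, (1 - v) * Real.exp (-(s * (2 * Real.pi * v) ^ 2 / 2)) ≤
          ∫ v in Set.Ioi (0:ℝ), Real.exp (-(s * (2 * Real.pi) ^ 2 / 2) * v ^ 2) := by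
        have hi := (integrable_exp_neg_mul_sq hb)
        rw [intervalIntegral.integral_of_le zero_le_one]
        calc _ ≤ ∫ v in Set.Ioc (0:ℝ) 1, Real.exp (-(s * (2 * Real.pi) ^ 2 / 2) * v ^ 2) := by
              refine setIntegral_mono_on ?_ hi.integrableOn measurableSet_Ioc fun v hv => ?_
              · exact (Continuous.integrableOn_Ioc (by fun_prop))
              · have e : -(s * (2 * Real.pi * v) ^ 2 / 2) =
                  -(s * (2 * Real.pi) ^ 2 / 2) * v ^ 2 := by ring
                rw [e]
                have := Real.exp_pos (-(s * (2 * Real.pi) ^ 2 / 2) * v ^ 2)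
                nlinarith [hv.1]
          _ ≤ _ := setIntegral_mono_set hi.integrableOn
              (by filter_upwards with v using (Real.exp_pos _).le)
              (LE.le.eventuallyLE fun v hv => hv.1)
      rw [integral_gaussian_Ioi] at this
      have e : √(Real.pi / (s * (2 * Real.pi) ^ 2 / 2)) = κ := by
        rw [hκ, ← Real.sqrt_inv]
        congr 1
        field_simp
      rw [e] at this
      linarith
    have h3 : ∫ w, fejerKernel w ∂(gaussianReal 0 s) =
        ∫ w, κ * (fejerKernel w * Real.exp (-w ^ 2 / (2 * ((n:ℝ) + 1) ^ 2))) := by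
      rw [integral_gaussianReal_eq_integral_smul hs0]
      congr 1
      ext w
      rw [gaussianPDFReal, smul_eq_mul, hsr, hκ, hsr, sub_zero]
      ring
    have hint2 : Integrable (fun w => fejerKernel w * Real.exp (-w ^ 2 / (2 * ((n:ℝ) + 1) ^ 2))) := by
      refine Integrable.bdd_mul (c := 2) ?_ measurable_fejerKernel.aestronglyMeasurable ?_
      · have := integrable_exp_neg_mul_sq (b := 1 / (2 * ((n:ℝ) + 1) ^ 2)) (by positivity)
        refine this.congr (ae_of_all _ fun w => ?_)
        simp only
        congr 1
        ring
      · exact ae_of_all _ abs_fejerKernel_le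
    rw [← ofReal_integral_eq_lintegral_ofReal hint2
      (ae_of_all _ fun w => mul_nonneg (fejerKernel_nonneg w) (Real.exp_pos _).le)]
    rw [h3, integral_const_mul] at h2
    rw [ENNReal.ofReal_le_one]
    exact le_of_mul_le_mul_left (by linarith) hκ0
  have hlim : ∀ w : ℝ, Tendsto (fun n : ℕ => ENNReal.ofReal
      (fejerKernel w * Real.exp (-w ^ 2 / (2 * ((n:ℝ) + 1) ^ 2)))) atTop
      (𝓝 (ENNReal.ofReal (fejerKernel w))) := by
    intro w
    have h1 : Tendsto (fun n : ℕ => -w ^ 2 / (2 * ((n:ℝ) + 1) ^ 2)) atTop (𝓝 0) := by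
      refine Tendsto.div_atTop tendsto_const_nhds ?_
      refine Tendsto.const_mul_atTop two_pos ?_
      exact (tendsto_pow_atTop two_ne_zero).comp
        (tendsto_atTop_add_const_right _ _ tendsto_natCast_atTop_atTop)
    have h2 := (Real.continuous_exp.tendsto 0).comp h1
    have h3 := ENNReal.tendsto_ofReal (h2.const_mul (fejerKernel w))
    simpa using h3
  calc ∫⁻ w, ENNReal.ofReal (fejerKernel w)
      = ∫⁻ w, liminf (fun n : ℕ => ENNReal.ofReal
        (fejerKernel w * Real.exp (-w ^ 2 / (2 * ((n:ℝ) + 1) ^ 2)))) atTop := by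
        congr 1; ext w; exact (hlim w).liminf_eq.symm
    _ ≤ liminf (fun n : ℕ => ∫⁻ w, ENNReal.ofReal
        (fejerKernel w * Real.exp (-w ^ 2 / (2 * ((n:ℝ) + 1) ^ 2)))) atTop :=
        lintegral_liminf_le fun n => (measurable_fejerKernel.mul (by fun_prop)).ennreal_ofReal
    _ ≤ 1 := by
        refine liminf_le_of_frequently_le' (Frequently.of_forall hg)

lemma integrable_fejerKernel : Integrable fejerKernel := by
  refine ⟨measurable_fejerKernel.aestronglyMeasurable, ?_⟩
  rw [hasFiniteIntegral_iff_ofReal (ae_of_all _ fejerKernel_nonneg)]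
  exact lintegral_fejerKernel_le_one.trans_lt ENNReal.one_lt_top

lemma integral_fejerKernel_le_one : ∫ w, fejerKernel w ≤ 1 := by
  rw [integral_eq_lintegral_of_nonneg_ae (ae_of_all _ fejerKernel_nonneg)
    measurable_fejerKernel.aestronglyMeasurable]
  exact ENNReal.toReal_le_of_le_ofReal zero_le_one (by simpa using lintegral_fejerKernel_le_one)

lemma integrable_indicator_sub_vaaler :
    Integrable fun w => (Set.Ici (0:ℝ)).indicator 1 w - (1 + vaalerSign w) / 2 := by
  refine Integrable.mono' (integrable_fejerKernel.div_const 2) ?_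
    (ae_of_all _ abs_indicator_sub_vaaler_le)
  refine ((measurable_one.indicator measurableSet_Ici).sub ?_).aestronglyMeasurable
  exact (measurable_vaalerSign.const_add 1).div_const 2

lemma integral_indicator_sub_vaaler :
    ∫ w, ((Set.Ici (0:ℝ)).indicator 1 w - (1 + vaalerSign w) / 2) = 0 := by
  have h := integral_neg_eq_self
    (fun w : ℝ => (Set.Ici (0:ℝ)).indicator 1 w - (1 + vaalerSign w) / 2) volume
  have h2 : ∫ w : ℝ, ((Set.Ici (0:ℝ)).indicator 1 (-w) - (1 + vaalerSign (-w)) / 2) =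
      ∫ w : ℝ, -((Set.Ici (0:ℝ)).indicator 1 w - (1 + vaalerSign w) / 2) := by
    refine integral_congr_ae ?_
    have : ∀ᵐ w : ℝ, w ≠ 0 := by simp [ae_iff]
    filter_upwards [this] with w hw
    rw [vaalerSign_neg]
    rcases lt_or_gt_of_ne hw with h | h
    · rw [Set.indicator_of_mem (by simpa using h.le), Set.indicator_of_notMem (by simpa using h)]
      simp only [Pi.one_apply]
      ring
    · rw [Set.indicator_of_notMem (by simpa using h), Set.indicator_of_mem (by simpa using h.le)]
      simp only [Pi.one_apply]
      ring
  rw [h2, integral_neg] at h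
  linarith

lemma integrable_vaalerError {ε : ℝ} (hε : |ε| = 1) : Integrable (vaalerError ε) := by
  have : vaalerError ε = fun y => fejerKernel y / 2 -
      ε * ((Set.Ici (0:ℝ)).indicator 1 y - (1 + vaalerSign y) / 2) := funext (vaalerError_eq hε)
  rw [this]
  exact (integrable_fejerKernel.div_const 2).sub (integrable_indicator_sub_vaaler.const_mul ε)

lemma integral_vaalerError_le {ε : ℝ} (hε : |ε| = 1) : ∫ y, vaalerError ε y ≤ 1 / 2 := by
  have : vaalerError ε = fun y => fejerKernel y / 2 -
      ε * ((Set.Ici (0:ℝ)).indicator 1 y - (1 + vaalerSign y) / 2) := funext (vaalerError_eq hε)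
  rw [this, integral_sub (integrable_fejerKernel.div_const 2)
    (integrable_indicator_sub_vaaler.const_mul ε), integral_const_mul,
    integral_indicator_sub_vaaler, integral_div]
  linarith [integral_fejerKernel_le_one]

lemma integrable_uncurry_vaalerFourier {ε : ℝ} (hε : |ε| = 1) (ρ : Measure ℝ)
    [IsProbabilityMeasure ρ] (hρ : Integrable id ρ) (T x : ℝ) :
    Integrable (Function.uncurry fun w v => vaalerFourier ε (T / (2 * Real.pi) * (x - w)) v)
      (ρ.prod (volume.restrict (Set.Ioc (0:ℝ) 1))) := by
  have hb : Integrable (fun w => |2 * Real.pi * (T / (2 * Real.pi) * (x - w))| + 1) ρ := by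
    refine Integrable.add ?_ (integrable_const 1)
    refine Integrable.abs ?_
    refine Integrable.const_mul ?_ _
    exact ((integrable_const x).sub hρ).const_mul _
  refine Integrable.mono' (hb.comp_fst (volume.restrict (Set.Ioc (0:ℝ) 1))) ?_ ?_
  · refine Measurable.aestronglyMeasurable ?_
    have := (measurable_uncurry_vaalerFourier ε).comp
      (f := fun z : ℝ × ℝ => (T / (2 * Real.pi) * (x - z.1), z.2)) (by fun_prop)
    exact this
  · have : ∀ᵐ z : ℝ × ℝ ∂(ρ.prod (volume.restrict (Set.Ioc (0:ℝ) 1))),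
        z.2 ∈ Set.Ioo (0:ℝ) 1 := by
      rw [← restrict_Ioo_eq_restrict_Ioc]
      exact Measure.quasiMeasurePreserving_snd.ae (ae_restrict_mem measurableSet_Ioo)
    filter_upwards [this] with z hz
    exact abs_vaalerFourier_le hε hz.1 hz.2 _

lemma integral_vaalerFourier_eq_charFun (ε : ℝ) (ρ : Measure ℝ) [IsProbabilityMeasure ρ]
    (T x v : ℝ) :
    ∫ w, vaalerFourier ε (T / (2 * Real.pi) * (x - w)) v ∂ρ =
      vaalerWeight v * (Complex.exp ((T * v * x : ℝ) * Complex.I) * charFun ρ (-(T * v))).im +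
      ε * ((1 - v) * (Complex.exp ((T * v * x : ℝ) * Complex.I) * charFun ρ (-(T * v))).re) := by
  have hi : Integrable (fun w : ℝ => Complex.exp ((T * v * (x - w) : ℝ) * Complex.I)) ρ := by
    refine Integrable.of_bound (Continuous.aestronglyMeasurable (by fun_prop)) (C := 1) ?_
    filter_upwards with w
    rw [Complex.norm_exp_ofReal_mul_I]
  have h : Complex.exp ((T * v * x : ℝ) * Complex.I) * charFun ρ (-(T * v)) =
      ∫ w, Complex.exp ((T * v * (x - w) : ℝ) * Complex.I) ∂ρ := by
    rw [charFun_apply_real, ← integral_const_mul]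
    congr 1
    ext w
    rw [← Complex.exp_add]
    congr 1
    push_cast
    ring
  have hs : ∀ w, 2 * Real.pi * (T / (2 * Real.pi) * (x - w)) * v = T * v * (x - w) := by
    intro w
    field_simp
  unfold vaalerFourier
  simp only [hs]
  rw [h, ← Complex.reCLM_apply, ← Complex.imCLM_apply,
    ← ContinuousLinearMap.integral_comp_comm _ hi, ← ContinuousLinearMap.integral_comp_comm _ hi]
  simp only [Complex.reCLM_apply, Complex.imCLM_apply, Complex.exp_ofReal_mul_I_re,
    Complex.exp_ofReal_mul_I_im]
  have bs : Integrable (fun w => Real.sin (T * v * (x - w))) ρ :=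
    Integrable.of_bound (Continuous.aestronglyMeasurable (by fun_prop)) (C := 1)
      (ae_of_all _ fun w => Real.abs_sin_le_one _)
  have bc : Integrable (fun w => Real.cos (T * v * (x - w))) ρ :=
    Integrable.of_bound (Continuous.aestronglyMeasurable (by fun_prop)) (C := 1)
      (ae_of_all _ fun w => Real.abs_cos_le_one _)
  rw [integral_add (bs.const_mul _) ((bc.const_mul _).const_mul _)]
  simp only [integral_const_mul]

lemma mul_im_add_mul_re_le (a b : ℝ) (z : ℂ) : |a * z.im + b * z.re| ≤ √(b ^ 2 + a ^ 2) * ‖z‖ := by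
  rw [← Real.sqrt_sq (norm_nonneg z), ← Real.sqrt_mul (by positivity)]
  refine Real.abs_le_sqrt ?_
  rw [Complex.sq_norm, Complex.normSq_apply]
  nlinarith [sq_nonneg (a * z.re - b * z.im)]

/-- Smoothing inequality of Prawitz type: the Kolmogorov distance to the standard normal law is
controlled by the difference of characteristic functions on `[0, T]`. -/
theorem abs_measureReal_Iic_sub_gaussian_le (ρ : Measure ℝ) [IsProbabilityMeasure ρ]
    (hρ : Integrable id ρ) {T : ℝ} (hT : 0 < T) {g : ℝ → ℝ} (hg : IntervalIntegrable g volume 0 1)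
    (hgb : ∀ v, 0 < v → v < 1 → √((1 - v) ^ 2 + vaalerWeight v ^ 2) *
      ‖charFun ρ (T * v) - charFun (gaussianReal 0 1) (T * v)‖ ≤ g v) (x : ℝ) :
    |ρ.real (Set.Iic x) - (gaussianReal 0 1).real (Set.Iic x)| ≤
      √(Real.pi / 2) / T + ∫ v in (0:ℝ)..1, g v := by
  set γ : Measure ℝ := gaussianReal 0 1
  have hγ : Integrable id γ := by
    simpa using (memLp_id_gaussianReal (μ := 0) (v := 1) 1).integrable (by simp)
  set c : ℝ := T / (2 * Real.pi) with hc
  have hc0 : 0 < c := by positivity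
  have main : ∀ ε : ℝ, |ε| = 1 → ε * (ρ.real (Set.Iic x) - γ.real (Set.Iic x)) ≤
      √(Real.pi / 2) / T + ∫ v in (0:ℝ)..1, g v := by
    intro ε hε
    have hind : ∀ w : ℝ, (Set.Ici (0:ℝ)).indicator (1 : ℝ → ℝ) (c * (x - w)) =
        (Set.Iic x).indicator 1 w := by
      intro w
      by_cases h : w ≤ x
      · rw [Set.indicator_of_mem, Set.indicator_of_mem (by simpa using h)]
        · simp
        · simp only [Set.mem_Ici]
          have := sub_nonneg.2 h
          positivity
      · rw [Set.indicator_of_notMem, Set.indicator_of_notMem (by simpa using h)]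
        simp only [Set.mem_Ici, not_le]
        have := sub_neg.2 (not_le.1 h)
        exact mul_neg_of_pos_of_neg hc0 this
    have herr : ∀ (θ : Measure ℝ) [IsProbabilityMeasure θ], Integrable id θ →
        ∫ w, vaalerError ε (c * (x - w)) ∂θ =
        ε * (1 / 2 + (∫ v in (0:ℝ)..1, ∫ w, vaalerFourier ε (c * (x - w)) v ∂θ)
          - θ.real (Set.Iic x)) := by
      intro θ _ hθ
      have hu := integrable_uncurry_vaalerFourier hε θ hθ T x
      unfold vaalerError
      simp only [intervalIntegral.integral_of_le zero_le_one, hind]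
      have i1 : Integrable (fun w => ∫ v in Set.Ioc (0:ℝ) 1, vaalerFourier ε (c * (x - w)) v) θ :=
        hu.integral_prod_left
      have i2 : Integrable (fun w => (Set.Iic x).indicator (1 : ℝ → ℝ) w) θ :=
        (integrable_const 1).indicator measurableSet_Iic
      have i3 : Integrable (fun w => 1 / 2 +
          ∫ v in Set.Ioc (0:ℝ) 1, vaalerFourier ε (c * (x - w)) v) θ := (integrable_const _).add i1
      rw [integral_const_mul, integral_sub i3 i2,
        integral_add (integrable_const _) i1, integral_indicator_one measurableSet_Iic,
        integral_integral_swap hu]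
      simp [hc]
    have h1 : 0 ≤ ∫ w, vaalerError ε (c * (x - w)) ∂ρ :=
      integral_nonneg fun w => vaalerError_nonneg hε _
    rw [herr ρ hρ] at h1
    have h2 : ∫ w, vaalerError ε (c * (x - w)) ∂γ ≤ √(Real.pi / 2) / T := by
      have hcomp : ∫ w, vaalerError ε (c * (x - w)) ≤ Real.pi / T := by
        have := integral_sub_left_eq_self (fun w => vaalerError ε (c * w)) volume x
        rw [this, Measure.integral_comp_mul_left, smul_eq_mul, abs_of_pos (by positivity)]
        calc c⁻¹ * ∫ y, vaalerError ε y ≤ c⁻¹ * (1 / 2) := by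
              gcongr
              exact integral_vaalerError_le hε
          _ = _ := by rw [hc]; field_simp
      have hint : Integrable (fun w => vaalerError ε (c * (x - w))) :=
        ((integrable_vaalerError hε).comp_mul_left' hc0.ne').comp_sub_left x
      rw [integral_gaussianReal_eq_integral_smul one_ne_zero]
      calc ∫ w, gaussianPDFReal 0 1 w • vaalerError ε (c * (x - w))
          ≤ ∫ w, (√(2 * Real.pi))⁻¹ * vaalerError ε (c * (x - w)) := by
            refine integral_mono_of_nonneg (ae_of_all _ fun w => ?_) (hint.const_mul _)
              (ae_of_all _ fun w => ?_)
            · exact mul_nonneg (gaussianPDFReal_nonneg _ _ _) (vaalerError_nonneg hε _)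
            · refine mul_le_mul_of_nonneg_right ?_ (vaalerError_nonneg hε _)
              rw [gaussianPDFReal]
              simp only [NNReal.coe_one, mul_one]
              refine mul_le_of_le_one_right (by positivity) ?_
              rw [Real.exp_le_one_iff]
              have := sq_nonneg (w - 0)
              linarith
        _ = (√(2 * Real.pi))⁻¹ * ∫ w, vaalerError ε (c * (x - w)) := integral_const_mul _ _
        _ ≤ (√(2 * Real.pi))⁻¹ * (Real.pi / T) := by gcongr
        _ = √(Real.pi / 2) / T := by
            rw [← mul_div_assoc]
            congr 1
            rw [inv_mul_eq_div, div_eq_iff (by positivity), ← Real.sqrt_mul (by positivity)]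
            have : Real.pi / 2 * (2 * Real.pi) = Real.pi ^ 2 := by ring
            rw [this, Real.sqrt_sq Real.pi_pos.le]
    rw [herr γ hγ] at h2
    have h3 : |∫ v in (0:ℝ)..1, ((∫ w, vaalerFourier ε (c * (x - w)) v ∂ρ) -
        ∫ w, vaalerFourier ε (c * (x - w)) v ∂γ)| ≤ ∫ v in (0:ℝ)..1, g v := by
      rw [← Real.norm_eq_abs]
      refine intervalIntegral.norm_integral_le_of_norm_le zero_le_one ?_ hg
      have hne : ∀ᵐ v : ℝ, v ≠ 1 := by simp [ae_iff]
      filter_upwards [hne] with v hv1 hv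
      have hv1' : v < 1 := lt_of_le_of_ne hv.2 hv1
      refine le_trans ?_ (hgb v hv.1 hv1')
      rw [hc, integral_vaalerFourier_eq_charFun, integral_vaalerFourier_eq_charFun]
      set z : ℂ := Complex.exp ((T * v * x : ℝ) * Complex.I) *
        (charFun ρ (-(T * v)) - charFun γ (-(T * v))) with hz
      have hzn : ‖z‖ = ‖charFun ρ (T * v) - charFun γ (T * v)‖ := by
        rw [hz, norm_mul, Complex.norm_exp_ofReal_mul_I, one_mul, charFun_neg, charFun_neg,
          ← map_sub, Complex.norm_conj]
      have h := mul_im_add_mul_re_le (vaalerWeight v) (ε * (1 - v)) z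
      have e2 : (ε * (1 - v)) ^ 2 = (1 - v) ^ 2 := by
        rw [mul_pow, ← sq_abs ε, hε]; ring
      rw [e2, hzn] at h
      refine le_trans (le_of_eq ?_) h
      rw [Real.norm_eq_abs]
      congr 1
      rw [hz, mul_sub, Complex.sub_im, Complex.sub_re]
      ring
    have hI : ∀ (θ : Measure ℝ) [IsProbabilityMeasure θ], Integrable id θ →
        IntervalIntegrable (fun v => ∫ w, vaalerFourier ε (c * (x - w)) v ∂θ) volume 0 1 := by
      intro θ _ hθ
      rw [intervalIntegrable_iff_integrableOn_Ioc_of_le zero_le_one]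
      exact (integrable_uncurry_vaalerFourier hε θ hθ T x).integral_prod_right
    rw [intervalIntegral.integral_sub (hI ρ hρ) (hI γ hγ)] at h3
    set A := ∫ v in (0:ℝ)..1, ∫ w, vaalerFourier ε (c * (x - w)) v ∂ρ
    set A' := ∫ v in (0:ℝ)..1, ∫ w, vaalerFourier ε (c * (x - w)) v ∂γ
    have h4 : ε * (A - A') ≤ ∫ v in (0:ℝ)..1, g v := by
      refine (le_abs_self _).trans ?_
      rwa [abs_mul, hε, one_mul]
    nlinarith
  rw [abs_le]
  constructor
  · have := main (-1) (by simp)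
    linarith
  · have := main 1 (by simp)
    linarith

/-! ### Elementary inequalities -/

lemma Real.cos_le_one_sub_sq_add_pow_four {x : ℝ} (hx : 0 ≤ x) :
    Real.cos x ≤ 1 - x ^ 2 / 2 + x ^ 4 / 24 := by
  have hmono : MonotoneOn (fun t : ℝ => 1 - t ^ 2 / 2 + t ^ 4 / 24 - Real.cos t) (Set.Ici 0) := by
    have hd : ∀ t : ℝ, HasDerivAt (fun t : ℝ => 1 - t ^ 2 / 2 + t ^ 4 / 24 - Real.cos t)
        (-t + t ^ 3 / 6 + Real.sin t) t := by
      intro t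
      have := (((((hasDerivAt_id t).pow 2).div_const 2).const_sub 1).add
        (((hasDerivAt_id t).pow 4).div_const 24)).sub (Real.hasDerivAt_cos t)
      refine this.congr_deriv ?_
      simp
      ring
    refine monotoneOn_of_deriv_nonneg (convex_Ici 0)
      (fun t _ => (hd t).continuousAt.continuousWithinAt)
      (fun t _ => (hd t).differentiableAt.differentiableWithinAt) fun t ht => ?_
    rw [interior_Ici] at ht
    rw [(hd t).deriv]
    have := Real.sin_ge_sub_cube (le_of_lt ht)
    linarith
  have := hmono (Set.mem_Ici.2 le_rfl) (Set.mem_Ici.2 hx) hx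
  simp at this
  linarith

lemma Real.cos_sub_one_add_sq_le (x : ℝ) : Real.cos x - 1 + x ^ 2 / 2 ≤ |x| ^ 3 / 10 := by
  rw [← Real.cos_abs, ← sq_abs]
  have hx := abs_nonneg x
  generalize |x| = y at hx
  rcases le_total y 2.4 with h | h
  · have := Real.cos_le_one_sub_sq_add_pow_four hx
    have h3 : 0 ≤ y ^ 3 := by positivity
    nlinarith
  rcases le_total y 5 with h5 | h5
  · have h1 := Real.one_sub_sq_div_two_le_cos (x := y - Real.pi)
    rw [Real.cos_sub_pi] at h1
    have hp1 := Real.pi_gt_d4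
    have hp2 := Real.pi_lt_d4
    have h2 : Real.pi ^ 2 ≤ 3.1416 ^ 2 := by gcongr
    have h4 : 3.1415 * y ≤ Real.pi * y := by gcongr
    have h6 := mul_nonneg (sub_nonneg.2 (h.trans' (by norm_num : (1.734:ℝ) ≤ 2.4)))
      (sq_nonneg (y - 4.133))
    norm_num at h2 h4 h6 ⊢
    nlinarith
  · have := Real.cos_le_one y
    nlinarith [mul_nonneg (sub_nonneg.2 h5) (sq_nonneg y)]

lemma norm_cexp_mul_I_taylor_two (x : ℝ) :
    ‖Complex.exp (x * Complex.I) - 1 - x * Complex.I + x ^ 2 / 2‖ ≤ |x| ^ 3 / 6 := by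
  have hexp : ∀ t : ℝ, HasDerivAt (fun t : ℝ => Complex.exp (t * Complex.I))
      (Complex.I * Complex.exp (t * Complex.I)) t := by
    intro t
    have h1 : HasDerivAt (fun t : ℝ => (t : ℂ) * Complex.I) Complex.I t := by
      simpa using (Complex.ofRealCLM.hasDerivAt (x := t)).mul_const Complex.I
    exact h1.cexp.congr_deriv (mul_comm _ _)
  have hlin : ∀ t : ℝ, HasDerivAt (fun t : ℝ => (t : ℂ) * Complex.I) Complex.I t := fun t => by
    simpa using (Complex.ofRealCLM.hasDerivAt (x := t)).mul_const Complex.I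
  have h1 : ∀ t : ℝ, 0 ≤ t → ‖Complex.exp (t * Complex.I) - 1‖ ≤ t := by
    intro t ht
    have := Real.norm_exp_I_mul_ofReal_sub_one_le (x := t)
    rwa [mul_comm, Real.norm_of_nonneg ht] at this
  have h2 : ∀ t : ℝ, 0 ≤ t → ‖Complex.exp (t * Complex.I) - 1 - t * Complex.I‖ ≤ t ^ 2 / 2 := by
    intro t ht
    refine image_norm_le_of_norm_deriv_right_le_deriv_boundary
      (f := fun t : ℝ => Complex.exp (t * Complex.I) - 1 - t * Complex.I)
      (f' := fun t : ℝ => Complex.I * Complex.exp (t * Complex.I) - Complex.I)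
      (B := fun t => t ^ 2 / 2) (B' := fun t => t) (a := 0) (b := t)
      (Continuous.continuousOn (by fun_prop))
      (fun s _ => (((hexp s).sub_const 1).sub (hlin s)).hasDerivWithinAt) (by simp)
      (fun s => (((hasDerivAt_id s).pow 2).div_const 2).congr_deriv (by simp))
      (fun s hs => ?_) (Set.right_mem_Icc.2 ht)
    have : Complex.I * Complex.exp (s * Complex.I) - Complex.I =
      Complex.I * (Complex.exp (s * Complex.I) - 1) := by ring
    rw [this, norm_mul, Complex.norm_I, one_mul]
    exact h1 s hs.1
  have h3 : ∀ t : ℝ, 0 ≤ t →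
      ‖Complex.exp (t * Complex.I) - 1 - t * Complex.I + t ^ 2 / 2‖ ≤ t ^ 3 / 6 := by
    intro t ht
    have hsq : ∀ s : ℝ, HasDerivAt (fun t : ℝ => (t : ℂ) ^ 2 / 2) (s : ℂ) s := by
      intro s
      have := (((Complex.ofRealCLM.hasDerivAt (x := s)).pow 2).div_const 2)
      refine this.congr_deriv ?_
      simp
    refine image_norm_le_of_norm_deriv_right_le_deriv_boundary
      (f := fun t : ℝ => Complex.exp (t * Complex.I) - 1 - t * Complex.I + t ^ 2 / 2)
      (f' := fun t : ℝ => Complex.I * Complex.exp (t * Complex.I) - Complex.I + t)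
      (B := fun t => t ^ 3 / 6) (B' := fun t => t ^ 2 / 2) (a := 0) (b := t)
      (Continuous.continuousOn (by fun_prop))
      (fun s _ => ((((hexp s).sub_const 1).sub (hlin s)).add (hsq s)).hasDerivWithinAt) (by simp)
      (fun s => (((hasDerivAt_id s).pow 3).div_const 6).congr_deriv (by simp; ring))
      (fun s hs => ?_) (Set.right_mem_Icc.2 ht)
    have : Complex.I * Complex.exp (s * Complex.I) - Complex.I + s =
      Complex.I * (Complex.exp (s * Complex.I) - 1 - s * Complex.I) := by
      ring_nf
      rw [Complex.I_sq]
      ring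
    rw [this, norm_mul, Complex.norm_I, one_mul]
    exact h2 s hs.1
  rcases le_total 0 x with hx | hx
  · rw [abs_of_nonneg hx]
    exact h3 x hx
  · have h := h3 (-x) (by linarith)
    rw [abs_of_nonpos hx]
    refine le_trans (le_of_eq ?_) h
    rw [← Complex.norm_conj]
    congr 1
    simp [← Complex.exp_conj, Complex.conj_ofNat]

lemma Complex.norm_exp_sub_one_le_of_re_le (r : ℂ) {x : ℝ} (hx : 0 < x) (h : r.re ≤ x) :
    ‖Complex.exp r - 1‖ ≤ ‖r‖ * ((Real.exp x - 1) / x) := by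
  have hd : ∀ t : ℝ, HasDerivAt (fun t : ℝ => Complex.exp (t * r)) (r * Complex.exp (t * r)) t := by
    intro t
    have h1 : HasDerivAt (fun t : ℝ => (t : ℂ) * r) r t := by
      simpa using (Complex.ofRealCLM.hasDerivAt (x := t)).mul_const r
    exact h1.cexp.congr_deriv (mul_comm _ _)
  have := image_norm_le_of_norm_deriv_right_le_deriv_boundary
    (f := fun t : ℝ => Complex.exp (t * r) - 1) (f' := fun t : ℝ => r * Complex.exp (t * r))
    (B := fun t => ‖r‖ * ((Real.exp (t * x) - 1) / x)) (B' := fun t => ‖r‖ * Real.exp (t * x))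
    (a := 0) (b := 1) (Continuous.continuousOn (by fun_prop))
    (fun s _ => ((hd s).sub_const 1).hasDerivWithinAt) (by simp)
    (fun s => by
      have h1 : HasDerivAt (fun t : ℝ => t * x) x s := by
        simpa using (hasDerivAt_id s).mul_const x
      refine (((h1.exp.sub_const 1).div_const x).const_mul ‖r‖).congr_deriv ?_
      field_simp)
    (fun s hs => by
      rw [norm_mul, Complex.norm_exp]
      gcongr
      simp only [Complex.mul_re, Complex.ofReal_re, Complex.ofReal_im, zero_mul, sub_zero]
      exact mul_le_mul_of_nonneg_left h hs.1) (Set.right_mem_Icc.2 zero_le_one)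
  simpa using this

lemma two_mul_mul_exp_le {y : ℝ} (hy : 0 ≤ y) : 2 * y * Real.exp y ≤ Real.exp (2 * y) - 1 := by
  have h := Real.self_le_sinh_iff.2 hy
  rw [Real.sinh_eq] at h
  have h1 : Real.exp (2 * y) = Real.exp y * Real.exp y := by rw [← Real.exp_add]; ring_nf
  have h2 : Real.exp (-y) * Real.exp y = 1 := by rw [← Real.exp_add]; simp
  have := Real.exp_pos y
  nlinarith

lemma two_mul_mul_exp_sub_one_le {X Y : ℝ} (hX : 0 ≤ X) (hY : 0 ≤ Y) :
    2 * (X * (Real.exp Y - 1)) ≤ Real.exp (X + Y) - 1 - (X + Y) := by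
  have h1 := two_mul_mul_exp_le hY
  have h2 := Real.quadratic_le_exp_of_nonneg hX
  have h3 : Real.exp (2 * Y) = Real.exp Y * Real.exp Y := by rw [← Real.exp_add]; ring_nf
  rw [h3] at h1
  rw [Real.exp_add]
  have hp := Real.exp_pos Y
  set E := Real.exp Y
  have h4 : 0 ≤ (X * E - (E - 1)) ^ 2 := sq_nonneg _
  have h5 : 2 * E * (X * (E - 1)) ≤ E * (E - 1 - Y + X * (E - 1) + X ^ 2 / 2 * E) := by
    nlinarith
  have h6 : 2 * (X * (E - 1)) ≤ E - 1 - Y + X * (E - 1) + X ^ 2 / 2 * E := by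
    nlinarith
  nlinarith

lemma vaaler_weight_bound {v b : ℝ} (h0 : 0 < v) (h1 : v < 1) (hb : 0 < b) :
    Real.pi * v * √((1 - v) ^ 2 + vaalerWeight v ^ 2) * ((Real.exp (v * b) - 1) / (v * b)) ≤
      2.5432 * ((Real.exp b - 1 - b) / b ^ 2) := by
  have hpi := Real.pi_pos
  have hs := sin_pi_mul_pos h0 h1
  have hE : 0 ≤ Real.exp (v * b) - 1 := by
    have := Real.add_one_le_exp (v * b)
    have : 0 < v * b := by positivity
    linarith
  rcases le_total v (1 / 2) with hv | hv
  · have hW : Real.pi * v * √((1 - v) ^ 2 + vaalerWeight v ^ 2) ≤ 1.2716 := by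
      have hx2 : Real.pi * v ≤ Real.pi / 2 := by nlinarith
      have hx0 : 0 < Real.pi * v := by positivity
      have hc0 : 0 ≤ Real.cos (Real.pi * v) :=
        Real.cos_nonneg_of_neg_pi_div_two_le_of_le (by linarith) hx2
      have hcot : Real.pi * v * Real.cos (Real.pi * v) ≤ Real.sin (Real.pi * v) := by
        rcases hx2.lt_or_eq with h | h
        · have := Real.lt_tan hx0 h
          rw [Real.tan_eq_sin_div_cos] at this
          have hc : 0 < Real.cos (Real.pi * v) := Real.cos_pos_of_mem_Ioo ⟨by linarith, h⟩
          rw [lt_div_iff₀ hc] at this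
          exact this.le
        · rw [h, Real.cos_pi_div_two]
          simp
      have hr : Real.pi * v * vaalerWeight v = (1 - v) *
          (Real.pi * v * Real.cos (Real.pi * v) / Real.sin (Real.pi * v)) + v := by
        unfold vaalerWeight
        field_simp
      have hq1 : Real.pi * v * Real.cos (Real.pi * v) / Real.sin (Real.pi * v) ≤ 1 := by
        rw [div_le_one hs]; exact hcot
      have hq0 : 0 ≤ Real.pi * v * Real.cos (Real.pi * v) / Real.sin (Real.pi * v) := by positivity
      have hw0 : 0 ≤ Real.pi * v * vaalerWeight v := by
        rw [hr]; have := sub_pos.2 h1; positivity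
      have hw1 : Real.pi * v * vaalerWeight v ≤ 1 := by
        rw [hr]; nlinarith
      have e : Real.pi * v * √((1 - v) ^ 2 + vaalerWeight v ^ 2) =
          √(Real.pi ^ 2 * (v * (1 - v)) ^ 2 + (Real.pi * v * vaalerWeight v) ^ 2) := by
        rw [← Real.sqrt_sq (by positivity : 0 ≤ Real.pi * v), ← Real.sqrt_mul (by positivity),
          Real.sqrt_sq (by positivity)]
        congr 1; ring
      rw [e]
      refine Real.sqrt_le_iff.2 ⟨by norm_num, ?_⟩
      have hp2 : Real.pi ^ 2 ≤ 3.1416 ^ 2 := by gcongr; exact Real.pi_lt_d4.le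
      have hv4 : v * (1 - v) ≤ 1 / 4 := by nlinarith [sq_nonneg (v - 1 / 2)]
      have hv5 : (v * (1 - v)) ^ 2 ≤ (1 / 4) ^ 2 := by
        have : 0 ≤ v * (1 - v) := mul_nonneg h0.le (sub_pos.2 h1).le
        gcongr
      have hw2 : (Real.pi * v * vaalerWeight v) ^ 2 ≤ 1 := by nlinarith
      have : Real.pi ^ 2 * (v * (1 - v)) ^ 2 ≤ 3.1416 ^ 2 * (1 / 4) ^ 2 := by gcongr
      norm_num at this ⊢
      linarith
    have hconv : Real.exp (v * b) - 1 ≤ 2 * v * (Real.exp (b / 2) - 1) := by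
      have := convexOn_exp.2 (Set.mem_univ 0) (Set.mem_univ (b / 2))
        (by linarith : 0 ≤ 1 - 2 * v) (by linarith : 0 ≤ 2 * v) (by ring)
      simp only [smul_eq_mul, mul_zero, zero_add, Real.exp_zero, mul_one] at this
      have e : 2 * v * (b / 2) = v * b := by ring
      rw [e] at this
      linarith
    have hh := two_mul_mul_exp_le (y := b / 2) (by positivity)
    have e2 : 2 * (b / 2) = b := by ring
    rw [e2] at hh
    have h6 : (Real.exp (v * b) - 1) / (v * b) ≤ 2 * ((Real.exp b - 1 - b) / b ^ 2) := by
      rw [← mul_div_assoc, div_le_div_iff₀ (by positivity) (by positivity)]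
      have h7 : b * (Real.exp (b / 2) - 1) ≤ Real.exp b - 1 - b := by linarith
      calc (Real.exp (v * b) - 1) * b ^ 2 ≤ 2 * v * (Real.exp (b / 2) - 1) * b ^ 2 := by gcongr
        _ = 2 * (b * (Real.exp (b / 2) - 1)) * (v * b) := by ring
        _ ≤ 2 * (Real.exp b - 1 - b) * (v * b) := by gcongr
    calc _ ≤ 1.2716 * (2 * ((Real.exp b - 1 - b) / b ^ 2)) :=
          mul_le_mul hW h6 (by positivity) (by norm_num)
      _ = _ := by ring
  · set e := 1 - v with he
    have he0 : 0 < e := by linarith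
    have hsin : Real.sin (Real.pi * v) = Real.sin (Real.pi * e) := by
      rw [he, mul_sub, mul_one, Real.sin_pi_sub]
    have hcos : Real.cos (Real.pi * v) = -Real.cos (Real.pi * e) := by
      rw [he, mul_sub, mul_one, Real.cos_pi_sub, neg_neg]
    have hx0 : 0 < Real.pi * e := by positivity
    have hx2 : Real.pi * e ≤ Real.pi / 2 := by nlinarith
    have hc0 : 0 ≤ Real.cos (Real.pi * e) :=
        Real.cos_nonneg_of_neg_pi_div_two_le_of_le (by linarith) hx2
    rw [hsin] at hs
    have hsc : 1 ≤ Real.sin (Real.pi * e) + Real.cos (Real.pi * e) := by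
      nlinarith [Real.sin_sq_add_cos_sq (Real.pi * e), mul_nonneg hs.le hc0]
    have hsx := Real.sin_le hx0.le
    have hcot : Real.pi * e * Real.cos (Real.pi * e) ≤ Real.sin (Real.pi * e) := by
      rcases hx2.lt_or_eq with h | h
      · have := Real.lt_tan hx0 h
        rw [Real.tan_eq_sin_div_cos] at this
        have hc : 0 < Real.cos (Real.pi * e) := Real.cos_pos_of_mem_Ioo ⟨by linarith, h⟩
        rw [lt_div_iff₀ hc] at this
        exact this.le
      · rw [h, Real.cos_pi_div_two]
        simp
    have hw : vaalerWeight v = (Real.sin (Real.pi * e) - Real.pi * e * Real.cos (Real.pi * e)) /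
        (Real.pi * Real.sin (Real.pi * e)) := by
      unfold vaalerWeight
      rw [hsin, hcos, ← he]
      have hs' := hs.ne'
      generalize Real.sin (Real.pi * e) = S at hs'
      generalize Real.cos (Real.pi * e) = C
      field_simp
      ring
    have hw0 : 0 ≤ vaalerWeight v := by
      rw [hw]; exact div_nonneg (by linarith) (by positivity)
    have hw1 : vaalerWeight v ≤ e := by
      rw [hw, div_le_iff₀ (by positivity)]
      nlinarith
    have hW : √(e ^ 2 + vaalerWeight v ^ 2) ≤ 1.415 * e := by
      refine Real.sqrt_le_iff.2 ⟨by positivity, ?_⟩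
      norm_num
      nlinarith
    have hb2 := two_mul_mul_exp_sub_one_le (X := e * b) (Y := v * b) (by positivity) (by positivity)
    have e3 : e * b + v * b = b := by rw [he]; ring
    rw [e3] at hb2
    have hp := Real.pi_lt_d4
    calc _ ≤ 3.1416 * v * (1.415 * e) * ((Real.exp (v * b) - 1) / (v * b)) := by gcongr
      _ = (3.1416 * 1.415 / 2) * (2 * (e * b * (Real.exp (v * b) - 1)) / b ^ 2) := by
          field_simp
      _ ≤ (3.1416 * 1.415 / 2) * ((Real.exp b - 1 - b) / b ^ 2) := by gcongr
      _ ≤ _ := by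
          have : 0 ≤ (Real.exp b - 1 - b) / b ^ 2 :=
            div_nonneg (by linarith [Real.add_one_le_exp b]) (by positivity)
          nlinarith

/-! ### A Gaussian integral -/

/-- The integrand controlling the Fourier side of the uniform bound. -/
noncomputable def gaussianExcess (u : ℝ) : ℝ :=
  (Real.exp (-(8 / 100 * u ^ 2)) - Real.exp (-(u ^ 2 / 2)) -
    42 / 100 * u ^ 2 * Real.exp (-(u ^ 2 / 2))) / u ^ 2

lemma gaussianExcess_eq (u : ℝ) : gaussianExcess u =
    (Real.exp (42 / 100 * u ^ 2) - 1 - 42 / 100 * u ^ 2) * Real.exp (-(u ^ 2 / 2)) / u ^ 2 := by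
  have h : Real.exp (-(8 / 100 * u ^ 2)) = Real.exp (42 / 100 * u ^ 2) * Real.exp (-(u ^ 2 / 2)) := by
    rw [← Real.exp_add]; ring_nf
  rw [gaussianExcess, h]
  ring

lemma gaussianExcess_nonneg (u : ℝ) : 0 ≤ gaussianExcess u := by
  rw [gaussianExcess_eq]
  have := Real.add_one_le_exp (42 / 100 * u ^ 2)
  have h : 0 ≤ Real.exp (42 / 100 * u ^ 2) - 1 - 42 / 100 * u ^ 2 := by linarith
  positivity

lemma Real.exp_sub_one_sub_le {b : ℝ} (hb : 0 ≤ b) : Real.exp b - 1 - b ≤ b ^ 2 * Real.exp b := by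
  have h := Real.add_one_le_exp (-b)
  have h2 : Real.exp (-b) * Real.exp b = 1 := by rw [← Real.exp_add]; simp
  have h3 := Real.exp_pos b
  have h4 : (1 - b) * Real.exp b ≤ 1 := by nlinarith
  nlinarith [mul_le_mul_of_nonneg_left h4 hb]

lemma gaussianExcess_le (u : ℝ) :
    gaussianExcess u ≤ 25 * Real.exp (-(4 / 100) * u ^ 2) := by
  rcases eq_or_ne u 0 with rfl | hu
  · simp [gaussianExcess]
  have hu2 : 0 < u ^ 2 := by positivity
  rw [gaussianExcess_eq, div_le_iff₀ hu2]
  have h1 := Real.exp_sub_one_sub_le (b := 42 / 100 * u ^ 2) (by positivity)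
  have h2 : Real.exp (42 / 100 * u ^ 2) * Real.exp (-(u ^ 2 / 2)) =
      Real.exp (-(4 / 100) * u ^ 2) * Real.exp (-(4 / 100 * u ^ 2)) := by
    rw [← Real.exp_add, ← Real.exp_add]; ring_nf
  have h3 : 4 / 100 * u ^ 2 * Real.exp (-(4 / 100 * u ^ 2)) ≤ 1 := by
    have h4 := Real.add_one_le_exp (4 / 100 * u ^ 2)
    have h5 : Real.exp (4 / 100 * u ^ 2) * Real.exp (-(4 / 100 * u ^ 2)) = 1 := by
      rw [← Real.exp_add]; simp
    have := Real.exp_pos (-(4 / 100 * u ^ 2))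
    nlinarith
  have h6 := Real.exp_pos (-(4 / 100) * u ^ 2)
  calc (Real.exp (42 / 100 * u ^ 2) - 1 - 42 / 100 * u ^ 2) * Real.exp (-(u ^ 2 / 2))
      ≤ (42 / 100 * u ^ 2) ^ 2 * Real.exp (42 / 100 * u ^ 2) * Real.exp (-(u ^ 2 / 2)) := by gcongr
    _ = (42 / 100 * u ^ 2) ^ 2 * (Real.exp (-(4 / 100) * u ^ 2) *
          Real.exp (-(4 / 100 * u ^ 2))) := by rw [mul_assoc, h2]
    _ = (42 / 100) ^ 2 * 25 * u ^ 2 * Real.exp (-(4 / 100) * u ^ 2) *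
          (4 / 100 * u ^ 2 * Real.exp (-(4 / 100 * u ^ 2))) := by ring
    _ ≤ (42 / 100) ^ 2 * 25 * u ^ 2 * Real.exp (-(4 / 100) * u ^ 2) * 1 := by gcongr
    _ ≤ _ := by nlinarith [mul_pos hu2 h6]

lemma measurable_gaussianExcess : Measurable gaussianExcess := by
  unfold gaussianExcess
  fun_prop

lemma integrable_gaussianExcess : Integrable gaussianExcess := by
  refine Integrable.mono' ((integrable_exp_neg_mul_sq (b := 4 / 100) (by norm_num)).const_mul 25)
    measurable_gaussianExcess.aestronglyMeasurable (ae_of_all _ fun u => ?_)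
  rw [Real.norm_of_nonneg (gaussianExcess_nonneg u)]
  exact gaussianExcess_le u

lemma integral_Ioi_gaussianExcess :
    ∫ u in Set.Ioi (0:ℝ), gaussianExcess u = 18 / 100 * √(Real.pi / 2) := by
  set F : ℝ → ℝ := fun u => -((Real.exp (-(8 / 100 * u ^ 2)) - Real.exp (-(u ^ 2 / 2))) / u)
  have iA : Integrable (fun u : ℝ => Real.exp (-(8 / 100) * u ^ 2)) :=
    integrable_exp_neg_mul_sq (by norm_num)
  have iB : Integrable (fun u : ℝ => Real.exp (-(1 / 2) * u ^ 2)) :=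
    integrable_exp_neg_mul_sq (by norm_num)
  have hA : ∀ u : ℝ, HasDerivAt (fun u => Real.exp (-(8 / 100 * u ^ 2)))
      (-(16 / 100 * u) * Real.exp (-(8 / 100 * u ^ 2))) u := by
    intro u
    have := ((((hasDerivAt_id u).pow 2).const_mul (8 / 100)).neg).exp
    refine this.congr_deriv ?_
    simp
    ring
  have hB : ∀ u : ℝ, HasDerivAt (fun u => Real.exp (-(u ^ 2 / 2)))
      (-u * Real.exp (-(u ^ 2 / 2))) u := by
    intro u
    have := ((((hasDerivAt_id u).pow 2).div_const 2).neg).exp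
    refine this.congr_deriv ?_
    simp
    ring
  have hF : ∀ u ∈ Set.Ioi (0:ℝ), HasDerivAt F (gaussianExcess u +
      16 / 100 * Real.exp (-(8 / 100) * u ^ 2) - 58 / 100 * Real.exp (-(1 / 2) * u ^ 2)) u := by
    intro u hu
    have hu0 : u ≠ 0 := (Set.mem_Ioi.1 hu).ne'
    have := (((hA u).sub (hB u)).div (hasDerivAt_id u) hu0).neg
    refine this.congr_deriv ?_
    have e1 : -(8 / 100) * u ^ 2 = -(8 / 100 * u ^ 2) := by ring
    have e2 : -(1 / 2) * u ^ 2 = -(u ^ 2 / 2) := by ring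
    rw [gaussianExcess, e1, e2]
    simp only [id, Pi.sub_apply]
    generalize Real.exp (-(8 / 100 * u ^ 2)) = A
    generalize Real.exp (-(u ^ 2 / 2)) = B
    field_simp
    ring
  have hc : ContinuousWithinAt F (Set.Ici 0) 0 := by
    have h0 := ((hA 0).sub (hB 0)).neg
    rw [hasDerivAt_iff_tendsto_slope] at h0
    have : ContinuousAt F 0 := by
      rw [continuousAt_iff_punctured_nhds]
      have e : F 0 = -(-(16 / 100 * 0) * Real.exp (-(8 / 100 * 0 ^ 2)) -
          -0 * Real.exp (-((0:ℝ) ^ 2 / 2))) := by simp [F]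
      rw [e]
      refine h0.congr fun u => ?_
      simp [F, slope_def_field]
      ring
    exact this.continuousWithinAt
  have hlim : Tendsto F atTop (𝓝 0) := by
    have h1 : Tendsto (fun u : ℝ => 2 / u) atTop (𝓝 0) := tendsto_const_nhds.div_atTop tendsto_id
    refine squeeze_zero_norm' ?_ h1
    filter_upwards [eventually_gt_atTop 0] with u hu
    simp only [F, norm_neg, norm_div, Real.norm_eq_abs, abs_of_pos hu]
    gcongr
    have a1 : Real.exp (-(8 / 100 * u ^ 2)) ≤ 1 := Real.exp_le_one_iff.2 (by nlinarith [sq_nonneg u])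
    have a2 : Real.exp (-(u ^ 2 / 2)) ≤ 1 := Real.exp_le_one_iff.2 (by nlinarith [sq_nonneg u])
    rw [abs_le]
    constructor <;> linarith [Real.exp_pos (-(8 / 100 * u ^ 2)), Real.exp_pos (-(u ^ 2 / 2))]
  have h := integral_Ioi_of_hasDerivAt_of_tendsto hc hF
    (((integrable_gaussianExcess.add (iA.const_mul _)).sub (iB.const_mul _)).integrableOn) hlim
  have h2 : ∫ u in Set.Ioi (0:ℝ), (gaussianExcess u +
      16 / 100 * Real.exp (-(8 / 100) * u ^ 2) - 58 / 100 * Real.exp (-(1 / 2) * u ^ 2)) =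
      (∫ u in Set.Ioi (0:ℝ), gaussianExcess u) + 16 / 100 * (√(Real.pi / (8 / 100)) / 2) -
        58 / 100 * (√(Real.pi / (1 / 2)) / 2) := by
    have i3 : Integrable (fun u => gaussianExcess u + 16 / 100 * Real.exp (-(8 / 100) * u ^ 2))
        (volume.restrict (Set.Ioi 0)) :=
      (integrable_gaussianExcess.add (iA.const_mul _)).integrableOn
    rw [integral_sub i3 (iB.const_mul _).integrableOn,
      integral_add integrable_gaussianExcess.integrableOn (iA.const_mul _).integrableOn,
      integral_const_mul, integral_const_mul, integral_gaussian_Ioi, integral_gaussian_Ioi]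
  rw [h2] at h
  have e1 : √(Real.pi / (8 / 100)) = 5 * √(Real.pi / 2) := by
    have : Real.pi / (8 / 100) = 5 ^ 2 * (Real.pi / 2) := by ring
    rw [this, Real.sqrt_mul (by positivity), Real.sqrt_sq (by norm_num)]
  have e2 : √(Real.pi / (1 / 2)) = 2 * √(Real.pi / 2) := by
    have : Real.pi / (1 / 2) = 2 ^ 2 * (Real.pi / 2) := by ring
    rw [this, Real.sqrt_mul (by positivity), Real.sqrt_sq (by norm_num)]
  rw [e1, e2] at h
  have e0 : F 0 = 0 := by simp [F]
  rw [e0] at h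
  linarith

/-! ### Uniform bound for infinitely divisible laws -/

/-- The Lévy exponent kernel with linear compensation. -/
noncomputable def levyKernel (u y : ℝ) : ℂ :=
  Complex.exp ((u * y : ℝ) * Complex.I) - 1 - (u * y : ℝ) * Complex.I

lemma norm_levyKernel_add_sq_le (u y : ℝ) :
    ‖levyKernel u y + ((u * y) ^ 2 / 2 : ℝ)‖ ≤ |u| ^ 3 * |y| ^ 3 / 6 := by
  have := norm_cexp_mul_I_taylor_two (u * y)
  rw [abs_mul, mul_pow] at this
  simpa [levyKernel] using this

lemma measurable_levyKernel (u : ℝ) : Measurable (levyKernel u) := by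
  unfold levyKernel
  fun_prop

lemma integrable_levyKernel {ν : Measure ℝ} (h2 : Integrable (fun y => y ^ 2) ν)
    (h3 : Integrable (fun y => |y| ^ 3) ν) (u : ℝ) : Integrable (levyKernel u) ν := by
  have h : Integrable (fun y => levyKernel u y + ((u * y) ^ 2 / 2 : ℝ)) ν := by
    refine Integrable.mono' ((h3.const_mul (|u| ^ 3)).div_const 6) ?_
      (ae_of_all _ (norm_levyKernel_add_sq_le u))
    have := measurable_levyKernel u
    exact Measurable.aestronglyMeasurable (by fun_prop)
  have h' : Integrable (fun y : ℝ => (((u * y) ^ 2 / 2 : ℝ) : ℂ)) ν := by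
    refine Integrable.ofReal ?_
    simp only [mul_pow]
    exact (h2.const_mul _).div_const 2
  refine (h.sub h').congr (ae_of_all _ fun y => ?_)
  simp

lemma levyKernel_re_add_sq_le (u y : ℝ) :
    (levyKernel u y).re + (u * y) ^ 2 / 2 ≤ |u| ^ 3 * |y| ^ 3 / 10 := by
  have := Real.cos_sub_one_add_sq_le (u * y)
  rw [abs_mul, mul_pow |u|] at this
  have e : (levyKernel u y).re = Real.cos (u * y) - 1 := by
    simp only [levyKernel, Complex.sub_re, Complex.exp_ofReal_mul_I_re]
    simp
  rw [e]
  exact this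

lemma integral_abs_pow_three_pos {ν : Measure ℝ} (h3 : Integrable (fun y => |y| ^ 3) ν)
    (hV : ∫ y, y ^ 2 ∂ν ≠ 0) : 0 < ∫ y, |y| ^ 3 ∂ν := by
  refine lt_of_le_of_ne (integral_nonneg fun y => by positivity) fun h => hV ?_
  rw [eq_comm, integral_eq_zero_iff_of_nonneg (fun y => by positivity) h3] at h
  refine integral_eq_zero_of_ae ?_
  filter_upwards [h] with y hy
  have : |y| = 0 := by simpa using hy
  simp [abs_eq_zero.1 this]

lemma charFun_gaussian_standard (u : ℝ) :
    charFun (gaussianReal 0 1) u = Complex.exp ((-(u ^ 2 / 2) : ℝ)) := by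
  rw [charFun_gaussianReal]
  congr 1
  push_cast
  simp

lemma norm_charFun_sub_gaussian_le {ρ ν : Measure ℝ} (h2 : Integrable (fun y => y ^ 2) ν)
    (h3 : Integrable (fun y => |y| ^ 3) ν) (hV : ∫ y, y ^ 2 ∂ν = 1)
    (hchar : ∀ u, charFun ρ u = Complex.exp (∫ y, levyKernel u y ∂ν)) {u : ℝ} (hu : 0 < u) :
    ‖charFun ρ u - charFun (gaussianReal 0 1) u‖ ≤
      Real.exp (-(u ^ 2 / 2)) * ((∫ y, |y| ^ 3 ∂ν) * u ^ 3 / 6 *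
        ((Real.exp ((∫ y, |y| ^ 3 ∂ν) * u ^ 3 / 10) - 1) / ((∫ y, |y| ^ 3 ∂ν) * u ^ 3 / 10))) := by
  have hL := integral_abs_pow_three_pos h3 (by rw [hV]; norm_num)
  set L := ∫ y, |y| ^ 3 ∂ν with hLdef
  have hk := integrable_levyKernel h2 h3 u
  have hsq : Integrable (fun y : ℝ => (((u * y) ^ 2 / 2 : ℝ) : ℂ)) ν := by
    refine Integrable.ofReal ?_
    simp only [mul_pow]
    exact (h2.const_mul _).div_const 2
  set r : ℂ := ∫ y, (levyKernel u y + ((u * y) ^ 2 / 2 : ℝ)) ∂ν with hr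
  have hr_eq : ∫ y, levyKernel u y ∂ν = r + ((-(u ^ 2 / 2) : ℝ) : ℂ) := by
    rw [hr, integral_add hk hsq, integral_complex_ofReal]
    simp only [mul_pow]
    rw [integral_div, integral_const_mul, hV]
    push_cast
    ring
  have hrn : ‖r‖ ≤ L * u ^ 3 / 6 := by
    refine (norm_integral_le_of_norm_le ((h3.const_mul (|u| ^ 3)).div_const 6)
      (ae_of_all _ (norm_levyKernel_add_sq_le u))).trans (le_of_eq ?_)
    rw [integral_div, integral_const_mul, abs_of_pos hu]
    ring
  have hrr : r.re ≤ L * u ^ 3 / 10 := by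
    have hi : Integrable (fun y => levyKernel u y + ((u * y) ^ 2 / 2 : ℝ)) ν := hk.add hsq
    rw [hr, ← Complex.reCLM_apply, ← ContinuousLinearMap.integral_comp_comm _ hi]
    have e : L * u ^ 3 / 10 = ∫ y, |u| ^ 3 * |y| ^ 3 / 10 ∂ν := by
      rw [integral_div, integral_const_mul, abs_of_pos hu]; ring
    rw [e]
    refine integral_mono hi.re ((h3.const_mul _).div_const _) fun y => ?_
    have := levyKernel_re_add_sq_le u y
    simpa [-Complex.ofReal_div, -Complex.ofReal_pow, -Complex.ofReal_mul] using this
  rw [hchar, charFun_gaussian_standard, hr_eq, Complex.exp_add]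
  have e : Complex.exp r * Complex.exp ((-(u ^ 2 / 2) : ℝ)) - Complex.exp ((-(u ^ 2 / 2) : ℝ)) =
      Complex.exp ((-(u ^ 2 / 2) : ℝ)) * (Complex.exp r - 1) := by ring
  rw [e, norm_mul, ← Complex.ofReal_exp, Complex.norm_of_nonneg (Real.exp_pos _).le]
  gcongr
  refine (Complex.norm_exp_sub_one_le_of_re_le r (by positivity) hrr).trans ?_
  gcongr
  have := Real.add_one_le_exp (L * u ^ 3 / 10)
  have h0 : 0 < L * u ^ 3 / 10 := by positivity
  exact div_nonneg (by linarith) h0.le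

theorem uniform_bound_standardized {ρ ν : Measure ℝ} [IsProbabilityMeasure ρ]
    (hρ : Integrable id ρ) (h2 : Integrable (fun y => y ^ 2) ν)
    (h3 : Integrable (fun y => |y| ^ 3) ν) (hV : ∫ y, y ^ 2 ∂ν = 1)
    (hchar : ∀ u, charFun ρ u = Complex.exp (∫ y, levyKernel u y ∂ν)) (x : ℝ) :
    |ρ.real (Set.Iic x) - (gaussianReal 0 1).real (Set.Iic x)| ≤ 0.4785 * ∫ y, |y| ^ 3 ∂ν := by
  have hL := integral_abs_pow_three_pos h3 (by rw [hV]; norm_num)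
  have hb := fun u hu => norm_charFun_sub_gaussian_le h2 h3 hV hchar (u := u) hu
  set L := ∫ y, |y| ^ 3 ∂ν with hLdef
  have hpi := Real.pi_pos
  set T : ℝ := 4.2 / L with hT
  have hT0 : 0 < T := by positivity
  have hLT : L * T = 4.2 := by rw [hT]; field_simp
  set κ : ℝ := 4.2 * 2.5432 / (6 * Real.pi) / 0.42 ^ 2 with hκ
  have hκ0 : 0 ≤ κ := by positivity
  have hg : IntervalIntegrable (fun v => κ * gaussianExcess (T * v)) volume 0 1 :=
    ((integrable_gaussianExcess.comp_mul_left' hT0.ne').const_mul κ).intervalIntegrable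
  refine (abs_measureReal_Iic_sub_gaussian_le ρ hρ hT0 hg ?_ x).trans ?_
  · intro v h0 h1
    set u := T * v with hu
    have hu0 : 0 < u := by positivity
    set b := 0.42 * u ^ 2 with hbdef
    have hb0 : 0 < b := by positivity
    have hLu : L * u ^ 3 / 10 = v * b := by
      have : L * u ^ 3 = (L * T) * v * u ^ 2 := by rw [hu]; ring
      rw [this, hLT, hbdef]; ring
    have h6 : L * u ^ 3 / 6 = 4.2 * v * u ^ 2 / 6 := by
      have : L * u ^ 3 = (L * T) * v * u ^ 2 := by rw [hu]; ring
      rw [this, hLT]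
    have hW := vaaler_weight_bound h0 h1 hb0
    have hbu := hb u hu0
    rw [hLu, h6] at hbu
    have hE := Real.exp_pos (-(u ^ 2 / 2))
    calc _ ≤ √((1 - v) ^ 2 + vaalerWeight v ^ 2) * (Real.exp (-(u ^ 2 / 2)) *
          (4.2 * v * u ^ 2 / 6 * ((Real.exp (v * b) - 1) / (v * b)))) := by gcongr
      _ = 4.2 * u ^ 2 / (6 * Real.pi) * Real.exp (-(u ^ 2 / 2)) *
          (Real.pi * v * √((1 - v) ^ 2 + vaalerWeight v ^ 2) *
            ((Real.exp (v * b) - 1) / (v * b))) := by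
          field_simp
      _ ≤ 4.2 * u ^ 2 / (6 * Real.pi) * Real.exp (-(u ^ 2 / 2)) *
          (2.5432 * ((Real.exp b - 1 - b) / b ^ 2)) := by gcongr
      _ = κ * gaussianExcess u := by
          have e : (42 / 100 : ℝ) * u ^ 2 = b := by rw [hbdef]; norm_num
          rw [gaussianExcess_eq, e, hκ]
          have e2 : b ^ 2 = 0.42 ^ 2 * u ^ 2 * u ^ 2 := by rw [hbdef]; ring
          rw [e2]
          field_simp
  · have hint : ∫ v in (0:ℝ)..1, κ * gaussianExcess (T * v) ≤
        κ * (T⁻¹ * (18 / 100 * √(Real.pi / 2))) := by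
      rw [intervalIntegral.integral_const_mul,
        intervalIntegral.integral_comp_mul_left gaussianExcess hT0.ne', smul_eq_mul, mul_zero,
        mul_one, ← integral_Ioi_gaussianExcess, intervalIntegral.integral_of_le hT0.le]
      gcongr κ * (T⁻¹ * ?_)
      exact setIntegral_mono_set integrable_gaussianExcess.integrableOn
        (ae_of_all _ gaussianExcess_nonneg) (LE.le.eventuallyLE fun v hv => hv.1)
    have hTi : T⁻¹ = L / 4.2 := by rw [hT, inv_div]
    have hs : √(Real.pi / 2) ≤ 1.2534 := by
      refine Real.sqrt_le_iff.2 ⟨by norm_num, ?_⟩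
      have := Real.pi_lt_d4
      norm_num
      linarith
    have hκ1 : κ ≤ 3.213 := by
      have h1 : 4.2 * 2.5432 / (6 * Real.pi) ≤ 4.2 * 2.5432 / (6 * 3.1415) := by
        gcongr; exact Real.pi_gt_d4.le
      rw [hκ]
      refine (div_le_div_of_nonneg_right h1 (by positivity)).trans ?_
      norm_num
    rw [hTi] at hint
    have h5 : κ * (L / 4.2 * (18 / 100 * √(Real.pi / 2))) ≤
        3.213 * (L / 4.2 * (18 / 100 * 1.2534)) := by gcongr
    have h7 : √(Real.pi / 2) / T ≤ 1.2534 * (L / 4.2) := by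
      rw [div_eq_mul_inv, hTi]; gcongr
    have h8 : (0.4785 : ℝ) * L ≥ 3.213 * (L / 4.2 * (18 / 100 * 1.2534)) + 1.2534 * (L / 4.2) := by
      norm_num
      linarith
    linarith

/-- Berry–Esseen bound for laws with Lévy–Khintchine exponent
`i u m + ∫ (exp (i u y) - 1 - i u y) dν`. -/
theorem uniform_bound {ρ ν : Measure ℝ} [IsProbabilityMeasure ρ] {m σ : ℝ} (hσ : 0 < σ)
    (hρ : Integrable id ρ) (h2 : Integrable (fun y => y ^ 2) ν)
    (h3 : Integrable (fun y => |y| ^ 3) ν) (hV : ∫ y, y ^ 2 ∂ν = σ ^ 2)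
    (hchar : ∀ u, charFun ρ u = Complex.exp ((u * m : ℝ) * Complex.I + ∫ y, levyKernel u y ∂ν))
    (w : ℝ) :
    |ρ.real (Set.Iic w) - (gaussianReal 0 1).real (Set.Iic ((w - m) / σ))| ≤
      0.4785 * ((∫ y, |y| ^ 3 ∂ν) / σ ^ 3) := by
  set ρ' := ρ.map (fun w => (w - m) / σ) with hρ'
  set ν' := ν.map (fun y => y / σ) with hν'
  have hm1 : Measurable (fun w : ℝ => (w - m) / σ) := by fun_prop
  have hm2 : Measurable (fun y : ℝ => y / σ) := by fun_prop
  have : IsProbabilityMeasure ρ' := Measure.isProbabilityMeasure_map hm1.aemeasurable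
  have hL : ∫ y, |y| ^ 3 ∂ν' = (∫ y, |y| ^ 3 ∂ν) / σ ^ 3 := by
    rw [hν', integral_map hm2.aemeasurable (Continuous.aestronglyMeasurable (by fun_prop)),
      ← integral_div]
    congr 1; ext y
    rw [abs_div, abs_of_pos hσ, div_pow]
  have key := uniform_bound_standardized (ρ := ρ') (ν := ν') ?_ ?_ ?_ ?_ ?_ ((w - m) / σ)
  · rw [hL] at key
    have e : ρ'.real (Set.Iic ((w - m) / σ)) = ρ.real (Set.Iic w) := by
      rw [hρ', map_measureReal_apply hm1 measurableSet_Iic]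
      congr 1
      ext z
      simp only [Set.mem_preimage, Set.mem_Iic, div_le_div_iff_of_pos_right hσ, sub_le_sub_iff_right]
    rwa [e] at key
  · rw [hρ', integrable_map_measure aestronglyMeasurable_id hm1.aemeasurable]
    exact (hρ.sub (integrable_const m)).div_const σ
  · rw [hν', integrable_map_measure (Continuous.aestronglyMeasurable (by fun_prop))
      hm2.aemeasurable]
    simp only [Function.comp_def, div_pow]
    exact h2.div_const _
  · rw [hν', integrable_map_measure (Continuous.aestronglyMeasurable (by fun_prop))
      hm2.aemeasurable]
    simp only [Function.comp_def, abs_div, div_pow]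
    exact h3.div_const _
  · rw [hν', integral_map hm2.aemeasurable (Continuous.aestronglyMeasurable (by fun_prop))]
    simp only [div_pow]
    rw [integral_div, hV]
    field_simp
  · intro u
    rw [hν', integral_map hm2.aemeasurable (measurable_levyKernel u).aestronglyMeasurable,
      hρ', charFun_apply_real, integral_map hm1.aemeasurable
        (Continuous.aestronglyMeasurable (by fun_prop))]
    have h := hchar (u / σ)
    have e1 : ∀ y, levyKernel (u / σ) y = levyKernel u (y / σ) := by
      intro y
      simp only [levyKernel]
      have : u / σ * y = u * (y / σ) := by ring
      rw [this]
    simp only [e1] at h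
    rw [Complex.exp_add] at h
    have h' : Complex.exp (∫ y, levyKernel u (y / σ) ∂ν) =
        Complex.exp (-((u / σ * m : ℝ) * Complex.I)) * charFun ρ (u / σ) := by
      rw [h, ← mul_assoc, ← Complex.exp_add]
      simp
    rw [h', charFun_apply_real, ← integral_const_mul]
    congr 1; ext z
    rw [← Complex.exp_add]
    congr 1
    push_cast
    field_simp
    ring

/-! ### Compound Poisson laws -/

/-- Convolution powers of a measure on the line. -/
noncomputable def convPow (ν : Measure ℝ) : ℕ → Measure ℝ
  | 0 => Measure.dirac 0
  | k + 1 => Measure.conv (convPow ν k) ν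

instance (ν : Measure ℝ) [IsFiniteMeasure ν] (k : ℕ) : IsFiniteMeasure (convPow ν k) := by
  induction k with
  | zero => rw [convPow]; infer_instance
  | succ k ih => rw [convPow]; infer_instance

/-- The compound Poisson law with finite jump measure `ν`. -/
noncomputable def compoundPoisson (ν : Measure ℝ) : Measure ℝ :=
  Measure.sum fun k => ENNReal.ofReal (Real.exp (-ν.real Set.univ) / k.factorial) • convPow ν k

lemma convPow_multiplicative {𝕜 : Type*} [RCLike 𝕜] {ν : Measure ℝ} [IsFiniteMeasure ν] {f : ℝ → 𝕜}
    (hfm : Measurable f) (hf : Integrable f ν) (h0 : f 0 = 1) (hadd : ∀ x y, f (x + y) = f x * f y)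
    (k : ℕ) : Integrable f (convPow ν k) ∧ ∫ x, f x ∂(convPow ν k) = (∫ y, f y ∂ν) ^ k := by
  induction k with
  | zero =>
    rw [convPow]
    exact ⟨integrable_dirac (by simp), by simp [h0]⟩
  | succ k ih =>
    have hi : Integrable f (Measure.conv (convPow ν k) ν) := by
      rw [integrable_conv_iff hfm.aestronglyMeasurable]
      simp only [hadd, norm_mul, integral_const_mul]
      exact ⟨ae_of_all _ fun x => hf.const_mul _, ih.1.norm.mul_const _⟩
    rw [convPow]
    refine ⟨hi, ?_⟩
    rw [integral_conv hi]
    simp only [hadd, integral_const_mul, integral_mul_const]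
    rw [ih.2, pow_succ]

lemma integrable_compoundPoisson {𝕜 : Type*} [RCLike 𝕜] {ν : Measure ℝ} [IsFiniteMeasure ν]
    {f : ℝ → 𝕜} (hfm : Measurable f) (hf : Integrable f ν) (h0 : f 0 = 1)
    (hadd : ∀ x y, f (x + y) = f x * f y) : Integrable f (compoundPoisson ν) := by
  refine integrable_sum_measure
    (fun k => (convPow_multiplicative hfm hf h0 hadd k).1.smul_measure (by simp)) ?_
  have h : ∀ k, ∫ x, ‖f x‖ ∂(convPow ν k) = (∫ y, ‖f y‖ ∂ν) ^ k := fun k =>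
    (convPow_multiplicative hfm.norm hf.norm (by simp [h0]) (by simp [hadd]) k).2
  simp only [integral_smul_measure, h]
  refine ((Real.summable_pow_div_factorial (∫ y, ‖f y‖ ∂ν)).mul_left
    (Real.exp (-ν.real Set.univ))).congr fun k => ?_
  rw [ENNReal.toReal_ofReal (by positivity), smul_eq_mul]
  ring

lemma integral_compoundPoisson {ν : Measure ℝ} [IsFiniteMeasure ν]
    {f : ℝ → ℂ} (hfm : Measurable f) (hf : Integrable f ν) (h0 : f 0 = 1)
    (hadd : ∀ x y, f (x + y) = f x * f y) :
    ∫ x, f x ∂(compoundPoisson ν) = Complex.exp (∫ y, (f y - 1) ∂ν) := by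
  have h := hasSum_integral_measure (integrable_compoundPoisson hfm hf h0 hadd)
  have h2 := (NormedSpace.expSeries_div_hasSum_exp (∫ y, f y ∂ν)).mul_left
    (Complex.exp (-ν.real Set.univ))
  rw [← Complex.exp_eq_exp_ℂ] at h2
  have e : ∫ y, (f y - 1) ∂ν = -(ν.real Set.univ : ℂ) + ∫ y, f y ∂ν := by
    rw [integral_sub hf (integrable_const _), integral_const]
    simp
    ring
  rw [e, Complex.exp_add]
  refine h.unique (h2.congr_fun ?_)
  intro k
  rw [integral_smul_measure, (convPow_multiplicative hfm hf h0 hadd k).2,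
    ENNReal.toReal_ofReal (by positivity), Complex.real_smul]
  push_cast
  ring

lemma integrable_exp_compoundPoisson {ν : Measure ℝ} [IsFiniteMeasure ν] {s : ℝ}
    (h : Integrable (fun y => Real.exp (s * y)) ν) :
    Integrable (fun y => Real.exp (s * y)) (compoundPoisson ν) :=
  integrable_compoundPoisson (by fun_prop) h (by simp) fun x y => by rw [mul_add, Real.exp_add]

lemma integrable_cexp_mul {ν : Measure ℝ} {z : ℂ}
    (h : Integrable (fun y => Real.exp (z.re * y)) ν) :
    Integrable (fun y : ℝ => Complex.exp (z * y)) ν := by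
  refine h.mono (Measurable.aestronglyMeasurable (by fun_prop)) (ae_of_all _ fun y => ?_)
  rw [Complex.norm_exp, Complex.re_mul_ofReal, Real.norm_of_nonneg (Real.exp_pos _).le]

lemma integral_cexp_compoundPoisson {ν : Measure ℝ} [IsFiniteMeasure ν] {z : ℂ}
    (h : Integrable (fun y => Real.exp (z.re * y)) ν) :
    ∫ w : ℝ, Complex.exp (z * w) ∂(compoundPoisson ν) =
      Complex.exp (∫ y : ℝ, (Complex.exp (z * y) - 1) ∂ν) :=
  integral_compoundPoisson (by fun_prop) (integrable_cexp_mul h) (by simp) fun x y => by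
    rw [← Complex.exp_add]; push_cast; ring_nf

lemma integral_exp_compoundPoisson {ν : Measure ℝ} [IsFiniteMeasure ν] {s : ℝ}
    (h : Integrable (fun y => Real.exp (s * y)) ν) :
    ∫ w, Real.exp (s * w) ∂(compoundPoisson ν) = Real.exp (∫ y, (Real.exp (s * y) - 1) ∂ν) := by
  have := integral_cexp_compoundPoisson (ν := ν) (z := s) (by simpa using h)
  have e : ∀ y : ℝ, Complex.exp ((s : ℂ) * y) - 1 = ((Real.exp (s * y) - 1 : ℝ) : ℂ) := by
    intro y; push_cast; rfl
  have e' : ∀ y : ℝ, Complex.exp ((s : ℂ) * y) = ((Real.exp (s * y) : ℝ) : ℂ) := by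
    intro y; push_cast; rfl
  simp only [e] at this
  simp only [e'] at this
  rw [integral_complex_ofReal, integral_complex_ofReal, ← Complex.ofReal_exp] at this
  exact_mod_cast this

instance (ν : Measure ℝ) [IsFiniteMeasure ν] : IsProbabilityMeasure (compoundPoisson ν) := by
  have h1 := integrable_exp_compoundPoisson (ν := ν) (s := 0) (by simp)
  have h2 := integral_exp_compoundPoisson (ν := ν) (s := 0) (by simp)
  simp only [zero_mul, Real.exp_zero, integral_const, smul_eq_mul, mul_one, sub_self,
    mul_zero] at h1 h2
  rwa [← isProbabilityMeasure_iff_real] at h2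

lemma charFun_compoundPoisson (ν : Measure ℝ) [IsFiniteMeasure ν] (u : ℝ) :
    charFun (compoundPoisson ν) u =
      Complex.exp (∫ y : ℝ, (Complex.exp (u * y * Complex.I) - 1) ∂ν) := by
  have := integral_cexp_compoundPoisson (ν := ν) (z := u * Complex.I) (by simp)
  rw [charFun_apply_real]
  simp only [mul_right_comm _ Complex.I] at this
  exact this

lemma compoundPoisson_map_mul (ν : Measure ℝ) [IsFiniteMeasure ν] (c : ℝ) :
    compoundPoisson (ν.map (c * ·)) = (compoundPoisson ν).map (c * ·) := by
  have : IsProbabilityMeasure ((compoundPoisson ν).map (c * ·)) :=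
    Measure.isProbabilityMeasure_map (by fun_prop)
  refine Measure.ext_of_charFun (funext fun u => ?_)
  rw [charFun_map_mul, charFun_compoundPoisson, charFun_compoundPoisson,
    integral_map (by fun_prop) (Continuous.aestronglyMeasurable (by fun_prop))]
  congr 2; ext y
  push_cast
  ring_nf

lemma convPow_mono {ν' ν : Measure ℝ} [IsFiniteMeasure ν'] [IsFiniteMeasure ν] (h : ν' ≤ ν) (k : ℕ) :
    convPow ν' k ≤ convPow ν k := by
  induction k with
  | zero => rfl
  | succ k ih =>
    rw [convPow, convPow, Measure.conv, Measure.conv]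
    exact Measure.map_mono (Measure.prod_mono ih h) (by fun_prop)

lemma compoundPoisson_mono {ν' ν : Measure ℝ} [IsFiniteMeasure ν'] [IsFiniteMeasure ν] (h : ν' ≤ ν)
    {A : Set ℝ} (hA : MeasurableSet A) :
    Real.exp (-(ν.real Set.univ - ν'.real Set.univ)) * (compoundPoisson ν').real A ≤
      (compoundPoisson ν).real A := by
  have h1 : ENNReal.ofReal (Real.exp (-(ν.real Set.univ - ν'.real Set.univ))) *
      compoundPoisson ν' A ≤ compoundPoisson ν A := by
    rw [compoundPoisson, compoundPoisson, Measure.sum_apply _ hA, Measure.sum_apply _ hA,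
      ← ENNReal.tsum_mul_left]
    refine ENNReal.tsum_le_tsum fun k => ?_
    rw [Measure.smul_apply, Measure.smul_apply, smul_eq_mul, smul_eq_mul, ← mul_assoc,
      ← ENNReal.ofReal_mul (by positivity), ← mul_div_assoc, ← Real.exp_add]
    have e : -(ν.real Set.univ - ν'.real Set.univ) + -ν'.real Set.univ = -ν.real Set.univ := by ring
    rw [e]
    exact mul_le_mul_right (convPow_mono h k A) _
  have h2 := ENNReal.toReal_mono (measure_ne_top _ _) h1
  rwa [ENNReal.toReal_mul, ENNReal.toReal_ofReal (Real.exp_pos _).le] at h2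

lemma abs_compoundPoisson_sub_le {ν' ν : Measure ℝ} [IsFiniteMeasure ν'] [IsFiniteMeasure ν]
    (h : ν' ≤ ν) {A : Set ℝ} (hA : MeasurableSet A) :
    |(compoundPoisson ν).real A - (compoundPoisson ν').real A| ≤
      ν.real Set.univ - ν'.real Set.univ := by
  have key : ∀ B : Set ℝ, MeasurableSet B → (compoundPoisson ν').real B -
      (compoundPoisson ν).real B ≤ ν.real Set.univ - ν'.real Set.univ := by
    intro B hB
    have h1 := compoundPoisson_mono h hB
    have h2 := Real.add_one_le_exp (-(ν.real Set.univ - ν'.real Set.univ))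
    have h3 : (compoundPoisson ν').real B ≤ 1 := measureReal_le_one
    have h4 : 0 ≤ (compoundPoisson ν').real B := measureReal_nonneg
    have h5 : ν'.real Set.univ ≤ ν.real Set.univ :=
      ENNReal.toReal_mono (measure_ne_top _ _) (h _)
    nlinarith
  have k1 := key A hA
  have k2 := key Aᶜ hA.compl
  rw [probReal_compl_eq_one_sub hA, probReal_compl_eq_one_sub hA] at k2
  rw [abs_le]
  constructor <;> linarith

lemma compoundPoisson_Iio_zero {ν : Measure ℝ} [IsFiniteMeasure ν] (h : ν (Set.Iio 0) = 0) :
    compoundPoisson ν (Set.Iio 0) = 0 := by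
  have hk : ∀ k, convPow ν k (Set.Iio 0) = 0 := by
    intro k
    induction k with
    | zero => simp [convPow]
    | succ k ih =>
      rw [convPow, Measure.conv, Measure.map_apply (by fun_prop) measurableSet_Iio]
      refine measure_mono_null (t := (Set.Iio 0 ×ˢ Set.univ) ∪ (Set.univ ×ˢ Set.Iio 0)) ?_ ?_
      · rintro ⟨a, b⟩ hab
        simp only [Set.mem_preimage, Set.mem_Iio] at hab
        by_contra hc
        simp only [Set.mem_union, Set.mem_prod, Set.mem_Iio, Set.mem_univ, and_true, true_and,
          not_or, not_lt] at hc
        linarith [hc.1, hc.2]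
      · refine measure_union_null ?_ ?_ <;> rw [Measure.prod_prod] <;> simp [ih, h]
  rw [compoundPoisson, Measure.sum_apply _ measurableSet_Iio]
  simp [hk]

/-! ### Elementary exponential inequalities -/

lemma hasSum_exp_sub_quadratic (t : ℝ) :
    HasSum (fun k : ℕ => t ^ (k + 3) / (k + 3).factorial) (Real.exp t - 1 - t - t ^ 2 / 2) := by
  have h := NormedSpace.expSeries_div_hasSum_exp t
  rw [← Real.exp_eq_exp_ℝ, ← hasSum_nat_add_iff' 3] at h
  have e : Real.exp t - ∑ i ∈ Finset.range 3, t ^ i / (i.factorial : ℝ) =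
      Real.exp t - 1 - t - t ^ 2 / 2 := by
    simp [Finset.sum_range_succ, Nat.factorial]
    ring
  rwa [e] at h

lemma exp_sub_quadratic_scale_le {c a : ℝ} (hc0 : 0 ≤ c) (hc1 : c ≤ 1) (ha : 0 ≤ a) :
    Real.exp (c * a) - 1 - c * a - (c * a) ^ 2 / 2 ≤ c ^ 3 * Real.exp a := by
  have h1 := hasSum_exp_sub_quadratic (c * a)
  have h2 := (hasSum_exp_sub_quadratic a).mul_left (c ^ 3)
  have h3 : Real.exp (c * a) - 1 - c * a - (c * a) ^ 2 / 2 ≤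
      c ^ 3 * (Real.exp a - 1 - a - a ^ 2 / 2) := by
    refine hasSum_le (fun k => ?_) h1 h2
    rw [mul_pow, ← mul_div_assoc]
    gcongr ?_ / _
    have : c ^ (k + 3) ≤ c ^ 3 := pow_le_pow_of_le_one hc0 hc1 (by omega)
    gcongr
  refine h3.trans ?_
  gcongr
  nlinarith [sq_nonneg a]

lemma exp_sub_quadratic_nonpos {t : ℝ} (ht : t ≤ 0) :
    Real.exp t - 1 - t - t ^ 2 / 2 ≤ 0 := by
  have h := Real.quadratic_le_exp_of_nonneg (x := -t) (by linarith)
  have hd : ∀ x : ℝ, HasDerivAt (fun x => Real.exp (-x) * (1 + x + x ^ 2 / 2))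
      (-(x ^ 2 / 2) * Real.exp (-x)) x := by
    intro x
    have h1 := ((hasDerivAt_id x).neg).exp
    have h2 := ((hasDerivAt_const x (1:ℝ)).add (hasDerivAt_id x)).add
      (((hasDerivAt_id x).pow 2).div_const 2)
    refine (h1.mul h2).congr_deriv ?_
    simp
    ring
  have hanti : Antitone (fun x => Real.exp (-x) * (1 + x + x ^ 2 / 2)) := by
    refine antitone_of_deriv_nonpos (fun x => (hd x).differentiableAt) fun x => ?_
    rw [(hd x).deriv]
    nlinarith [sq_nonneg x, Real.exp_pos (-x), mul_nonneg (sq_nonneg x) (Real.exp_pos (-x)).le]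
  have h0 := hanti ht
  simp only [neg_zero, Real.exp_zero] at h0
  have he : Real.exp (-t) * Real.exp t = 1 := by rw [← Real.exp_add]; simp
  have := Real.exp_pos t
  nlinarith [mul_le_mul_of_nonneg_left h0 this.le]

lemma exp_sub_quadratic_le_of_nonneg {t : ℝ} (ht : 0 ≤ t) :
    Real.exp t - 1 - t - t ^ 2 / 2 ≤ t ^ 3 * Real.exp t / 6 := by
  have h1 := hasSum_exp_sub_quadratic t
  have h2 := (NormedSpace.expSeries_div_hasSum_exp t).mul_left (t ^ 3 / 6)
  rw [← Real.exp_eq_exp_ℝ] at h2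
  have h3 : Real.exp t - 1 - t - t ^ 2 / 2 ≤ t ^ 3 / 6 * Real.exp t := by
    refine hasSum_le (fun k => ?_) h1 h2
    have hf : (6 * k.factorial : ℝ) ≤ (k + 3).factorial := by
      have : 6 * k.factorial ≤ (k + 3).factorial := by
        have h6 : 6 ≤ (k + 2 + 1) * ((k + 1 + 1) * (k + 1)) := by
          nlinarith [Nat.zero_le (k * k), Nat.zero_le (k * k * k)]
        rw [Nat.factorial_succ, Nat.factorial_succ, Nat.factorial_succ, ← mul_assoc (k + 1 + 1),
          ← mul_assoc]
        exact Nat.mul_le_mul_right _ h6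
      exact_mod_cast this
    have hk : (0 : ℝ) < k.factorial := by positivity
    calc t ^ (k + 3) / (k + 3).factorial ≤ t ^ (k + 3) / (6 * k.factorial) := by gcongr
      _ = _ := by field_simp; ring
  linarith

lemma exp_sub_quadratic_le {y b : ℝ} (hy : y ≤ b) :
    Real.exp y - 1 - y - y ^ 2 / 2 ≤ |y| ^ 3 * Real.exp b / 6 := by
  rcases le_total y 0 with h | h
  · exact (exp_sub_quadratic_nonpos h).trans (by positivity)
  · rw [abs_of_nonneg h]
    exact (exp_sub_quadratic_le_of_nonneg h).trans (by gcongr)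

lemma Real.cubic_le_exp (t : ℝ) : 1 + t + t ^ 2 / 2 + t ^ 3 / 6 ≤ Real.exp t := by
  rcases le_total 0 t with ht | ht
  · have h1 := hasSum_exp_sub_quadratic t
    have h2 := h1.summable.sum_le_tsum {0} (fun k _ => by positivity)
    rw [h1.tsum_eq] at h2
    simp [Nat.factorial] at h2
    linarith
  · have hd : ∀ x : ℝ, HasDerivAt (fun x => Real.exp (-x) * (1 + x + x ^ 2 / 2 + x ^ 3 / 6))
        (-(x ^ 3 / 6) * Real.exp (-x)) x := by
      intro x
      have h1 := ((hasDerivAt_id x).neg).exp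
      have h2 := (((hasDerivAt_const x (1:ℝ)).add (hasDerivAt_id x)).add
        (((hasDerivAt_id x).pow 2).div_const 2)).add (((hasDerivAt_id x).pow 3).div_const 6)
      refine (h1.mul h2).congr_deriv ?_
      simp
      ring
    have hmono : MonotoneOn (fun x => Real.exp (-x) * (1 + x + x ^ 2 / 2 + x ^ 3 / 6))
        (Set.Iic 0) := by
      refine monotoneOn_of_deriv_nonneg (convex_Iic 0)
        (fun x _ => (hd x).continuousAt.continuousWithinAt)
        (fun x _ => (hd x).differentiableAt.differentiableWithinAt) fun x hx => ?_
      rw [interior_Iic] at hx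
      rw [(hd x).deriv]
      have hx' : x < 0 := hx
      have : 0 ≤ -(x ^ 3 / 6) := by nlinarith [pow_pos (neg_pos.2 hx') 3]
      have := Real.exp_pos (-x)
      positivity
    have h0 := hmono (Set.mem_Iic.2 ht) (Set.mem_Iic.2 le_rfl) ht
    simp only [neg_zero, Real.exp_zero] at h0
    have he : Real.exp (-t) * Real.exp t = 1 := by rw [← Real.exp_add]; simp
    have := Real.exp_pos t
    nlinarith [mul_le_mul_of_nonneg_left h0 this.le]

lemma abs_exp_mul_quadratic_sub_one_le {y b : ℝ} (hb : 0 ≤ b) (hy : y ≤ b) :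
    |Real.exp y * (1 - y + y ^ 2 / 2) - 1| ≤ |y| ^ 3 * Real.exp b / 6 := by
  have he : Real.exp (-y) * Real.exp y = 1 := by rw [← Real.exp_add]; simp
  have hp := Real.exp_pos y
  have heb : Real.exp y ≤ Real.exp b := Real.exp_le_exp.2 hy
  have heb1 : 1 ≤ Real.exp b := Real.one_le_exp hb
  have h1 := Real.cubic_le_exp (-y)
  rcases le_total 0 y with h | h
  · rw [abs_of_nonneg h]
    have h2 := exp_sub_quadratic_nonpos (t := -y) (by linarith)
    have hy3 : 0 ≤ y ^ 3 := by positivity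
    rw [abs_le]
    constructor
    · have : 0 ≤ y ^ 3 * Real.exp b / 6 := by positivity
      nlinarith [mul_le_mul_of_nonneg_left h2 hp.le]
    · nlinarith [mul_le_mul_of_nonneg_left h1 hp.le, mul_le_mul_of_nonneg_left heb hy3]
  · have hny : 0 ≤ -y := by linarith
    rw [abs_of_nonpos h]
    have h2 := exp_sub_quadratic_le_of_nonneg hny
    have h3 := Real.quadratic_le_exp_of_nonneg hny
    have hy3 : 0 ≤ (-y) ^ 3 := by positivity
    rw [abs_le]
    constructor
    · nlinarith [mul_le_mul_of_nonneg_left h2 hp.le, mul_le_mul_of_nonneg_left heb1 hy3]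
    · have : 0 ≤ (-y) ^ 3 * Real.exp b / 6 := by positivity
      nlinarith [mul_le_mul_of_nonneg_left h3 hp.le]

lemma abs_exp_mul_sub_le {y b : ℝ} (hb : 0 ≤ b) (hy : y ≤ b) :
    |y - y * Real.exp y + y ^ 2 * Real.exp y| ≤ |y| ^ 3 * Real.exp b := by
  have he : Real.exp (-y) * Real.exp y = 1 := by rw [← Real.exp_add]; simp
  have hp := Real.exp_pos y
  have heb : Real.exp y ≤ Real.exp b := Real.exp_le_exp.2 hy
  have heb1 : 1 ≤ Real.exp b := Real.one_le_exp hb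
  have h1 := Real.add_one_le_exp y
  have h2 : Real.exp y - 1 ≤ y * Real.exp y := by
    nlinarith [Real.add_one_le_exp (-y), mul_le_mul_of_nonneg_left (Real.add_one_le_exp (-y)) hp.le]
  have e : y - y * Real.exp y + y ^ 2 * Real.exp y = y * (1 - Real.exp y + y * Real.exp y) := by ring
  have hg0 : 0 ≤ 1 - Real.exp y + y * Real.exp y := by linarith
  have hg1 : 1 - Real.exp y + y * Real.exp y ≤ y ^ 2 * Real.exp b := by
    rcases le_total 0 y with h | h
    · nlinarith [mul_le_mul_of_nonneg_left h2 h, mul_le_mul_of_nonneg_left heb (sq_nonneg y)]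
    · nlinarith [mul_le_mul_of_nonneg_left heb1 (sq_nonneg y)]
  rw [e, abs_mul, abs_of_nonneg hg0]
  calc |y| * (1 - Real.exp y + y * Real.exp y) ≤ |y| * (y ^ 2 * Real.exp b) := by gcongr
    _ = |y| ^ 3 * Real.exp b := by rw [← sq_abs y]; ring

lemma sq_mul_exp_sub_one_le {y b : ℝ} (hy : y ≤ b) :
    y ^ 2 * Real.exp y - y ^ 2 ≤ |y| ^ 3 * Real.exp b := by
  have hp := Real.exp_pos y
  rcases le_total 0 y with h | h
  · have heb : Real.exp y ≤ Real.exp b := Real.exp_le_exp.2 hy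
    have h2 : Real.exp y - 1 ≤ y * Real.exp y := by
      have he : Real.exp (-y) * Real.exp y = 1 := by rw [← Real.exp_add]; simp
      nlinarith [mul_le_mul_of_nonneg_left (Real.add_one_le_exp (-y)) hp.le]
    rw [abs_of_nonneg h]
    have hy3 : 0 ≤ y ^ 3 := by positivity
    nlinarith [mul_le_mul_of_nonneg_left h2 (sq_nonneg y), mul_le_mul_of_nonneg_left heb hy3]
  · have h1 : Real.exp y ≤ 1 := Real.exp_le_one_iff.2 h
    have : 0 ≤ |y| ^ 3 * Real.exp b := by positivity
    nlinarith [mul_le_mul_of_nonneg_left h1 (sq_nonneg y)]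

lemma neg_abs_pow_le_sq_mul_exp_sub (y : ℝ) : -|y| ^ 3 ≤ y ^ 2 * Real.exp y - y ^ 2 := by
  have h1 := Real.add_one_le_exp y
  have h2 : y ^ 2 * -|y| ≤ y ^ 2 * (Real.exp y - 1) := by
    gcongr
    linarith [neg_abs_le y]
  calc -|y| ^ 3 = y ^ 2 * -|y| := by rw [← sq_abs y]; ring
    _ ≤ _ := h2
    _ = _ := by ring

/-! ### Gaussian tails -/

lemma gaussianReal_real_Ioi (m : ℝ) {σ : ℝ} (hσ : 0 < σ) (w : ℝ) :
    (gaussianReal m (.mk (σ ^ 2) (sq_nonneg σ))).real (Set.Ioi w) =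
      (gaussianReal 0 1).real (Set.Ioi ((w - m) / σ)) := by
  have h1 : gaussianReal m (.mk (σ ^ 2) (sq_nonneg σ)) =
      (gaussianReal 0 1).map (fun y => σ * y + m) := by
    have : (fun y : ℝ => σ * y + m) = (fun y => y + m) ∘ (fun y => σ * y) := rfl
    rw [this, ← Measure.map_map (by fun_prop) (by fun_prop), gaussianReal_map_const_mul,
      gaussianReal_map_add_const]
    simp
  rw [h1, map_measureReal_apply (by fun_prop) measurableSet_Ioi]
  congr 1
  ext y
  simp only [Set.mem_preimage, Set.mem_Ioi, div_lt_iff₀ hσ]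
  constructor <;> intro h <;> linarith

lemma setIntegral_Ioi_exp_neg_gaussianReal (m : ℝ) {v : NNReal} (hv : v ≠ 0) (z : ℝ) :
    ∫ w in Set.Ioi z, Real.exp (-w) ∂(gaussianReal m v) =
      Real.exp (-m + v / 2) * (gaussianReal (m - v) v).real (Set.Ioi z) := by
  have hv0 : (v : ℝ) ≠ 0 := by exact_mod_cast hv
  rw [← integral_indicator measurableSet_Ioi, integral_gaussianReal_eq_integral_smul hv,
    ← integral_indicator_one measurableSet_Ioi, integral_gaussianReal_eq_integral_smul hv,
    ← integral_const_mul]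
  congr 1; ext w
  by_cases hw : w ∈ Set.Ioi z
  · have h : Real.exp (-(w - m) ^ 2 / (2 * v)) * Real.exp (-w) =
        Real.exp (-m + v / 2) * Real.exp (-(w - (m - v)) ^ 2 / (2 * v)) := by
      rw [← Real.exp_add, ← Real.exp_add]
      congr 1
      field_simp
      ring
    rw [Set.indicator_of_mem hw, Set.indicator_of_mem hw, smul_eq_mul, smul_eq_mul, Pi.one_apply,
      mul_one, gaussianPDFReal, gaussianPDFReal, mul_assoc, h]
    ring
  · rw [Set.indicator_of_notMem hw, Set.indicator_of_notMem hw]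
    simp

lemma gaussianReal_real_Ioi_le {x : ℝ} (hx : 0 ≤ x) :
    (gaussianReal 0 1).real (Set.Ioi x) ≤ Real.exp (-(x ^ 2 / 2)) := by
  have h := measure_ge_le_exp_mul_mgf (μ := gaussianReal 0 1) (X := id) x hx
    (integrable_exp_mul_gaussianReal x)
  rw [mgf_id_gaussianReal] at h
  refine (measureReal_mono (fun y hy => (Set.mem_Ioi.1 hy).le)).trans (h.trans (le_of_eq ?_))
  rw [← Real.exp_add]
  congr 1
  simp
  ring

lemma gaussianReal_real_Ioi_sub_le {a b : ℝ} (ha : 0 ≤ a) (hab : a ≤ b) :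
    (gaussianReal 0 1).real (Set.Ioi a) - (gaussianReal 0 1).real (Set.Ioi b) ≤
      (b - a) * Real.exp (-(a ^ 2 / 2)) := by
  have h1 : (gaussianReal 0 1).real (Set.Ioi a) =
      (gaussianReal 0 1).real (Set.Ioc a b) + (gaussianReal 0 1).real (Set.Ioi b) := by
    rw [← Set.Ioc_union_Ioi_eq_Ioi hab, measureReal_union (Set.Ioc_disjoint_Ioi le_rfl)
      measurableSet_Ioi]
  rw [h1, add_sub_cancel_right, ← integral_indicator_one measurableSet_Ioc,
    integral_gaussianReal_eq_integral_smul one_ne_zero]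
  have h2 : ∀ x, gaussianPDFReal 0 1 x • (Set.Ioc a b).indicator (1 : ℝ → ℝ) x ≤
      (Set.Ioc a b).indicator (fun _ => Real.exp (-(a ^ 2 / 2))) x := by
    intro x
    by_cases hx : x ∈ Set.Ioc a b
    · rw [Set.indicator_of_mem hx, Set.indicator_of_mem hx, Pi.one_apply, smul_eq_mul, mul_one,
        gaussianPDFReal]
      have h3 : (√(2 * Real.pi * (1 : NNReal)))⁻¹ ≤ 1 := by
        refine inv_le_one_of_one_le₀ (Real.one_le_sqrt.2 ?_)
        have := Real.pi_gt_three
        simp only [NNReal.coe_one, mul_one]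
        linarith
      have h4 : Real.exp (-(x - 0) ^ 2 / (2 * (1 : NNReal))) ≤ Real.exp (-(a ^ 2 / 2)) := by
        refine Real.exp_le_exp.2 ?_
        have := hx.1
        simp only [NNReal.coe_one, mul_one]
        nlinarith
      calc _ ≤ 1 * Real.exp (-(a ^ 2 / 2)) := by gcongr
        _ = _ := one_mul _
    · rw [Set.indicator_of_notMem hx, Set.indicator_of_notMem hx]
      simp
  have h5 : Integrable ((Set.Ioc a b).indicator (fun _ : ℝ => Real.exp (-(a ^ 2 / 2)))) :=
    (integrable_indicator_iff measurableSet_Ioc).2 (by simp)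
  refine (integral_mono_of_nonneg (ae_of_all _ fun x => ?_) h5 (ae_of_all _ h2)).trans ?_
  · exact mul_nonneg (gaussianPDFReal_nonneg _ _ _) (Set.indicator_nonneg (by simp) _)
  · rw [integral_indicator measurableSet_Ioc]
    simp [hab]

/-- Kolmogorov distance controls exponentially weighted upper tails. -/
lemma abs_setIntegral_Ioi_exp_neg_sub_le {τ γ : Measure ℝ} [IsProbabilityMeasure τ]
    [IsProbabilityMeasure γ] {δ : ℝ} (h : ∀ w, |τ.real (Set.Iic w) - γ.real (Set.Iic w)| ≤ δ)
    (z : ℝ) :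
    |∫ w in Set.Ioi z, Real.exp (-w) ∂τ - ∫ w in Set.Ioi z, Real.exp (-w) ∂γ| ≤
      2 * δ * Real.exp (-z) := by
  set f : ℝ → ℝ := (Set.Ioi z).indicator fun w => Real.exp (-w) with hf
  have hf0 : ∀ w, 0 ≤ f w := fun w => Set.indicator_nonneg (fun _ _ => (Real.exp_pos _).le) _
  have hfM : ∀ w, f w ≤ Real.exp (-z) := fun w =>
    Set.indicator_le' (fun w hw => Real.exp_le_exp.2 (neg_le_neg (Set.mem_Ioi.1 hw).le))
      (fun _ _ => (Real.exp_pos _).le) w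
  have hfm : Measurable f := Measurable.indicator (by fun_prop) measurableSet_Ioi
  have hlevel : ∀ t ∈ Set.Ioc 0 (Real.exp (-z)), {w | t ≤ f w} = Set.Ioc z (-Real.log t) := by
    intro t ht
    ext w
    simp only [Set.mem_ofPred_eq, Set.mem_Ioc]
    by_cases hw : w ∈ Set.Ioi z
    · rw [hf, Set.indicator_of_mem hw, ← Real.log_le_iff_le_exp ht.1]
      exact ⟨fun h => ⟨hw, by linarith⟩, fun h => by linarith [h.2]⟩
    · rw [hf, Set.indicator_of_notMem hw]
      exact ⟨fun h => absurd ht.1 (not_lt.2 h), fun h => absurd h.1 hw⟩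
  have hlayer : ∀ η : Measure ℝ, IsProbabilityMeasure η →
      ∫ w in Set.Ioi z, Real.exp (-w) ∂η =
        ∫ t in Set.Ioc 0 (Real.exp (-z)), η.real (Set.Ioc z (-Real.log t)) ∧
      IntegrableOn (fun t => η.real (Set.Ioc z (-Real.log t))) (Set.Ioc 0 (Real.exp (-z))) := by
    intro η hη
    constructor
    · rw [← integral_indicator measurableSet_Ioi]
      have hi : Integrable f η := Integrable.of_bound hfm.aestronglyMeasurable (Real.exp (-z))
        (ae_of_all _ fun w => by rw [Real.norm_of_nonneg (hf0 w)]; exact hfM w)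
      rw [hi.integral_eq_integral_Ioc_meas_le (ae_of_all _ hf0) (ae_of_all _ hfM)]
      exact setIntegral_congr_fun measurableSet_Ioc fun t ht => by simp only [hlevel t ht]
    · have hanti : AntitoneOn (fun t => η.real (Set.Ioc z (-Real.log t)))
          (Set.Ioc 0 (Real.exp (-z))) := fun s hs t _ hst =>
        measureReal_mono (Set.Ioc_subset_Ioc_right (neg_le_neg (Real.log_le_log hs.1 hst)))
      refine Integrable.of_bound (C := 1)
        (aemeasurable_restrict_of_antitoneOn measurableSet_Ioc hanti).aestronglyMeasurable
        (ae_of_all _ fun t => ?_)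
      rw [Real.norm_of_nonneg measureReal_nonneg]
      exact measureReal_le_one
  have hIoc : ∀ t ∈ Set.Ioc 0 (Real.exp (-z)), ‖τ.real (Set.Ioc z (-Real.log t)) -
      γ.real (Set.Ioc z (-Real.log t))‖ ≤ 2 * δ := by
    intro t ht
    have hzt : z ≤ -Real.log t := by
      have := (Real.log_le_iff_le_exp ht.1).2 ht.2
      linarith
    have e : ∀ η : Measure ℝ, IsProbabilityMeasure η → η.real (Set.Ioc z (-Real.log t)) =
        η.real (Set.Iic (-Real.log t)) - η.real (Set.Iic z) := by
      intro η hη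
      rw [← Set.Iic_sdiff_Iic, measureReal_sdiff (Set.Iic_subset_Iic.2 hzt) measurableSet_Iic]
    rw [e τ ‹_›, e γ ‹_›, Real.norm_eq_abs]
    have h1 := abs_le.1 (h z)
    have h2 := abs_le.1 (h (-Real.log t))
    rw [abs_le]
    constructor <;> linarith [h1.1, h1.2, h2.1, h2.2]
  rw [(hlayer τ ‹_›).1, (hlayer γ ‹_›).1, ← integral_sub (hlayer τ ‹_›).2 (hlayer γ ‹_›).2,
    ← Real.norm_eq_abs]
  refine (norm_setIntegral_le_of_norm_le_const (by simp) hIoc).trans (le_of_eq ?_)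
  simp [(Real.exp_pos _).le]

/-! ### Exponential tilting of compound Poisson laws -/

lemma integrableExpSet_id_eq_univ {ν : Measure ℝ}
    (hexp : ∀ s : ℝ, Integrable (fun y => Real.exp (s * y)) ν) : integrableExpSet id ν = Set.univ :=
  Set.eq_univ_of_forall hexp

lemma integrable_abs_pow_mul_exp {ν : Measure ℝ}
    (hexp : ∀ s : ℝ, Integrable (fun y => Real.exp (s * y)) ν) (n : ℕ) (s : ℝ) :
    Integrable (fun y => |y| ^ n * Real.exp (s * y)) ν :=
  integrable_pow_abs_mul_exp_of_mem_interior_integrableExpSet (X := id)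
    (by simp [integrableExpSet_id_eq_univ hexp]) n

lemma integrable_pow_mul_exp {ν : Measure ℝ}
    (hexp : ∀ s : ℝ, Integrable (fun y => Real.exp (s * y)) ν) (n : ℕ) (s : ℝ) :
    Integrable (fun y => y ^ n * Real.exp (s * y)) ν :=
  integrable_pow_mul_exp_of_mem_interior_integrableExpSet (X := id)
    (by simp [integrableExpSet_id_eq_univ hexp]) n

lemma integrable_withDensity_exp_iff {ν : Measure ℝ} {f : ℝ → ℝ} :
    Integrable f (ν.withDensity fun y => ENNReal.ofReal (Real.exp y)) ↔
      Integrable (fun y => f y * Real.exp y) ν := by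
  rw [integrable_withDensity_iff (by fun_prop) (by simp)]
  simp only [ENNReal.toReal_ofReal (Real.exp_pos _).le]

lemma integral_withDensity_exp {E : Type*} [NormedAddCommGroup E] [NormedSpace ℝ E]
    {ν : Measure ℝ} (f : ℝ → E) :
    ∫ y, f y ∂(ν.withDensity fun y => ENNReal.ofReal (Real.exp y)) = ∫ y, Real.exp y • f y ∂ν := by
  rw [integral_withDensity_eq_integral_toReal_smul (by fun_prop) (by simp)]
  simp only [ENNReal.toReal_ofReal (Real.exp_pos _).le]

/-- Saddle-point expansion with unit tilt for the upper tail of a compound Poisson law. -/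
theorem compoundPoisson_tail_tilted {ν : Measure ℝ} [IsFiniteMeasure ν]
    (hexp : ∀ s : ℝ, Integrable (fun y => Real.exp (s * y)) ν) {σ : ℝ} (hσ : 0 < σ)
    (hV : ∫ y, y ^ 2 * Real.exp y ∂ν = σ ^ 2) (z : ℝ) :
    |(compoundPoisson ν).real (Set.Ioi z) -
      Real.exp (∫ y, (Real.exp y - 1) ∂ν - ∫ y, y * Real.exp y ∂ν + σ ^ 2 / 2) *
        (gaussianReal 0 1).real (Set.Ioi ((z - ∫ y, y * Real.exp y ∂ν + σ ^ 2) / σ))| ≤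
      2 * (0.4785 * ((∫ y, |y| ^ 3 * Real.exp y ∂ν) / σ ^ 3)) *
        Real.exp (∫ y, (Real.exp y - 1) ∂ν - z) := by
  set ρ := compoundPoisson ν with hρ
  set m := ∫ y, y * Real.exp y ∂ν with hm
  set Λ := ∫ y, (Real.exp y - 1) ∂ν with hΛ
  have hρexp : ∀ s : ℝ, Integrable (fun y => Real.exp (s * y)) ρ := fun s =>
    integrable_exp_compoundPoisson (hexp s)
  have hi1 : Integrable (fun w => Real.exp w) ρ := by simpa using hρexp 1
  have hM : ∫ w, Real.exp w ∂ρ = Real.exp Λ := by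
    simpa using integral_exp_compoundPoisson (hexp 1)
  set τ := ρ.tilted id with hτ
  have hτp : IsProbabilityMeasure τ := isProbabilityMeasure_tilted hi1
  have hτid : Integrable id τ := by
    have := memLp_tilted_mul (X := id) (μ := ρ) (t := 1)
      (by simp [integrableExpSet_id_eq_univ hρexp]) 1
    simp only [one_mul, ENNReal.coe_one] at this
    exact this.integrable le_rfl
  set ν₁ := ν.withDensity fun y => ENNReal.ofReal (Real.exp y) with hν₁
  have h2 : Integrable (fun y => y ^ 2) ν₁ := by
    rw [hν₁, integrable_withDensity_exp_iff]
    simpa using integrable_pow_mul_exp hexp 2 1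
  have h3 : Integrable (fun y => |y| ^ 3) ν₁ := by
    rw [hν₁, integrable_withDensity_exp_iff]
    simpa using integrable_abs_pow_mul_exp hexp 3 1
  have hV₁ : ∫ y, y ^ 2 ∂ν₁ = σ ^ 2 := by
    rw [hν₁, integral_withDensity_exp, ← hV]
    simp only [smul_eq_mul, mul_comm]
  have hT₁ : ∫ y, |y| ^ 3 ∂ν₁ = ∫ y, |y| ^ 3 * Real.exp y ∂ν := by
    rw [hν₁, integral_withDensity_exp]
    simp only [smul_eq_mul, mul_comm]
  have hchar : ∀ u, charFun τ u =
      Complex.exp ((u * m : ℝ) * Complex.I + ∫ y, levyKernel u y ∂ν₁) := by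
    intro u
    rw [charFun_apply_real, hτ, integral_tilted]
    simp only [id]
    rw [hM, hν₁, integral_withDensity_exp]
    have hre : Integrable (fun y : ℝ => Real.exp ((1 + u * Complex.I : ℂ).re * y)) ν := by
      simpa using hexp 1
    have hc := integral_cexp_compoundPoisson hre
    have e1 : ∀ w : ℝ, (Real.exp w / Real.exp Λ) • Complex.exp (u * w * Complex.I) =
        Complex.exp (-Λ) * Complex.exp ((1 + u * Complex.I) * w) := by
      intro w
      rw [← Real.exp_sub, Complex.real_smul, Complex.ofReal_exp, ← Complex.exp_add,
        ← Complex.exp_add]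
      congr 1
      push_cast
      ring
    simp only [e1]
    rw [integral_const_mul, hc, ← Complex.exp_add]
    congr 1
    have hIz : Integrable (fun y : ℝ => Complex.exp ((1 + u * Complex.I) * y) - 1) ν :=
      (integrable_cexp_mul hre).sub (integrable_const _)
    have hIe : Integrable (fun y : ℝ => ((Real.exp y - 1 : ℝ) : ℂ)) ν := by
      refine Integrable.ofReal ?_
      have := (hexp 1).sub (integrable_const (1:ℝ))
      simpa using! this
    have hIm : Integrable (fun y : ℝ => ((u * (y * Real.exp y) : ℝ) : ℂ) * Complex.I) ν := by
      refine (Integrable.ofReal ?_).mul_const _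
      have : Integrable (fun y => u * (y * Real.exp y)) ν := by
        simpa using (integrable_pow_mul_exp hexp 1 1).const_mul u
      exact this
    have e2 : ∀ y : ℝ, Real.exp y • levyKernel u y =
        (Complex.exp ((1 + u * Complex.I) * y) - 1) - ((Real.exp y - 1 : ℝ) : ℂ) -
          ((u * (y * Real.exp y) : ℝ) : ℂ) * Complex.I := by
      intro y
      rw [levyKernel, Complex.real_smul, mul_sub, mul_sub, Complex.ofReal_exp, ← Complex.exp_add]
      have : (y : ℂ) + (u * y : ℝ) * Complex.I = (1 + u * Complex.I) * y := by push_cast; ring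
      rw [this]
      push_cast
      ring
    simp only [e2]
    have hI1 : Integrable (fun y : ℝ => (Complex.exp ((1 + u * Complex.I) * y) - 1) -
        ((Real.exp y - 1 : ℝ) : ℂ)) ν := hIz.sub hIe
    rw [integral_sub hI1 hIm, integral_sub hIz hIe, integral_mul_const, integral_complex_ofReal,
      integral_complex_ofReal, integral_const_mul, ← hm, ← hΛ]
    push_cast
    ring
  have hunif := uniform_bound hσ hτid h2 h3 hV₁ hchar
  rw [hT₁] at hunif
  set v : NNReal := .mk (σ ^ 2) (sq_nonneg σ) with hv
  have hv0 : v ≠ 0 := by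
    rw [Ne, ← NNReal.coe_eq_zero]
    exact (pow_pos hσ 2).ne'
  have hIic : ∀ w, (gaussianReal m v).real (Set.Iic w) =
      (gaussianReal 0 1).real (Set.Iic ((w - m) / σ)) := by
    intro w
    have := gaussianReal_real_Ioi m hσ w
    rw [← Set.compl_Iic, ← Set.compl_Iic, probReal_compl_eq_one_sub measurableSet_Iic,
      probReal_compl_eq_one_sub measurableSet_Iic] at this
    linarith
  have key := abs_setIntegral_Ioi_exp_neg_sub_le (τ := τ) (γ := gaussianReal m v)
    (fun w => by rw [hIic]; exact hunif w) z
  rw [setIntegral_Ioi_exp_neg_gaussianReal m hv0] at key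
  have hvc : (v : ℝ) = σ ^ 2 := rfl
  rw [hvc, gaussianReal_real_Ioi _ hσ] at key
  have hρτ : (ρ.real (Set.Ioi z)) = Real.exp Λ * ∫ w in Set.Ioi z, Real.exp (-w) ∂τ := by
    rw [hτ, setIntegral_tilted' _ _ measurableSet_Ioi]
    simp only [id]
    rw [hM, ← integral_const_mul]
    have : ∀ w, Real.exp Λ * (Real.exp w / Real.exp Λ) • Real.exp (-w) = 1 := by
      intro w
      rw [smul_eq_mul, div_mul_eq_mul_div, ← Real.exp_add, add_neg_cancel, Real.exp_zero]
      field_simp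
    simp only [this]
    simp
  have e3 : (z - m + σ ^ 2) / σ = (z - (m - σ ^ 2)) / σ := by ring
  have e4 : Real.exp (Λ - m + σ ^ 2 / 2) = Real.exp Λ * Real.exp (-m + σ ^ 2 / 2) := by
    rw [← Real.exp_add]; ring_nf
  have e5 : Real.exp (Λ - z) = Real.exp Λ * Real.exp (-z) := by
    rw [← Real.exp_add]; ring_nf
  rw [hρτ, e3, e4, e5, mul_assoc (Real.exp Λ), ← mul_sub, abs_mul, abs_of_pos (Real.exp_pos _)]
  calc _ ≤ Real.exp Λ * _ := mul_le_mul_of_nonneg_left key (Real.exp_pos _).le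
    _ = _ := by ring

/-! ### Non-uniform tail bound for compound Poisson laws -/

lemma integrable_pow_of_exp {ν : Measure ℝ}
    (hexp : ∀ s : ℝ, Integrable (fun y => Real.exp (s * y)) ν) (n : ℕ) :
    Integrable (fun y => y ^ n) ν := by
  simpa using integrable_pow_mul_exp hexp n 0

lemma integrable_abs_pow_of_exp {ν : Measure ℝ}
    (hexp : ∀ s : ℝ, Integrable (fun y => Real.exp (s * y)) ν) (n : ℕ) :
    Integrable (fun y => |y| ^ n) ν := by
  simpa using integrable_abs_pow_mul_exp hexp n 0

lemma setIntegral_Ioi_pow_nonneg {ν : Measure ℝ} {b : ℝ} (hb : 0 ≤ b) (k : ℕ) :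
    0 ≤ ∫ y in Set.Ioi b, y ^ k ∂ν :=
  setIntegral_nonneg measurableSet_Ioi fun _ hy => pow_nonneg (hb.trans (Set.mem_Ioi.1 hy).le) k

lemma setIntegral_Ioi_pow_le {ν : Measure ℝ} {b : ℝ} (hb : 0 < b) {k j : ℕ} (hkj : k + j = 3)
    (hk : Integrable (fun y => y ^ k) ν) (h3 : Integrable (fun y => |y| ^ 3) ν) :
    ∫ y in Set.Ioi b, y ^ k ∂ν ≤ (∫ y, |y| ^ 3 ∂ν) / b ^ j := by
  rw [← integral_div]
  refine (setIntegral_mono_on hk.integrableOn (h3.div_const _).integrableOn measurableSet_Ioi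
    fun y hy => ?_).trans (setIntegral_le_integral (h3.div_const _) (ae_of_all _ fun _ => ?_))
  · have hby : b ≤ y := (Set.mem_Ioi.1 hy).le
    have hy0 : 0 < y := hb.trans_le hby
    rw [le_div_iff₀ (by positivity), abs_of_pos hy0, ← hkj, pow_add]
    gcongr
  · simp only [Pi.zero_apply]
    positivity

lemma compoundPoisson_Ioi_le {ν : Measure ℝ} [IsFiniteMeasure ν] {s : ℝ} (hs : 0 ≤ s)
    (hexp : Integrable (fun y => Real.exp (s * y)) ν) (z : ℝ) :
    (compoundPoisson ν).real (Set.Ioi z) ≤ Real.exp (∫ y, (Real.exp (s * y) - 1) ∂ν - s * z) := by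
  have h := measure_ge_le_exp_mul_mgf (μ := compoundPoisson ν) (X := id) z hs
    (integrable_exp_compoundPoisson hexp)
  have hm : mgf id (compoundPoisson ν) s = Real.exp (∫ y, (Real.exp (s * y) - 1) ∂ν) :=
    integral_exp_compoundPoisson hexp
  rw [hm, ← Real.exp_add] at h
  refine (measureReal_mono (fun y hy => (Set.mem_Ioi.1 hy).le)).trans (h.trans (le_of_eq ?_))
  ring_nf

/-- Chernoff bound for a compound Poisson law whose jumps are truncated at level `b`. -/
lemma compoundPoisson_restrict_Ioi_le {ν : Measure ℝ} [IsFiniteMeasure ν]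
    (hexp : ∀ s : ℝ, Integrable (fun y => Real.exp (s * y)) ν) {b : ℝ} (hb : 0 < b) {l : ℝ}
    (hl : 0 ≤ l) (z : ℝ) :
    (compoundPoisson (ν.restrict (Set.Iic b))).real (Set.Ioi z) ≤
      Real.exp (l / b * (∫ y in Set.Iic b, y ∂ν) + (l / b) ^ 2 / 2 * (∫ y, y ^ 2 ∂ν) +
        (∫ y, |y| ^ 3 ∂ν) / b ^ 3 * Real.exp l - l / b * z) := by
  set s := l / b with hs
  have hs0 : 0 ≤ s := by positivity
  have h1 : Integrable (fun y => y) ν := by simpa using integrable_pow_of_exp hexp 1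
  have h2 := integrable_pow_of_exp hexp 2
  have h3 := integrable_abs_pow_of_exp hexp 3
  refine (compoundPoisson_Ioi_le hs0 (hexp s).integrableOn z).trans (Real.exp_le_exp.2 ?_)
  have hi1 : IntegrableOn (fun y => s * y) (Set.Iic b) ν := (h1.const_mul s).integrableOn
  have hi2 : Integrable (fun y => s ^ 2 / 2 * y ^ 2) ν := h2.const_mul _
  have hi3 : Integrable (fun y => |y| ^ 3 / b ^ 3 * Real.exp l) ν := (h3.div_const _).mul_const _
  have hi23 : Integrable (fun y => s ^ 2 / 2 * y ^ 2 + |y| ^ 3 / b ^ 3 * Real.exp l) ν :=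
    hi2.add hi3
  have hpt : ∫ y in Set.Iic b, (Real.exp (s * y) - 1) ∂ν ≤
      ∫ y in Set.Iic b, (s * y + (s ^ 2 / 2 * y ^ 2 + |y| ^ 3 / b ^ 3 * Real.exp l)) ∂ν := by
    refine setIntegral_mono_on ((hexp s).sub (integrable_const _)).integrableOn
      (hi1.add hi23.integrableOn) measurableSet_Iic fun y hy => ?_
    rcases le_total y 0 with h | h
    · have := exp_sub_quadratic_nonpos (t := s * y) (mul_nonpos_of_nonneg_of_nonpos hs0 h)
      have : 0 ≤ |y| ^ 3 / b ^ 3 * Real.exp l := by positivity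
      nlinarith
    · have := exp_sub_quadratic_scale_le (c := y / b) (a := l) (by positivity)
        ((div_le_one hb).2 hy) hl
      have e : y / b * l = s * y := by rw [hs]; ring
      rw [e, div_pow] at this
      rw [abs_of_nonneg h]
      nlinarith
  have hle : ∫ y in Set.Iic b, (s ^ 2 / 2 * y ^ 2 + |y| ^ 3 / b ^ 3 * Real.exp l) ∂ν ≤
      ∫ y, (s ^ 2 / 2 * y ^ 2 + |y| ^ 3 / b ^ 3 * Real.exp l) ∂ν :=
    setIntegral_le_integral hi23 (ae_of_all _ fun y => by simp only [Pi.zero_apply]; positivity)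
  rw [integral_add hi1 hi23.integrableOn, integral_const_mul] at hpt
  rw [integral_add hi2 hi3, integral_const_mul, integral_mul_const, integral_div] at hle
  linarith

lemma gaussian_tail_perturbation {x A σ e a : ℝ} (hx : 4 ≤ x) (hA0 : 0 ≤ A) (hA : A ≤ 0.02)
    (hσ : 0 < σ) (h1 : |σ ^ 2 - 1| ≤ A) (he : |e| ≤ A / 6) (ha : |a * σ - x| ≤ 1.04 * A) :
    |Real.exp e * (gaussianReal 0 1).real (Set.Ioi a) - (gaussianReal 0 1).real (Set.Ioi x)| ≤
      A * x * Real.exp (-(0.45 * x ^ 2)) := by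
  rw [abs_le] at h1
  have hσ1 : 0.98 ≤ σ := by nlinarith
  have hσ2 : |1 - σ| ≤ 0.51 * A := by
    have : (1 - σ ^ 2) = (1 - σ) * (1 + σ) := by ring
    rw [abs_le]
    constructor <;> nlinarith
  have hax : |a - x| ≤ 0.8 * A * x := by
    have e1 : (a - x) * σ = (a * σ - x) + x * (1 - σ) := by ring
    have e2 : |a - x| * σ ≤ 1.04 * A + x * (0.51 * A) := by
      rw [show |a - x| * σ = |(a - x) * σ| by rw [abs_mul, abs_of_pos hσ], e1]
      refine (abs_add_le _ _).trans (add_le_add ha ?_)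
      rw [abs_mul, abs_of_nonneg (by linarith)]
      gcongr
    nlinarith [mul_nonneg hA0 (by linarith : 0 ≤ x), abs_nonneg (a - x)]
  have hax' : |a - x| ≤ 0.016 * x := hax.trans (by nlinarith)
  rw [abs_le] at hax'
  have hg : ∀ y, 0.984 * x ≤ y → Real.exp (-(y ^ 2 / 2)) ≤ Real.exp (-(0.45 * x ^ 2)) := by
    intro y hy
    refine Real.exp_le_exp.2 ?_
    nlinarith
  have hd : |(gaussianReal 0 1).real (Set.Ioi a) - (gaussianReal 0 1).real (Set.Ioi x)| ≤
      0.8 * A * x * Real.exp (-(0.45 * x ^ 2)) := by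
    rcases le_total a x with h | h
    · have := gaussianReal_real_Ioi_sub_le (a := a) (b := x) (by linarith) h
      rw [abs_of_nonneg (sub_nonneg.2 (measureReal_mono (Set.Ioi_subset_Ioi h)))]
      refine this.trans (mul_le_mul ?_ ?_ (Real.exp_pos _).le (by positivity))
      · rw [abs_sub_comm] at hax; exact (le_abs_self _).trans hax
      · exact hg a (by linarith)
    · have := gaussianReal_real_Ioi_sub_le (a := x) (b := a) (by linarith) h
      rw [abs_sub_comm, abs_of_nonneg (sub_nonneg.2 (measureReal_mono (Set.Ioi_subset_Ioi h)))]
      refine this.trans (mul_le_mul ?_ ?_ (Real.exp_pos _).le (by positivity))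
      · exact (le_abs_self _).trans hax
      · exact hg x (by linarith)
  have hE : |Real.exp e - 1| ≤ A / 3 := by
    refine (Real.abs_exp_sub_one_le (by linarith)).trans (by linarith)
  have hga : (gaussianReal 0 1).real (Set.Ioi a) ≤ Real.exp (-(0.45 * x ^ 2)) :=
    (gaussianReal_real_Ioi_le (by linarith)).trans (hg a (by linarith))
  have hm : |(Real.exp e - 1) * (gaussianReal 0 1).real (Set.Ioi a)| ≤
      A / 3 * Real.exp (-(0.45 * x ^ 2)) := by
    rw [abs_mul, abs_of_nonneg (measureReal_nonneg (μ := gaussianReal 0 1))]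
    gcongr
  have e3 : Real.exp e * (gaussianReal 0 1).real (Set.Ioi a) -
      (gaussianReal 0 1).real (Set.Ioi x) = (Real.exp e - 1) * (gaussianReal 0 1).real (Set.Ioi a) +
        ((gaussianReal 0 1).real (Set.Ioi a) - (gaussianReal 0 1).real (Set.Ioi x)) := by ring
  rw [e3]
  refine (abs_add_le _ _).trans ((add_le_add hm hd).trans ?_)
  have := Real.exp_pos (-(0.45 * x ^ 2))
  nlinarith [mul_nonneg hA0 this.le]

lemma pow_le_pow_mul_exp (n : ℕ) {t c : ℝ} (ht : 0 ≤ t) (hc : 0 < c) :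
    t ^ n ≤ c ^ n * Real.exp (n * (t / c - 1)) := by
  have h : t / c ≤ Real.exp (t / c - 1) := by
    have := Real.add_one_le_exp (t / c - 1)
    linarith
  rw [Real.exp_nat_mul, ← mul_pow]
  gcongr
  rw [div_le_iff₀ hc] at h
  linarith

lemma integral_eq_setIntegral_Iic_add_Ioi {ν : Measure ℝ} {f : ℝ → ℝ} (hf : Integrable f ν)
    (b : ℝ) : ∫ y, f y ∂ν = ∫ y in Set.Iic b, f y ∂ν + ∫ y in Set.Ioi b, f y ∂ν := by
  rw [← Set.compl_Iic, integral_add_compl measurableSet_Iic hf]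

lemma compoundPoisson_restrict_Ioi_le_of_large {ν : Measure ℝ} [IsFiniteMeasure ν]
    (hexp : ∀ s : ℝ, Integrable (fun y => Real.exp (s * y)) ν) (hV : ∫ y, y ^ 2 ∂ν = 1) {x : ℝ}
    (hx : 0 < x) (hL0 : 0 < ∫ y, |y| ^ 3 ∂ν) (hL : 8 * (∫ y, |y| ^ 3 ∂ν) / x ^ 3 ≤ 1)
    (hlarge : Real.exp (-(x ^ 2 / 2)) ≤ 8 * (∫ y, |y| ^ 3 ∂ν) / x ^ 3) :
    (compoundPoisson (ν.restrict (Set.Iic (x / 2)))).real (Set.Ioi (∫ y, y ∂ν + x)) ≤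
      Real.exp 1 * (8 * (∫ y, |y| ^ 3 ∂ν) / x ^ 3) := by
  set L := ∫ y, |y| ^ 3 ∂ν with hLd
  set r := 8 * L / x ^ 3 with hr
  have hr0 : 0 < r := by positivity
  set l := -Real.log r with hl
  have hl0 : 0 ≤ l := neg_nonneg.2 (Real.log_nonpos hr0.le hL)
  have hl2 : l ≤ x ^ 2 / 2 := by
    have := (Real.le_log_iff_exp_le hr0).2 hlarge
    rw [hl]; linarith
  have h1 : Integrable (fun y => y) ν := by simpa using integrable_pow_of_exp hexp 1
  have hsplit := integral_eq_setIntegral_Iic_add_Ioi h1 (x / 2)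
  have hβ := setIntegral_Ioi_pow_nonneg (ν := ν) (b := x / 2) (by positivity) 1
  simp only [pow_one] at hβ
  refine (compoundPoisson_restrict_Ioi_le hexp (half_pos hx) hl0 _).trans ?_
  have e1 : L / (x / 2) ^ 3 * Real.exp l = 1 := by
    rw [hl, Real.exp_neg, Real.exp_log hr0, hr]
    field_simp
    ring
  have e2 : Real.exp 1 * r = Real.exp (1 - l) := by
    rw [hl, sub_neg_eq_add, Real.exp_add, Real.exp_log hr0]
  rw [e1, e2, hV, hsplit]
  refine Real.exp_le_exp.2 ?_
  have e3 : l / (x / 2) * x = 2 * l := by field_simp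
  have e4 : (l / (x / 2)) ^ 2 / 2 ≤ l := by
    rw [div_pow, div_div, div_le_iff₀ (by positivity)]
    nlinarith
  have e5 : 0 ≤ l / (x / 2) := by positivity
  nlinarith [mul_nonneg e5 hβ]

lemma tail_parameter_le {x A : ℝ} (hx : 4 ≤ x)
    (hA : A * Real.exp (-(x / 2)) ≤ x ^ 3 / 8 * Real.exp (-(x ^ 2 / 2))) : A ≤ 0.02 := by
  have h1 := pow_le_pow_mul_exp 3 (t := x) (c := 4) (by linarith) (by norm_num)
  have h2 : A ≤ 8 * Real.exp (-6) := by
    have e : A = A * Real.exp (-(x / 2)) * Real.exp (x / 2) := by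
      rw [mul_assoc, ← Real.exp_add]; simp
    rw [e]
    calc _ ≤ (4 ^ 3 * Real.exp ((3 : ℕ) * (x / 4 - 1))) / 8 * Real.exp (-(x ^ 2 / 2)) *
          Real.exp (x / 2) := by
          refine mul_le_mul_of_nonneg_right (hA.trans ?_) (Real.exp_pos _).le
          gcongr
      _ = 8 * Real.exp (3 * (x / 4 - 1) + -(x ^ 2 / 2) + x / 2) := by
          rw [Real.exp_add, Real.exp_add]; push_cast; ring
      _ ≤ _ := by
          gcongr
          nlinarith
  have h3 : Real.exp (-6) ≤ 0.0025 := by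
    rw [show (-6 : ℝ) = -((6 : ℕ) * 1) by norm_num, Real.exp_neg, Real.exp_nat_mul]
    have := Real.exp_one_gt_d9
    rw [inv_le_comm₀ (by positivity) (by norm_num)]
    calc (0.0025 : ℝ)⁻¹ ≤ 2.718 ^ 6 := by norm_num
      _ ≤ _ := by gcongr; linarith
  linarith

lemma tail_error_le {x L A σ : ℝ} (hx : 4 ≤ x) (hL0 : 0 ≤ L) (hA : A = L * Real.exp (x / 2))
    (hA2 : A ≤ 0.02) (hσ : 0 < σ) (h1 : |σ ^ 2 - 1| ≤ A) :
    2 * (0.4785 * (A / σ ^ 3)) * Real.exp (1 / 2 + A / 6 - x) + A * x * Real.exp (-(0.45 * x ^ 2)) ≤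
      23.4 * L / x ^ 3 := by
  have hx0 : 0 < x := by linarith
  rw [abs_le] at h1
  have hA0 : 0 ≤ A := by rw [hA]; positivity
  have hσ1 : 0.98 ≤ σ := by nlinarith
  have hσ3 : 0.94 ≤ σ ^ 3 := by
    calc (0.94 : ℝ) ≤ 0.98 ^ 3 := by norm_num
      _ ≤ _ := by gcongr
  have he1 := Real.exp_one_lt_d9
  have he2 := Real.exp_one_gt_d9
  have f1 : x ^ 3 * Real.exp (-(x / 2)) ≤ 10.8 := by
    have h := pow_le_pow_mul_exp 3 (t := x) (c := 6) (by linarith) (by norm_num)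
    have : Real.exp ((3 : ℕ) * (x / 6 - 1)) * Real.exp (-(x / 2)) = (Real.exp 1 ^ 3)⁻¹ := by
      rw [← Real.exp_add, ← Real.exp_nat_mul, ← Real.exp_neg]
      congr 1; push_cast; ring
    calc _ ≤ (6 ^ 3 * Real.exp ((3 : ℕ) * (x / 6 - 1))) * Real.exp (-(x / 2)) := by gcongr
      _ = 216 * (Real.exp 1 ^ 3)⁻¹ := by rw [mul_assoc, this]; norm_num
      _ ≤ 216 * (2.718 ^ 3)⁻¹ := by gcongr; linarith
      _ ≤ _ := by norm_num
  have f2 : x ^ 4 * Real.exp (x / 2 - 0.45 * x ^ 2) ≤ 2 := by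
    have h := pow_le_pow_mul_exp 2 (t := x ^ 2) (c := 16) (by positivity) (by norm_num)
    calc _ = (x ^ 2) ^ 2 * Real.exp (x / 2 - 0.45 * x ^ 2) := by ring
      _ ≤ (16 ^ 2 * Real.exp ((2 : ℕ) * (x ^ 2 / 16 - 1))) * Real.exp (x / 2 - 0.45 * x ^ 2) := by
          gcongr
      _ = 256 * Real.exp ((2 : ℕ) * (x ^ 2 / 16 - 1) + (x / 2 - 0.45 * x ^ 2)) := by
          rw [Real.exp_add]; ring
      _ ≤ 256 * Real.exp (-((5 : ℕ) * 1)) := by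
          gcongr
          push_cast
          nlinarith
      _ = 256 * (Real.exp 1 ^ 5)⁻¹ := by rw [Real.exp_neg, Real.exp_nat_mul]
      _ ≤ 256 * (2.718 ^ 5)⁻¹ := by gcongr; linarith
      _ ≤ _ := by norm_num
  have f3 : Real.exp (1 / 2 + A / 6) ≤ 1.66 := by
    have hh : Real.exp (1 / 2 + A / 6) ^ 2 ≤ 1.66 ^ 2 := by
      rw [← Real.exp_nat_mul]
      calc Real.exp ((2 : ℕ) * (1 / 2 + A / 6)) ≤ Real.exp (1 + 1 / 100) := by
            refine Real.exp_le_exp.2 ?_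
            push_cast; linarith
        _ = Real.exp 1 * Real.exp (1 / 100) := Real.exp_add _ _
        _ ≤ 2.719 * 1.0102 := by
            gcongr
            · linarith
            · have := (abs_le.1 (Real.abs_exp_sub_one_sub_id_le (x := 1 / 100)
                (by rw [abs_of_pos] <;> norm_num))).2
              linarith
        _ ≤ _ := by norm_num
    exact (pow_le_pow_iff_left₀ (Real.exp_pos _).le (by norm_num) two_ne_zero).1 hh
  rw [le_div_iff₀ (by positivity)]
  have g1 : 2 * (0.4785 * (A / σ ^ 3)) * Real.exp (1 / 2 + A / 6 - x) * x ^ 3 ≤ 18.3 * L := by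
    calc _ = 0.957 * (L / σ ^ 3) * Real.exp (1 / 2 + A / 6) *
          (x ^ 3 * (Real.exp (x / 2) * Real.exp (-x))) := by
          rw [sub_eq_add_neg, Real.exp_add]
          nth_rewrite 1 [hA]
          ring
      _ = 0.957 * (L / σ ^ 3) * Real.exp (1 / 2 + A / 6) * (x ^ 3 * Real.exp (-(x / 2))) := by
          rw [← Real.exp_add]; ring_nf
      _ ≤ 0.957 * (L / 0.94) * 1.66 * 10.8 := by gcongr
      _ = 0.957 / 0.94 * 1.66 * 10.8 * L := by ring
      _ ≤ _ := mul_le_mul_of_nonneg_right (by norm_num) hL0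
  have g2 : A * x * Real.exp (-(0.45 * x ^ 2)) * x ^ 3 ≤ 2 * L := by
    calc _ = L * (x ^ 4 * (Real.exp (x / 2) * Real.exp (-(0.45 * x ^ 2)))) := by
          nth_rewrite 1 [hA]
          ring
      _ = L * (x ^ 4 * Real.exp (x / 2 - 0.45 * x ^ 2)) := by
          rw [← Real.exp_add]; ring_nf
      _ ≤ L * 2 := by gcongr
      _ = _ := by ring
  linarith

lemma compoundPoisson_restrict_Ioi_sub_le_of_small {ν : Measure ℝ} [IsFiniteMeasure ν]
    (hexp : ∀ s : ℝ, Integrable (fun y => Real.exp (s * y)) ν) (hV : ∫ y, y ^ 2 ∂ν = 1) {x : ℝ}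
    (hx : 4 ≤ x) (hsmall : 8 * (∫ y, |y| ^ 3 ∂ν) / x ^ 3 ≤ Real.exp (-(x ^ 2 / 2))) :
    |(compoundPoisson (ν.restrict (Set.Iic (x / 2)))).real (Set.Ioi (∫ y, y ∂ν + x)) -
      (gaussianReal 0 1).real (Set.Ioi x)| ≤ 23.4 * (∫ y, |y| ^ 3 ∂ν) / x ^ 3 := by
  have hx0 : 0 < x := by linarith
  set b := x / 2 with hb
  have hb0 : 0 < b := by positivity
  set L := ∫ y, |y| ^ 3 ∂ν with hLd
  have hL0 : 0 ≤ L := integral_nonneg fun y => by positivity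
  set A := L * Real.exp b with hA
  have hAL : A * Real.exp (-b) = L := by rw [hA, mul_assoc, ← Real.exp_add]; simp
  have hA0 : 0 ≤ A := by positivity
  have hA2 : A ≤ 0.02 := by
    refine tail_parameter_le hx ?_
    rw [← hb, hAL]
    rw [div_le_iff₀ (by positivity)] at hsmall
    linarith
  have hL2 : L ≤ 0.14 * A := by
    rw [← hAL]
    have : Real.exp (-b) ≤ 0.14 := by
      have h2 : Real.exp (-b) ≤ Real.exp (-((2 : ℕ) * 1)) := by
        refine Real.exp_le_exp.2 ?_
        push_cast; rw [hb]; linarith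
      rw [Real.exp_neg ((2 : ℕ) * 1), Real.exp_nat_mul] at h2
      have he := Real.exp_one_gt_d9
      calc _ ≤ _ := h2
        _ ≤ (2.7 ^ 2)⁻¹ := by gcongr; linarith
        _ ≤ _ := by norm_num
    nlinarith
  set ν' := ν.restrict (Set.Iic b) with hν'
  have hexp' : ∀ s : ℝ, Integrable (fun y => Real.exp (s * y)) ν' := fun s => (hexp s).integrableOn
  have h1 : Integrable (fun y => y) ν := by simpa using integrable_pow_of_exp hexp 1
  have h2 := integrable_pow_of_exp hexp 2
  have h3 := integrable_abs_pow_of_exp hexp 3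
  have h1' : Integrable (fun y => y) ν' := h1.integrableOn
  have h2' : Integrable (fun y => y ^ 2) ν' := h2.integrableOn
  have h3' : Integrable (fun y => |y| ^ 3) ν' := h3.integrableOn
  have he' : Integrable (fun y => Real.exp y) ν' := by simpa using hexp' 1
  have hye' : Integrable (fun y => y * Real.exp y) ν' := by
    simpa using integrable_pow_mul_exp hexp' 1 1
  have hy2e' : Integrable (fun y => y ^ 2 * Real.exp y) ν' := by
    simpa using integrable_pow_mul_exp hexp' 2 1
  have hy3e' : Integrable (fun y => |y| ^ 3 * Real.exp y) ν' := by
    simpa using integrable_abs_pow_mul_exp hexp' 3 1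
  have he1' : Integrable (fun y => Real.exp y - 1) ν' := he'.sub (integrable_const _)
  have hL' : ∫ y, |y| ^ 3 ∂ν' ≤ L :=
    setIntegral_le_integral h3 (ae_of_all _ fun y => by simp only [Pi.zero_apply]; positivity)
  have hae : ∀ᵐ y ∂ν', y ≤ b := ae_restrict_mem measurableSet_Iic
  have hA' : (∫ y, |y| ^ 3 ∂ν') * Real.exp b ≤ A := by rw [hA]; gcongr
  have hdom : Integrable (fun y => |y| ^ 3 * Real.exp b) ν' := h3'.mul_const _
  have hbd : ∀ f : ℝ → ℝ, (∀ y ≤ b, |f y| ≤ |y| ^ 3 * Real.exp b) → |∫ y, f y ∂ν'| ≤ A := by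
    intro f hf
    rw [← Real.norm_eq_abs]
    refine (norm_integral_le_of_norm_le hdom (hae.mono fun y hy => ?_)).trans ?_
    · exact hf y hy
    · rwa [integral_mul_const]
  have hβ0 := setIntegral_Ioi_pow_nonneg (ν := ν) hb0.le 1
  have hβ1 := setIntegral_Ioi_pow_le hb0 (k := 1) (j := 2) rfl (by simpa using h1) h3
  have hγ0 := setIntegral_Ioi_pow_nonneg (ν := ν) hb0.le 2
  have hγ1 := setIntegral_Ioi_pow_le hb0 (k := 2) (j := 1) rfl h2 h3
  simp only [pow_one] at hβ0 hβ1 hγ1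
  have hs1 := integral_eq_setIntegral_Iic_add_Ioi h1 b
  have hs2 := integral_eq_setIntegral_Iic_add_Ioi h2 b
  rw [← hν'] at hs1 hs2
  rw [hV] at hs2
  set β := ∫ y in Set.Ioi b, y ∂ν
  set γ₂ := ∫ y in Set.Ioi b, y ^ 2 ∂ν
  have hb2 : 2 ≤ b := by rw [hb]; linarith
  have hβA : β ≤ 0.04 * A := by
    have : L / b ^ 2 ≤ L / 2 ^ 2 := by gcongr
    linarith
  have hγL : γ₂ ≤ L / 2 := hγ1.trans (by gcongr)
  set W := ∫ y, y ^ 2 * Real.exp y ∂ν' with hW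
  have hW1 : W - ∫ y, y ^ 2 ∂ν' ≤ A := by
    rw [hW, ← integral_sub hy2e' h2']
    refine (integral_mono_ae (hy2e'.sub h2') hdom
      (hae.mono fun y hy => sq_mul_exp_sub_one_le hy)).trans ?_
    rwa [integral_mul_const]
  have hW2 : -L ≤ W - ∫ y, y ^ 2 ∂ν' := by
    rw [hW, ← integral_sub hy2e' h2']
    refine le_trans ?_ (integral_mono (h3'.neg) (hy2e'.sub h2')
      fun y => neg_abs_pow_le_sq_mul_exp_sub y)
    simp only [Pi.neg_apply]
    rw [integral_neg]
    linarith
  have hWA : |W - 1| ≤ A := by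
    rw [abs_le]; constructor <;> linarith
  have hW0 : 0 < W := by
    rw [abs_le] at hWA; linarith
  set σ := Real.sqrt W with hσ
  have hσ0 : 0 < σ := Real.sqrt_pos.2 hW0
  have hσW : σ ^ 2 = W := Real.sq_sqrt hW0.le
  have key := compoundPoisson_tail_tilted hexp' hσ0 (hW.symm.trans hσW.symm) (∫ y, y ∂ν + x)
  set Λ := ∫ y, (Real.exp y - 1) ∂ν' with hΛ
  set M := ∫ y, y * Real.exp y ∂ν' with hM
  have hT : ∫ y, |y| ^ 3 * Real.exp y ∂ν' ≤ A := by
    refine (integral_mono_ae hy3e' hdom (hae.mono fun y hy => ?_)).trans ?_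
    · exact mul_le_mul_of_nonneg_left (Real.exp_le_exp.2 hy) (by positivity)
    · rwa [integral_mul_const]
  have hE : |Λ - M + σ ^ 2 / 2| ≤ A / 6 := by
    have e : Λ - M + σ ^ 2 / 2 = ∫ y, (Real.exp y * (1 - y + y ^ 2 / 2) - 1) ∂ν' := by
      have hi : Integrable (fun y => Real.exp y - 1 - y * Real.exp y) ν' := he1'.sub hye'
      rw [hσW, hΛ, hM, hW, ← integral_sub he1' hye', ← integral_div,
        ← integral_add hi (hy2e'.div_const 2)]
      congr 1 with y
      ring
    have := hbd (fun y => 6 * (Real.exp y * (1 - y + y ^ 2 / 2) - 1)) fun y hy => by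
      rw [abs_mul, abs_of_pos (by norm_num : (0:ℝ) < 6)]
      linarith [abs_exp_mul_quadratic_sub_one_le hb0.le hy]
    rw [integral_const_mul, ← e, abs_mul, abs_of_pos (by norm_num : (0:ℝ) < 6)] at this
    linarith
  have hη : |∫ y, y ∂ν' - M + W| ≤ A := by
    have hi : Integrable (fun y => y - y * Real.exp y) ν' := h1'.sub hye'
    rw [hM, hW, ← integral_sub h1' hye', ← integral_add hi hy2e']
    exact hbd _ fun y hy => abs_exp_mul_sub_le hb0.le hy
  have hΛz : Λ - (∫ y, y ∂ν + x) ≤ 1 / 2 + A / 6 - x := by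
    have h : Λ - ∫ y, y ∂ν' - (∫ y, y ^ 2 ∂ν') / 2 ≤ A / 6 := by
      have hi : Integrable (fun y => Real.exp y - 1 - y) ν' := he1'.sub h1'
      rw [hΛ, ← integral_sub he1' h1', ← integral_div, ← integral_sub hi (h2'.div_const 2)]
      refine (integral_mono_ae (hi.sub (h2'.div_const 2)) (hdom.div_const 6)
        (hae.mono fun y hy => exp_sub_quadratic_le hy)).trans ?_
      rw [integral_div, integral_mul_const]
      linarith
    linarith
  have hpert := gaussian_tail_perturbation (a := (∫ y, y ∂ν + x - M + σ ^ 2) / σ) hx hA0 hA2 hσ0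
    (by rwa [hσW]) hE (by
      rw [div_mul_cancel₀ _ hσ0.ne', hσW, hs1]
      have e : ∫ y, y ∂ν' + β + x - M + W - x = (∫ y, y ∂ν' - M + W) + β := by ring
      rw [e]
      refine (abs_add_le _ _).trans ?_
      rw [abs_of_nonneg hβ0]
      linarith)
  refine (abs_sub_le _ _ _).trans ((add_le_add key hpert).trans ?_)
  refine le_trans (add_le_add_left ?_ _) (tail_error_le hx hL0 hA hA2 hσ0 (by rwa [hσW]))
  gcongr

/-- Non-uniform bound for the upper tail of a standardized compound Poisson law. -/
theorem compoundPoisson_Ioi_sub_le {ν : Measure ℝ} [IsFiniteMeasure ν]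
    (hexp : ∀ s : ℝ, Integrable (fun y => Real.exp (s * y)) ν) (hV : ∫ y, y ^ 2 ∂ν = 1) {x : ℝ}
    (hx : 4 ≤ x) :
    |(compoundPoisson ν).real (Set.Ioi (∫ y, y ∂ν + x)) - (gaussianReal 0 1).real (Set.Ioi x)| ≤
      31.4 * (∫ y, |y| ^ 3 ∂ν) / x ^ 3 := by
  have hx0 : 0 < x := by linarith
  have h3 := integrable_abs_pow_of_exp hexp 3
  have hL0 := integral_abs_pow_three_pos h3 (by rw [hV]; norm_num)
  have hcut : |(compoundPoisson ν).real (Set.Ioi (∫ y, y ∂ν + x)) -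
      (compoundPoisson (ν.restrict (Set.Iic (x / 2)))).real (Set.Ioi (∫ y, y ∂ν + x))| ≤
        8 * (∫ y, |y| ^ 3 ∂ν) / x ^ 3 := by
    refine (abs_compoundPoisson_sub_le Measure.restrict_le_self measurableSet_Ioi).trans ?_
    have h0 := setIntegral_Ioi_pow_le (half_pos hx0) (k := 0) (j := 3) rfl
      (by simp) h3
    have h1 : ν.real Set.univ = ν.real (Set.Iic (x / 2)) + ν.real (Set.Ioi (x / 2)) := by
      rw [← Set.compl_Iic, measureReal_add_measureReal_compl measurableSet_Iic]
    simp only [pow_zero, integral_const, measureReal_restrict_apply_univ, smul_eq_mul,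
      mul_one] at h0 ⊢
    have e : (∫ y, |y| ^ 3 ∂ν) / (x / 2) ^ 3 = 8 * (∫ y, |y| ^ 3 ∂ν) / x ^ 3 := by
      field_simp
      ring
    linarith
  set L := ∫ y, |y| ^ 3 ∂ν with hLd
  have e8 : ∀ c : ℝ, c * L / x ^ 3 = c / 8 * (8 * L / x ^ 3) := fun c => by ring
  rcases le_total (8 * L / x ^ 3) (Real.exp (-(x ^ 2 / 2))) with hs | hs
  · have := compoundPoisson_restrict_Ioi_sub_le_of_small hexp hV hx hs
    refine (abs_sub_le _ _ _).trans ((add_le_add hcut this).trans (le_of_eq ?_))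
    rw [← hLd]
    ring
  · have hr0 : 0 < 8 * L / x ^ 3 := by positivity
    have hP : (compoundPoisson ν).real (Set.Ioi (∫ y, y ∂ν + x)) ≤ 31.4 * L / x ^ 3 := by
      rcases le_total (8 * L / x ^ 3) 1 with h1 | h1
      · have := compoundPoisson_restrict_Ioi_le_of_large hexp hV hx0 hL0 h1 hs
        rw [e8]
        have he := Real.exp_one_lt_d9
        rw [abs_le] at hcut
        nlinarith
      · rw [e8]
        refine (measureReal_le_one).trans ?_
        nlinarith
    have hG : (gaussianReal 0 1).real (Set.Ioi x) ≤ 31.4 * L / x ^ 3 := by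
      refine (gaussianReal_real_Ioi_le hx0.le).trans (hs.trans ?_)
      rw [e8 31.4]
      nlinarith
    rw [abs_le]
    constructor <;> linarith [measureReal_nonneg (μ := gaussianReal 0 1) (s := Set.Ioi x),
      measureReal_nonneg (μ := compoundPoisson ν) (s := Set.Ioi (∫ y, y ∂ν + x))]

lemma continuous_gaussianReal_real_Iic :
    Continuous fun x => (gaussianReal 0 1).real (Set.Iic x) := by
  have : NullSingletonClass (gaussianReal 0 1) := nullSingletonClass_gaussianReal one_ne_zero
  have h := (integrable_const (μ := gaussianReal 0 1) (1 : ℝ)).continuous_primitive 0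
  have e : (fun x => (gaussianReal 0 1).real (Set.Iic x)) = fun x =>
      (∫ _ in (0:ℝ)..x, (1 : ℝ) ∂(gaussianReal 0 1)) + (gaussianReal 0 1).real (Set.Iic 0) := by
    ext x
    rw [← intervalIntegral.integral_Iic_sub_Iic (integrable_const _).integrableOn
      (integrable_const _).integrableOn]
    simp
  rw [e]
  exact h.add continuous_const

lemma gaussianReal_real_Iic_neg (x : ℝ) :
    (gaussianReal 0 1).real (Set.Iic (-x)) = (gaussianReal 0 1).real (Set.Ioi x) := by
  have : NullSingletonClass (gaussianReal 0 1) := nullSingletonClass_gaussianReal one_ne_zero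
  have h : (gaussianReal 0 1).map (fun y => -y) = gaussianReal 0 1 := by
    rw [gaussianReal_map_neg]; simp
  nth_rewrite 1 [← h]
  rw [map_measureReal_apply (by fun_prop) measurableSet_Iic,
    measureReal_congr (Ioi_ae_eq_Ici (μ := gaussianReal 0 1) (a := x))]
  congr 1
  ext y
  simp

lemma compoundPoisson_Iic_uniform {ν : Measure ℝ} [IsFiniteMeasure ν]
    (hexp : ∀ s : ℝ, Integrable (fun y => Real.exp (s * y)) ν) (hV : ∫ y, y ^ 2 ∂ν = 1) (x : ℝ) :
    |(compoundPoisson ν).real (Set.Iic (∫ y, y ∂ν + x)) - (gaussianReal 0 1).real (Set.Iic x)| ≤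
      0.4785 * ∫ y, |y| ^ 3 ∂ν := by
  have h1 : Integrable (fun y => y) ν := by simpa using integrable_pow_of_exp hexp 1
  have h2 := integrable_pow_of_exp hexp 2
  have h3 := integrable_abs_pow_of_exp hexp 3
  have hid : Integrable (fun y => y) (compoundPoisson ν) := by
    simpa using integrable_pow_of_exp (fun s => integrable_exp_compoundPoisson (hexp s)) 1
  have hchar : ∀ u, charFun (compoundPoisson ν) u =
      Complex.exp ((u * ∫ y, y ∂ν : ℝ) * Complex.I + ∫ y, levyKernel u y ∂ν) := by
    intro u
    have hi : Integrable (fun y : ℝ => ((u * y : ℝ) : ℂ) * Complex.I) ν :=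
      (h1.const_mul u).ofReal.mul_const _
    rw [charFun_compoundPoisson, ← integral_const_mul, ← integral_complex_ofReal,
      ← integral_mul_const, ← integral_add hi (integrable_levyKernel h2 h3 u)]
    congr 2 with y
    rw [levyKernel]
    push_cast
    ring
  have := uniform_bound one_pos hid h2 h3 (by simpa using hV) hchar (∫ y, y ∂ν + x)
  simpa using this

lemma compoundPoisson_Ici_sub_le {ν : Measure ℝ} [IsFiniteMeasure ν]
    (hexp : ∀ s : ℝ, Integrable (fun y => Real.exp (s * y)) ν) (hV : ∫ y, y ^ 2 ∂ν = 1) {x : ℝ}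
    (hx : 4 < x) :
    |(compoundPoisson ν).real (Set.Ici (∫ y, y ∂ν + x)) - (gaussianReal 0 1).real (Set.Ioi x)| ≤
      31.4 * (∫ y, |y| ^ 3 ∂ν) / x ^ 3 := by
  set m := ∫ y, y ∂ν
  set L := ∫ y, |y| ^ 3 ∂ν
  have hlow := compoundPoisson_Ioi_sub_le hexp hV hx.le
  have hmono : (compoundPoisson ν).real (Set.Ioi (m + x)) ≤
      (compoundPoisson ν).real (Set.Ici (m + x)) := measureReal_mono Set.Ioi_subset_Ici_self
  have hcont : Tendsto (fun t => (gaussianReal 0 1).real (Set.Ioi t) + 31.4 * L / t ^ 3)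
      (𝓝[<] x) (𝓝 ((gaussianReal 0 1).real (Set.Ioi x) + 31.4 * L / x ^ 3)) := by
    refine tendsto_nhdsWithin_of_tendsto_nhds (ContinuousAt.tendsto ?_)
    simp only [← gaussianReal_real_Iic_neg]
    refine (continuous_gaussianReal_real_Iic.comp continuous_neg).continuousAt.add ?_
    have : x ^ 3 ≠ 0 := by positivity
    fun_prop (disch := assumption)
  have hup : (compoundPoisson ν).real (Set.Ici (m + x)) ≤
      (gaussianReal 0 1).real (Set.Ioi x) + 31.4 * L / x ^ 3 := by
    refine ge_of_tendsto hcont ?_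
    filter_upwards [Ioo_mem_nhdsLT hx] with t ht
    have h := (abs_le.1 (compoundPoisson_Ioi_sub_le hexp hV ht.1.le)).2
    have : (compoundPoisson ν).real (Set.Ici (m + x)) ≤
        (compoundPoisson ν).real (Set.Ioi (m + t)) :=
      measureReal_mono (Set.Ici_subset_Ioi.2 (by linarith [ht.2]))
    linarith
  rw [abs_le] at hlow ⊢
  constructor <;> linarith

lemma compoundPoisson_Iic_standardized {ν : Measure ℝ} [IsFiniteMeasure ν]
    (hexp : ∀ s : ℝ, Integrable (fun y => Real.exp (s * y)) ν) (hV : ∫ y, y ^ 2 ∂ν = 1) (x : ℝ) :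
    |(compoundPoisson ν).real (Set.Iic (∫ y, y ∂ν + x)) - (gaussianReal 0 1).real (Set.Iic x)| ≤
      (∫ y, |y| ^ 3 ∂ν) * min 0.4785 (31.935 / (1 + |x| ^ 3)) := by
  have hu := compoundPoisson_Iic_uniform hexp hV x
  have hL0 := integral_abs_pow_three_pos (integrable_abs_pow_of_exp hexp 3)
    (by rw [hV]; norm_num)
  set L := ∫ y, |y| ^ 3 ∂ν with hL
  rw [mul_min_of_nonneg _ _ hL0.le]
  refine le_min (by linarith) ?_
  have htail : 4 ≤ |x| → 31.4 * L / |x| ^ 3 ≤ L * (31.935 / (1 + |x| ^ 3)) := by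
    intro hx
    have h64 : 4 ^ 3 ≤ |x| ^ 3 := by gcongr
    rw [← mul_div_assoc, div_le_div_iff₀ (by positivity) (by positivity)]
    nlinarith
  rcases le_or_gt |x| 4 with hx | hx
  · refine hu.trans ?_
    have h64 : |x| ^ 3 ≤ 4 ^ 3 := by gcongr
    rw [← mul_div_assoc, le_div_iff₀ (by positivity)]
    nlinarith
  · refine le_trans ?_ (htail hx.le)
    rcases le_total 0 x with h | h
    · rw [abs_of_nonneg h] at hx ⊢
      have := compoundPoisson_Ioi_sub_le hexp hV hx.le
      rwa [← Set.compl_Iic, ← Set.compl_Iic, probReal_compl_eq_one_sub measurableSet_Iic,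
        probReal_compl_eq_one_sub measurableSet_Iic, sub_sub_sub_cancel_left, abs_sub_comm] at this
    · rw [abs_of_nonpos h] at hx ⊢
      have hm : Measurable fun y : ℝ => -1 * y := by fun_prop
      have := compoundPoisson_Ici_sub_le (ν := ν.map (-1 * ·)) (x := -x) (fun s => by
          rw [integrable_map_measure (by fun_prop) hm.aemeasurable]
          simpa [Function.comp_def] using hexp (-s))
        (by rw [integral_map hm.aemeasurable (by fun_prop)]; simpa using hV) hx
      rw [integral_map hm.aemeasurable (by fun_prop), integral_map hm.aemeasurable (by fun_prop),
        compoundPoisson_map_mul, map_measureReal_apply hm measurableSet_Ici,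
        ← gaussianReal_real_Iic_neg, neg_neg, integral_const_mul] at this
      simp only [neg_one_mul, abs_neg] at this
      have e : (fun y => -y) ⁻¹' Set.Ici (-∫ y, y ∂ν + -x) = Set.Iic (∫ y, y ∂ν + x) := by
        ext y
        simp only [Set.mem_Iic, Set.mem_preimage, Set.mem_Ici]
        constructor <;> intro _ <;> linarith
      rwa [e] at this

/-- Uniform and non-uniform Berry-Esseen bounds for a compound Poisson law. -/
theorem compoundPoisson_Iic_sub_le {ν : Measure ℝ} [IsFiniteMeasure ν]
    (hexp : ∀ s : ℝ, Integrable (fun y => Real.exp (s * y)) ν) {σ : ℝ} (hσ : 0 < σ)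
    (hV : ∫ y, y ^ 2 ∂ν = σ ^ 2) (x : ℝ) :
    |(compoundPoisson ν).real (Set.Iic (∫ y, y ∂ν + σ * x)) -
      (gaussianReal 0 1).real (Set.Iic x)| ≤
      (∫ y, |y| ^ 3 ∂ν) / σ ^ 3 * min 0.4785 (31.935 / (1 + |x| ^ 3)) := by
  have hm : Measurable fun y : ℝ => σ⁻¹ * y := by fun_prop
  have := compoundPoisson_Iic_standardized (ν := ν.map (σ⁻¹ * ·)) (fun s => by
      rw [integrable_map_measure (by fun_prop) hm.aemeasurable]
      simpa [Function.comp_def, ← mul_assoc] using hexp (s * σ⁻¹))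
    (by
      rw [integral_map hm.aemeasurable (by fun_prop)]
      simp only [mul_pow]
      rw [integral_const_mul, hV]
      field_simp) x
  rw [integral_map hm.aemeasurable (by fun_prop), integral_map hm.aemeasurable (by fun_prop),
    compoundPoisson_map_mul, map_measureReal_apply hm measurableSet_Iic, integral_const_mul] at this
  simp only [abs_mul, mul_pow, abs_inv, abs_of_pos hσ] at this
  rw [integral_const_mul, ← div_eq_inv_mul, inv_pow, ← div_eq_inv_mul] at this
  convert this using 4
  ext y
  simp only [Set.mem_Iic, Set.mem_preimage]
  rw [← div_eq_inv_mul, div_le_iff₀ hσ, add_mul, div_mul_cancel₀ _ hσ.ne', mul_comm σ]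

/-! ### Moments from the Laplace transform -/

lemma integrable_and_integral_eq_of_tendsto {α : Type*} [MeasurableSpace α] {ρ : Measure α}
    {f : ℕ → α → ℝ} {g : α → ℝ} {c : ℝ} (hg : AEStronglyMeasurable g ρ)
    (hf : ∀ n, Integrable (f n) ρ) (hf0 : ∀ n, ∀ᵐ w ∂ρ, 0 ≤ f n w)
    (hfg : ∀ n, ∀ᵐ w ∂ρ, f n w ≤ g w)
    (hlim : ∀ᵐ w ∂ρ, Tendsto (fun n => f n w) atTop (𝓝 (g w)))
    (hc : Tendsto (fun n => ∫ w, f n w ∂ρ) atTop (𝓝 c)) :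
    Integrable g ρ ∧ ∫ w, g w ∂ρ = c := by
  have hgi : Integrable g ρ := by
    refine ⟨hg, ?_⟩
    have h1 : ∫⁻ w, ‖g w‖ₑ ∂ρ ≤ liminf (fun n => ∫⁻ w, ‖f n w‖ₑ ∂ρ) atTop := by
      refine le_trans (lintegral_mono_ae (hlim.mono fun w hw => ?_))
        (lintegral_liminf_le' fun n => (hf n).1.enorm)
      exact hw.enorm.liminf_eq.ge
    have h2 : ∀ n, ∫⁻ w, ‖f n w‖ₑ ∂ρ = ENNReal.ofReal (∫ w, f n w ∂ρ) := fun n => by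
      rw [ofReal_integral_eq_lintegral_ofReal (hf n) (hf0 n)]
      exact lintegral_congr_ae ((hf0 n).mono fun w hw => Real.enorm_of_nonneg hw)
    simp only [h2] at h1
    have h3 : Tendsto (fun n => ENNReal.ofReal (∫ w, f n w ∂ρ)) atTop (𝓝 (ENNReal.ofReal c)) :=
      (ENNReal.continuous_ofReal.tendsto c).comp hc
    rw [h3.liminf_eq] at h1
    exact h1.trans_lt ENNReal.ofReal_lt_top
  refine ⟨hgi, tendsto_nhds_unique ?_ hc⟩
  refine tendsto_integral_of_dominated_convergence g (fun n => (hf n).1) hgi (fun n => ?_) hlim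
  filter_upwards [hf0 n, hfg n] with w h0 h1
  rwa [Real.norm_of_nonneg h0]

lemma tendsto_mul_exp_sub_one {k c : ℕ → ℝ} {l : ℝ} (hk : Tendsto k atTop atTop)
    (hc : Tendsto (fun n => k n * c n) atTop (𝓝 l)) :
    Tendsto (fun n => k n * (Real.exp (c n) - 1)) atTop (𝓝 l) := by
  have hc0 : Tendsto c atTop (𝓝 0) := by
    have := hc.div_atTop hk
    refine this.congr' ?_
    filter_upwards [hk.eventually_gt_atTop 0] with n hn
    field_simp
  have hd : Tendsto (fun n => k n * (Real.exp (c n) - 1) - k n * c n) atTop (𝓝 0) := by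
    have hb : Tendsto (fun n => |k n * c n| * |c n|) atTop (𝓝 0) := by
      simpa using hc.abs.mul hc0.abs
    refine squeeze_zero_norm' ?_ hb
    have h1 : ∀ᶠ n in atTop, |c n| < 1 := by
      have := hc0.abs
      rw [abs_zero] at this
      exact this.eventually_lt_const one_pos
    filter_upwards [h1] with n hn
    have := Real.abs_exp_sub_one_sub_id_le hn.le
    rw [Real.norm_eq_abs, ← mul_sub, abs_mul, abs_mul, mul_assoc, ← sq, sq_abs]
    gcongr
  simpa using hd.add hc

lemma one_sub_exp_neg_nonneg {y : ℝ} (hy : 0 ≤ y) : 0 ≤ 1 - Real.exp (-y) :=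
  sub_nonneg.2 (Real.exp_le_one_iff.2 (neg_nonpos.2 hy))

lemma mul_one_sub_exp_neg_div_le (n : ℕ) (y : ℝ) :
    ((n : ℝ) + 1) * (1 - Real.exp (-(y / (n + 1)))) ≤ y := by
  have h := Real.add_one_le_exp (-(y / ((n : ℝ) + 1)))
  have hn : (0 : ℝ) < n + 1 := by positivity
  calc _ ≤ ((n : ℝ) + 1) * (y / (n + 1)) := by gcongr; linarith
    _ = y := by field_simp

lemma tendsto_mul_one_sub_exp_neg_div (y : ℝ) :
    Tendsto (fun n : ℕ => ((n : ℝ) + 1) * (1 - Real.exp (-(y / (n + 1))))) atTop (𝓝 y) := by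
  have h := tendsto_mul_exp_sub_one (k := fun n : ℕ => (n : ℝ) + 1)
    (c := fun n : ℕ => -(y / ((n : ℝ) + 1))) (l := -y)
    (tendsto_natCast_atTop_atTop.atTop_add tendsto_const_nhds)
    (tendsto_const_nhds.congr fun n => by field_simp)
  have h2 := h.neg
  rw [neg_neg] at h2
  exact h2.congr fun n => by ring

/-- Convergence of the difference quotients of the Laplace transform at the origin. -/
lemma tendsto_integral_pow_one_sub_exp {ν : Measure ℝ} (hν : ∀ᵐ y ∂ν, 0 ≤ y) (k : ℕ)
    (hk : Integrable (fun y => y ^ k) ν) :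
    Tendsto (fun n : ℕ => ∫ y, (((n : ℝ) + 1) * (1 - Real.exp (-(y / (n + 1))))) ^ k ∂ν) atTop
      (𝓝 (∫ y, y ^ k ∂ν)) := by
  refine tendsto_integral_of_dominated_convergence (fun y => y ^ k)
    (fun n => Continuous.aestronglyMeasurable (by fun_prop)) hk (fun n => ?_)
    (ae_of_all _ fun y => (tendsto_mul_one_sub_exp_neg_div y).pow k)
  filter_upwards [hν] with y hy
  have h0 : 0 ≤ ((n : ℝ) + 1) * (1 - Real.exp (-(y / (n + 1)))) :=
    mul_nonneg (by positivity) (one_sub_exp_neg_nonneg (by positivity))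
  rw [Real.norm_of_nonneg (pow_nonneg h0 k)]
  exact pow_le_pow_left₀ h0 (mul_one_sub_exp_neg_div_le n y) k

lemma integrable_one_sub_exp_neg {ν : Measure ℝ} (hν : ∀ᵐ y ∂ν, 0 ≤ y)
    (h1 : Integrable (fun y => y) ν) {s : ℝ} (hs : 0 ≤ s) :
    Integrable (fun y => 1 - Real.exp (-(s * y))) ν := by
  refine (h1.const_mul s).mono' (Continuous.aestronglyMeasurable (by fun_prop)) ?_
  filter_upwards [hν] with y hy
  rw [Real.norm_of_nonneg (one_sub_exp_neg_nonneg (by positivity))]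
  linarith [Real.add_one_le_exp (-(s * y))]

section LaplaceMoments

variable {ρ ν : Measure ℝ} [IsProbabilityMeasure ρ]

lemma integrable_exp_neg_mul_of_nonneg (hρ : ∀ᵐ w ∂ρ, 0 ≤ w) {s : ℝ} (hs : 0 ≤ s) :
    Integrable (fun w => Real.exp (-(s * w))) ρ := by
  refine (integrable_const (1 : ℝ)).mono' (Continuous.aestronglyMeasurable (by fun_prop)) ?_
  filter_upwards [hρ] with w hw
  rw [Real.norm_of_nonneg (Real.exp_pos _).le, Real.exp_le_one_iff]
  exact neg_nonpos.2 (by positivity)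

lemma integral_eq_of_laplace (hρ : ∀ᵐ w ∂ρ, 0 ≤ w) (hν : ∀ᵐ y ∂ν, 0 ≤ y)
    (h1 : Integrable (fun y => y) ν)
    (hL : ∀ s : ℝ, 0 ≤ s →
      ∫ w, Real.exp (-(s * w)) ∂ρ = Real.exp (-∫ y, (1 - Real.exp (-(s * y))) ∂ν)) :
    Integrable (fun w => w) ρ ∧ ∫ w, w ∂ρ = ∫ y, y ∂ν := by
  have hdiv : ∀ (n : ℕ) (w : ℝ), w / ((n : ℝ) + 1) = ((n : ℝ) + 1)⁻¹ * w := fun n w => by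
    rw [div_eq_inv_mul]
  have hn0 : ∀ n : ℕ, 0 ≤ ((n : ℝ) + 1)⁻¹ := fun n => by positivity
  refine integrable_and_integral_eq_of_tendsto
    (f := fun (n : ℕ) w => ((n : ℝ) + 1) * (1 - Real.exp (-(w / (n + 1)))))
    aestronglyMeasurable_id (fun n => ?_) (fun n => ?_)
    (fun n => ae_of_all _ (mul_one_sub_exp_neg_div_le n))
    (ae_of_all _ tendsto_mul_one_sub_exp_neg_div) ?_
  · simp only [hdiv]
    exact ((integrable_const _).sub (integrable_exp_neg_mul_of_nonneg hρ (hn0 n))).const_mul _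
  · filter_upwards [hρ] with w hw
    exact mul_nonneg (by positivity) (one_sub_exp_neg_nonneg (by positivity))
  · have hν1 := tendsto_integral_pow_one_sub_exp hν 1 (by simpa using h1)
    simp only [pow_one, integral_const_mul] at hν1
    have h := tendsto_mul_exp_sub_one (k := fun n : ℕ => (n : ℝ) + 1)
      (c := fun n : ℕ => -∫ y, (1 - Real.exp (-(y / ((n : ℝ) + 1)))) ∂ν) (l := -∫ y, y ∂ν)
      (tendsto_natCast_atTop_atTop.atTop_add tendsto_const_nhds)
      (hν1.neg.congr fun n => by ring)
    have h2 := h.neg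
    rw [neg_neg] at h2
    refine h2.congr fun n => ?_
    simp only [hdiv]
    rw [integral_const_mul, integral_sub (integrable_const _)
      (integrable_exp_neg_mul_of_nonneg hρ (hn0 n)), hL _ (hn0 n)]
    simp
    ring

lemma integral_sq_eq_of_laplace (hρ : ∀ᵐ w ∂ρ, 0 ≤ w) (hν : ∀ᵐ y ∂ν, 0 ≤ y)
    (h1 : Integrable (fun y => y) ν) (h2 : Integrable (fun y => y ^ 2) ν)
    (hL : ∀ s : ℝ, 0 ≤ s →
      ∫ w, Real.exp (-(s * w)) ∂ρ = Real.exp (-∫ y, (1 - Real.exp (-(s * y))) ∂ν)) :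
    Integrable (fun w => w ^ 2) ρ ∧ ∫ w, w ^ 2 ∂ρ = (∫ y, y ∂ν) ^ 2 + ∫ y, y ^ 2 ∂ν := by
  have hdiv : ∀ (n : ℕ) (w : ℝ), w / ((n : ℝ) + 1) = ((n : ℝ) + 1)⁻¹ * w := fun n w => by
    rw [div_eq_inv_mul]
  have hn0 : ∀ n : ℕ, 0 ≤ ((n : ℝ) + 1)⁻¹ := fun n => by positivity
  have hexpand : ∀ (n : ℕ) (w : ℝ), (((n : ℝ) + 1) * (1 - Real.exp (-(w / (n + 1))))) ^ 2 =
      ((n : ℝ) + 1) ^ 2 * (1 - 2 * Real.exp (-(((n : ℝ) + 1)⁻¹ * w)) +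
        Real.exp (-((2 * ((n : ℝ) + 1)⁻¹) * w))) := by
    intro n w
    have : Real.exp (-((2 * ((n : ℝ) + 1)⁻¹) * w)) = Real.exp (-(((n : ℝ) + 1)⁻¹ * w)) ^ 2 := by
      rw [← Real.exp_nat_mul]; push_cast; ring_nf
    rw [this, hdiv]
    ring
  have hiρ : ∀ n : ℕ, Integrable (fun w => 1 - 2 * Real.exp (-(((n : ℝ) + 1)⁻¹ * w))) ρ :=
    fun n => (integrable_const _).sub ((integrable_exp_neg_mul_of_nonneg hρ (hn0 n)).const_mul _)
  have hiρ2 : ∀ n : ℕ, Integrable (fun w => Real.exp (-((2 * ((n : ℝ) + 1)⁻¹) * w))) ρ :=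
    fun n => integrable_exp_neg_mul_of_nonneg hρ (by positivity)
  refine integrable_and_integral_eq_of_tendsto
    (f := fun (n : ℕ) w => (((n : ℝ) + 1) * (1 - Real.exp (-(w / (n + 1))))) ^ 2)
    (Continuous.aestronglyMeasurable (by fun_prop)) (fun n => ?_)
    (fun n => ae_of_all _ fun w => sq_nonneg _) (fun n => ?_)
    (ae_of_all _ fun w => (tendsto_mul_one_sub_exp_neg_div w).pow 2) ?_
  · simp only [hexpand]
    exact ((hiρ n).add (hiρ2 n)).const_mul _
  · filter_upwards [hρ] with w hw
    exact pow_le_pow_left₀ (mul_nonneg (by positivity) (one_sub_exp_neg_nonneg (by positivity)))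
      (mul_one_sub_exp_neg_div_le n w) 2
  · set a : ℕ → ℝ := fun n => ∫ y, (1 - Real.exp (-(((n : ℝ) + 1)⁻¹ * y))) ∂ν with ha
    set b : ℕ → ℝ := fun n => ∫ y, (1 - Real.exp (-(((n : ℝ) + 1)⁻¹ * y))) ^ 2 ∂ν with hb
    have hat : Tendsto (fun n : ℕ => ((n : ℝ) + 1) * a n) atTop (𝓝 (∫ y, y ∂ν)) := by
      have hν1 := tendsto_integral_pow_one_sub_exp hν 1 (by simpa using h1)
      simpa only [pow_one, integral_const_mul, hdiv] using hν1
    have hbt : Tendsto (fun n : ℕ => ((n : ℝ) + 1) ^ 2 * b n) atTop (𝓝 (∫ y, y ^ 2 ∂ν)) := by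
      have hν1 := tendsto_integral_pow_one_sub_exp hν 2 h2
      simpa only [mul_pow, integral_const_mul, hdiv] using hν1
    have hk : Tendsto (fun n : ℕ => (n : ℝ) + 1) atTop atTop :=
      tendsto_natCast_atTop_atTop.atTop_add tendsto_const_nhds
    have hA := (tendsto_mul_exp_sub_one hk (c := fun n => -a n) (l := -∫ y, y ∂ν)
      (hat.neg.congr fun n => by ring))
    have hB := tendsto_mul_exp_sub_one ((tendsto_pow_atTop two_ne_zero).comp hk) hbt
    have ha0 : Tendsto a atTop (𝓝 0) := by
      refine (hat.div_atTop hk).congr fun n => ?_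
      have : (n : ℝ) + 1 ≠ 0 := by positivity
      field_simp
    have hE : Tendsto (fun n => Real.exp (-(2 * a n))) atTop (𝓝 1) := by
      have := (Real.continuous_exp.tendsto _).comp ((ha0.const_mul 2).neg)
      simpa [Function.comp_def] using this
    have hfin := (hA.pow 2).add (hE.mul hB)
    rw [neg_sq, one_mul] at hfin
    refine hfin.congr fun n => ?_
    have hab : 2 * a n - ∫ y, (1 - Real.exp (-((2 * ((n : ℝ) + 1)⁻¹) * y))) ∂ν = b n := by
      rw [ha, hb]
      simp only
      rw [← integral_const_mul, ← integral_sub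
        ((integrable_one_sub_exp_neg hν h1 (hn0 n)).const_mul 2)
        (integrable_one_sub_exp_neg hν h1 (by positivity))]
      congr 1 with y
      have : Real.exp (-((2 * ((n : ℝ) + 1)⁻¹) * y)) = Real.exp (-(((n : ℝ) + 1)⁻¹ * y)) ^ 2 := by
        rw [← Real.exp_nat_mul]; push_cast; ring_nf
      rw [this]
      ring
    simp only [hexpand]
    rw [integral_const_mul, integral_add (hiρ n) (hiρ2 n), integral_sub (integrable_const _)
      ((integrable_exp_neg_mul_of_nonneg hρ (hn0 n)).const_mul _), integral_const_mul,
      hL _ (hn0 n), hL _ (by positivity)]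
    have e : Real.exp (-∫ y, (1 - Real.exp (-((2 * ((n : ℝ) + 1)⁻¹) * y))) ∂ν) =
        Real.exp (-a n) ^ 2 * Real.exp (b n) := by
      rw [← Real.exp_nat_mul, ← Real.exp_add, ← hab]
      congr 1
      push_cast
      ring
    have e2 : Real.exp (-(2 * a n)) = Real.exp (-a n) ^ 2 := by
      rw [← Real.exp_nat_mul]; push_cast; ring_nf
    rw [e, e2]
    simp only [Function.comp_apply, integral_const, probReal_univ, smul_eq_mul, mul_one]
    ring

end LaplaceMoments

/-! ### Convergence of Laplace transforms implies weak convergence -/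

lemma tendsto_integral_comp_exp_neg {ρn : ℕ → Measure ℝ} {ρ : Measure ℝ}
    [∀ n, IsProbabilityMeasure (ρn n)] [IsProbabilityMeasure ρ]
    (h0n : ∀ n, ∀ᵐ w ∂(ρn n), 0 ≤ w) (h0 : ∀ᵐ w ∂ρ, 0 ≤ w)
    (hL : ∀ k : ℕ, Tendsto (fun n => ∫ w, Real.exp (-(k * w)) ∂(ρn n)) atTop
      (𝓝 (∫ w, Real.exp (-(k * w)) ∂ρ)))
    {f : ℝ → ℝ} (hf : Continuous f) :
    Tendsto (fun n => ∫ w, f (Real.exp (-w)) ∂(ρn n)) atTop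
      (𝓝 (∫ w, f (Real.exp (-w)) ∂ρ)) := by
  have hIcc : ∀ w : ℝ, 0 ≤ w → Real.exp (-w) ∈ Set.Icc (0 : ℝ) 1 := fun w hw =>
    ⟨(Real.exp_pos _).le, Real.exp_le_one_iff.2 (neg_nonpos.2 hw)⟩
  have hint : ∀ (τ : Measure ℝ) [IsProbabilityMeasure τ], (∀ᵐ w ∂τ, 0 ≤ w) →
      ∀ g : ℝ → ℝ, Continuous g → Integrable (fun w => g (Real.exp (-w))) τ := by
    intro τ _ hτ g hg
    obtain ⟨C, hC⟩ := isCompact_Icc.exists_bound_of_continuousOn (hg.continuousOn (s := Set.Icc 0 1))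
    refine Integrable.of_bound (by fun_prop) C (hτ.mono fun w hw => hC _ (hIcc w hw))
  have hpoly : ∀ r : Polynomial ℝ, Tendsto (fun n => ∫ w, r.eval (Real.exp (-w)) ∂(ρn n)) atTop
      (𝓝 (∫ w, r.eval (Real.exp (-w)) ∂ρ)) := by
    intro r
    have hsum : ∀ (τ : Measure ℝ) [IsProbabilityMeasure τ], (∀ᵐ w ∂τ, 0 ≤ w) →
        ∫ w, r.eval (Real.exp (-w)) ∂τ
          = ∑ k ∈ Finset.range (r.natDegree + 1), r.coeff k * ∫ w, Real.exp (-(k * w)) ∂τ := by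
      intro τ _ hτ
      simp only [Polynomial.eval_eq_sum_range]
      rw [integral_finsetSum _ fun k _ =>
        (hint τ hτ (fun u => r.coeff k * u ^ k) (by fun_prop))]
      refine Finset.sum_congr rfl fun k _ => ?_
      rw [integral_const_mul]
      congr 2 with w
      rw [← Real.exp_nat_mul, mul_neg]
    rw [hsum ρ h0]
    simp only [fun n => hsum (ρn n) (h0n n)]
    exact tendsto_finsetSum _ fun k _ => (hL k).const_mul _
  rw [Metric.tendsto_atTop]
  intro ε hε
  obtain ⟨r, hr⟩ := exists_polynomial_near_of_continuousOn 0 1 f hf.continuousOn (ε / 3)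
    (by positivity)
  have hnear : ∀ (τ : Measure ℝ) [IsProbabilityMeasure τ], (∀ᵐ w ∂τ, 0 ≤ w) →
      |∫ w, r.eval (Real.exp (-w)) ∂τ - ∫ w, f (Real.exp (-w)) ∂τ| ≤ ε / 3 := by
    intro τ _ hτ
    rw [← integral_sub (hint τ hτ (fun u => r.eval u) r.continuous) (hint τ hτ f hf),
      ← Real.norm_eq_abs]
    have := norm_integral_le_of_norm_le_const (μ := τ) (C := ε / 3)
      (f := fun w => r.eval (Real.exp (-w)) - f (Real.exp (-w)))
      (hτ.mono fun w hw => (hr _ (hIcc w hw)).le)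
    simpa using this
  obtain ⟨N, hN⟩ := Metric.tendsto_atTop.1 (hpoly r) (ε / 3) (by positivity)
  refine ⟨N, fun n hn => ?_⟩
  have h1 := hN n hn
  have h2 := abs_le.1 (hnear (ρn n) (h0n n))
  have h3 := abs_le.1 (hnear ρ h0)
  rw [Real.dist_eq, abs_lt] at h1 ⊢
  constructor <;> linarith [h1.1, h1.2, h2.1, h2.2, h3.1, h3.2]

/-- The law of `exp (-w)` when `w` has law `ρ`. -/
noncomputable def expNegLaw (ρ : Measure ℝ) [IsProbabilityMeasure ρ] : ProbabilityMeasure ℝ :=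
  ⟨ρ.map fun w => Real.exp (-w), Measure.isProbabilityMeasure_map (by fun_prop)⟩

lemma tendsto_expNegLaw {ρn : ℕ → Measure ℝ} {ρ : Measure ℝ}
    [∀ n, IsProbabilityMeasure (ρn n)] [IsProbabilityMeasure ρ]
    (h0n : ∀ n, ∀ᵐ w ∂(ρn n), 0 ≤ w) (h0 : ∀ᵐ w ∂ρ, 0 ≤ w)
    (hL : ∀ k : ℕ, Tendsto (fun n => ∫ w, Real.exp (-(k * w)) ∂(ρn n)) atTop
      (𝓝 (∫ w, Real.exp (-(k * w)) ∂ρ))) :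
    Tendsto (fun n => expNegLaw (ρn n)) atTop (𝓝 (expNegLaw ρ)) := by
  rw [ProbabilityMeasure.tendsto_iff_forall_integral_tendsto]
  intro f
  have := tendsto_integral_comp_exp_neg h0n h0 hL f.continuous
  convert this using 1
  · ext n
    exact integral_map (by fun_prop) f.continuous.aestronglyMeasurable
  · congr 1
    exact integral_map (by fun_prop) f.continuous.aestronglyMeasurable

lemma exp_neg_preimage_Ici (z : ℝ) :
    (fun w => Real.exp (-w)) ⁻¹' Set.Ici (Real.exp (-z)) = Set.Iic z := by
  ext w; simp

lemma exp_neg_preimage_Ioi (z : ℝ) :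
    (fun w => Real.exp (-w)) ⁻¹' Set.Ioi (Real.exp (-z)) = Set.Iio z := by
  ext w; simp

/-- If the distribution functions at points `z n → z` converge to `L` then `ρ (Iio z) ≤ L`. -/
lemma real_Iio_le_of_laplace_tendsto {ρn : ℕ → Measure ℝ} {ρ : Measure ℝ}
    [∀ n, IsProbabilityMeasure (ρn n)] [IsProbabilityMeasure ρ]
    (h0n : ∀ n, ∀ᵐ w ∂(ρn n), 0 ≤ w) (h0 : ∀ᵐ w ∂ρ, 0 ≤ w)
    (hL : ∀ k : ℕ, Tendsto (fun n => ∫ w, Real.exp (-(k * w)) ∂(ρn n)) atTop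
      (𝓝 (∫ w, Real.exp (-(k * w)) ∂ρ))) {z : ℝ} {u : ℕ → ℝ} {L : ℝ}
    (hle : ∀ᶠ n in atTop, (ρn n).real (Set.Iic z) ≤ u n) (hu : Tendsto u atTop (𝓝 L)) :
    ρ.real (Set.Iio z) ≤ L := by
  have h := ProbabilityMeasure.le_liminf_measure_open_of_tendsto
    (tendsto_expNegLaw h0n h0 hL) (isOpen_Ioi (a := Real.exp (-z)))
  simp only [expNegLaw, ProbabilityMeasure.coe_mk] at h
  rw [Measure.map_apply (by fun_prop) measurableSet_Ioi, exp_neg_preimage_Ioi] at h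
  simp only [Measure.map_apply (f := fun w : ℝ => Real.exp (-w)) (by fun_prop)
    (measurableSet_Ioi (a := Real.exp (-z))), exp_neg_preimage_Ioi] at h
  have hu' : Tendsto (fun n => ENNReal.ofReal (u n)) atTop (𝓝 (ENNReal.ofReal L)) :=
    (ENNReal.continuous_ofReal.tendsto L).comp hu
  have h1 : ρ (Set.Iio z) ≤ ENNReal.ofReal L := by
    refine h.trans ?_
    rw [← hu'.liminf_eq]
    refine liminf_le_liminf (hle.mono fun n hn => ?_)
    rw [← ENNReal.ofReal_toReal (measure_ne_top (ρn n) (Set.Iio z))]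
    exact ENNReal.ofReal_le_ofReal
      ((measureReal_mono (μ := ρn n) Set.Iio_subset_Iic_self).trans hn)
  have hL0 : 0 ≤ L := ge_of_tendsto hu (hle.mono fun n hn => measureReal_nonneg.trans hn)
  exact ENNReal.toReal_le_of_le_ofReal hL0 h1

lemma le_real_Iic_of_laplace_tendsto {ρn : ℕ → Measure ℝ} {ρ : Measure ℝ}
    [∀ n, IsProbabilityMeasure (ρn n)] [IsProbabilityMeasure ρ]
    (h0n : ∀ n, ∀ᵐ w ∂(ρn n), 0 ≤ w) (h0 : ∀ᵐ w ∂ρ, 0 ≤ w)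
    (hL : ∀ k : ℕ, Tendsto (fun n => ∫ w, Real.exp (-(k * w)) ∂(ρn n)) atTop
      (𝓝 (∫ w, Real.exp (-(k * w)) ∂ρ))) {z : ℝ} {u : ℕ → ℝ} {L : ℝ}
    (hle : ∀ᶠ n in atTop, u n ≤ (ρn n).real (Set.Iic z)) (hu : Tendsto u atTop (𝓝 L)) :
    L ≤ ρ.real (Set.Iic z) := by
  have h := ProbabilityMeasure.limsup_measure_closed_le_of_tendsto
    (tendsto_expNegLaw h0n h0 hL) (isClosed_Ici (a := Real.exp (-z)))
  simp only [expNegLaw, ProbabilityMeasure.coe_mk] at h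
  rw [Measure.map_apply (by fun_prop) measurableSet_Ici, exp_neg_preimage_Ici] at h
  simp only [Measure.map_apply (f := fun w : ℝ => Real.exp (-w)) (by fun_prop)
    (measurableSet_Ici (a := Real.exp (-z))), exp_neg_preimage_Ici] at h
  have hu' : Tendsto (fun n => ENNReal.ofReal (u n)) atTop (𝓝 (ENNReal.ofReal L)) :=
    (ENNReal.continuous_ofReal.tendsto L).comp hu
  have h1 : ENNReal.ofReal L ≤ ρ (Set.Iic z) := by
    refine le_trans ?_ h
    rw [← hu'.limsup_eq]
    refine limsup_le_limsup (hle.mono fun n hn => ?_)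
    exact ENNReal.ofReal_le_of_le_toReal hn
  exact (ENNReal.ofReal_le_iff_le_toReal (measure_ne_top _ _)).1 h1

/-! ### Passing to the limit in the jump measure -/

/-- The restriction of `ν` to jumps of size in `[1/(n+1), n+1]`. -/
noncomputable def truncJump (ν : Measure ℝ) (n : ℕ) : Measure ℝ :=
  ν.restrict (Set.Icc ((n : ℝ) + 1)⁻¹ (n + 1))

lemma isFiniteMeasure_truncJump {ν : Measure ℝ} (h1 : Integrable (fun y => y) ν) (n : ℕ) :
    IsFiniteMeasure (truncJump ν n) := by
  refine ⟨?_⟩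
  rw [truncJump, Measure.restrict_apply_univ]
  exact (measure_mono fun y hy => hy.1).trans_lt
    (h1.measure_ge_lt_top (show (0 : ℝ) < ((n : ℝ) + 1)⁻¹ by positivity))

lemma integrable_exp_truncJump {ν : Measure ℝ} (h1 : Integrable (fun y => y) ν) (n : ℕ) (s : ℝ) :
    Integrable (fun y => Real.exp (s * y)) (truncJump ν n) := by
  have := isFiniteMeasure_truncJump h1 n
  obtain ⟨C, hC⟩ := (isCompact_Icc (a := ((n : ℝ) + 1)⁻¹)
    (b := (n : ℝ) + 1)).exists_bound_of_continuousOn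
    (f := fun y => Real.exp (s * y)) (by fun_prop)
  refine Integrable.of_bound (by fun_prop) C ?_
  rw [truncJump]
  filter_upwards [ae_restrict_mem measurableSet_Icc] with y hy using hC y hy

lemma tendsto_integral_truncJump {ν : Measure ℝ} (hν : ∀ᵐ y ∂ν, 0 ≤ y) {f : ℝ → ℝ}
    (hf : Integrable f ν) (hf0 : f 0 = 0) :
    Tendsto (fun n => ∫ y, f y ∂(truncJump ν n)) atTop (𝓝 (∫ y, f y ∂ν)) := by
  simp only [truncJump, ← integral_indicator measurableSet_Icc]
  refine tendsto_integral_of_dominated_convergence (fun y => ‖f y‖)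
    (fun n => hf.1.indicator measurableSet_Icc) hf.norm
    (fun n => Eventually.of_forall fun y => norm_indicator_le_norm_self _ _) ?_
  filter_upwards [hν] with y hy
  rcases hy.eq_or_lt with rfl | hy
  · refine tendsto_const_nhds.congr fun n => ?_
    rw [hf0]
    by_cases h : (0 : ℝ) ∈ Set.Icc ((n : ℝ) + 1)⁻¹ (n + 1)
    · rw [Set.indicator_of_mem h, hf0]
    · rw [Set.indicator_of_notMem h]
  · refine tendsto_const_nhds.congr' ?_
    have hk : Tendsto (fun n : ℕ => (n : ℝ) + 1) atTop atTop :=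
      tendsto_natCast_atTop_atTop.atTop_add tendsto_const_nhds
    filter_upwards [hk.eventually_ge_atTop y, hk.eventually_ge_atTop y⁻¹] with n ha hb
    rw [Set.indicator_of_mem]
    exact ⟨inv_le_of_inv_le₀ hy hb, ha⟩

/-- The Berry–Esseen type bound appearing in the approximation of compound Poisson laws. -/
noncomputable def berryEsseenWeight (x : ℝ) : ℝ := min 0.4785 (31.935 / (1 + |x| ^ 3))

lemma continuous_berryEsseenWeight : Continuous berryEsseenWeight := by
  unfold berryEsseenWeight
  refine continuous_const.min (continuous_const.div (by fun_prop) fun x => ?_)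
  positivity

lemma real_Iic_sub_le_of_laplace {ν ρ : Measure ℝ} [IsProbabilityMeasure ρ]
    (hρ : ∀ᵐ w ∂ρ, 0 ≤ w) (hν : ∀ᵐ y ∂ν, 0 ≤ y) (h1 : Integrable (fun y => y) ν)
    (h2 : Integrable (fun y => y ^ 2) ν) (h3 : Integrable (fun y => |y| ^ 3) ν)
    (hL : ∀ s : ℝ, 0 ≤ s → ∫ w, Real.exp (-(s * w)) ∂ρ
      = Real.exp (-∫ y, (1 - Real.exp (-(s * y))) ∂ν))
    {σ : ℝ} (hσ : 0 < σ) (hV : ∫ y, y ^ 2 ∂ν = σ ^ 2) (x : ℝ) :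
    |ρ.real (Set.Iic (∫ y, y ∂ν + σ * x)) - (gaussianReal 0 1).real (Set.Iic x)|
      ≤ (∫ y, |y| ^ 3 ∂ν) / σ ^ 3 * berryEsseenWeight x := by
  have := isFiniteMeasure_truncJump h1
  have h0n : ∀ n, ∀ᵐ w ∂(compoundPoisson (truncJump ν n)), 0 ≤ w := by
    intro n
    have h : truncJump ν n (Set.Iio 0) = 0 := by
      rw [truncJump]
      refine nonpos_iff_eq_zero.1 ((Measure.restrict_apply_le _ _).trans ?_)
      have := ae_iff.1 hν
      simp only [not_le] at this
      exact this.le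
    have := compoundPoisson_Iio_zero h
    rw [ae_iff]
    simp only [not_le]
    exact this
  have hLn : ∀ k : ℕ, Tendsto (fun n => ∫ w, Real.exp (-(k * w)) ∂(compoundPoisson (truncJump ν n)))
      atTop (𝓝 (∫ w, Real.exp (-(k * w)) ∂ρ)) := by
    intro k
    rw [hL k k.cast_nonneg]
    have e : ∀ n, ∫ w, Real.exp (-(k * w)) ∂(compoundPoisson (truncJump ν n))
        = Real.exp (-∫ y, (1 - Real.exp (-(k * y))) ∂(truncJump ν n)) := by
      intro n
      have := integral_exp_compoundPoisson (integrable_exp_truncJump h1 n (-(k : ℝ)))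
      simp only [neg_mul] at this
      rw [this, ← integral_neg]
      simp only [neg_sub]
    simp only [e]
    refine (Real.continuous_exp.tendsto _).comp (Tendsto.neg ?_)
    exact tendsto_integral_truncJump hν (integrable_one_sub_exp_neg hν h1 k.cast_nonneg) (by simp)
  have hm := tendsto_integral_truncJump hν h1 rfl
  have hT := tendsto_integral_truncJump hν h3 (by simp)
  have hσn : Tendsto (fun n => Real.sqrt (∫ y, y ^ 2 ∂(truncJump ν n))) atTop (𝓝 σ) := by
    have := (tendsto_integral_truncJump hν h2 (by simp)).sqrt
    rwa [hV, Real.sqrt_sq hσ.le] at this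
  set m := ∫ y, y ∂ν
  set T := ∫ y, |y| ^ 3 ∂ν
  set mn := fun n => ∫ y, y ∂(truncJump ν n)
  set Tn := fun n => ∫ y, |y| ^ 3 ∂(truncJump ν n)
  set σn := fun n => Real.sqrt (∫ y, y ^ 2 ∂(truncJump ν n)) with hσn_def
  have hxn : ∀ x, Tendsto (fun n => (m + σ * x - mn n) / σn n) atTop (𝓝 x) := by
    intro x
    have := (hm.const_sub (m + σ * x)).div hσn hσ.ne'
    rwa [show (m + σ * x - m) / σ = x by field_simp; ring] at this
  have hΦn : ∀ x, Tendsto (fun n => (gaussianReal 0 1).real (Set.Iic ((m + σ * x - mn n) / σn n)))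
      atTop (𝓝 ((gaussianReal 0 1).real (Set.Iic x))) := fun x =>
    (continuous_gaussianReal_real_Iic.tendsto x).comp (hxn x)
  have hbn : ∀ x, Tendsto (fun n => Tn n / σn n ^ 3 *
      berryEsseenWeight ((m + σ * x - mn n) / σn n)) atTop
      (𝓝 (T / σ ^ 3 * berryEsseenWeight x)) := fun x =>
    (hT.div (hσn.pow 3) (by positivity)).mul
      ((continuous_berryEsseenWeight.tendsto x).comp (hxn x))
  have hBE : ∀ x, ∀ᶠ n in atTop,
      |(compoundPoisson (truncJump ν n)).real (Set.Iic (m + σ * x))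
        - (gaussianReal 0 1).real (Set.Iic ((m + σ * x - mn n) / σn n))|
      ≤ Tn n / σn n ^ 3 * berryEsseenWeight ((m + σ * x - mn n) / σn n) := by
    intro x
    filter_upwards [hσn.eventually_const_lt hσ] with n hn
    have h := compoundPoisson_Iic_sub_le (integrable_exp_truncJump h1 n) hn
      (Real.sq_sqrt (integral_nonneg fun y => sq_nonneg y)).symm ((m + σ * x - mn n) / σn n)
    rwa [show ∫ y, y ∂(truncJump ν n) + σn n * ((m + σ * x - mn n) / σn n) = m + σ * x by
      simp only [mn]; field_simp; ring] at h
  have hup : ∀ x, ρ.real (Set.Iio (m + σ * x))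
      ≤ (gaussianReal 0 1).real (Set.Iic x) + T / σ ^ 3 * berryEsseenWeight x := fun x =>
    real_Iio_le_of_laplace_tendsto h0n hρ hLn
      ((hBE x).mono fun n hn => by linarith [(abs_le.1 hn).2]) ((hΦn x).add (hbn x))
  have hlo : (gaussianReal 0 1).real (Set.Iic x) - T / σ ^ 3 * berryEsseenWeight x
      ≤ ρ.real (Set.Iic (m + σ * x)) :=
    le_real_Iic_of_laplace_tendsto h0n hρ hLn
      ((hBE x).mono fun n hn => by linarith [(abs_le.1 hn).1]) ((hΦn x).sub (hbn x))
  have hup' : ρ.real (Set.Iic (m + σ * x))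
      ≤ (gaussianReal 0 1).real (Set.Iic x) + T / σ ^ 3 * berryEsseenWeight x := by
    have hc : Continuous fun x => (gaussianReal 0 1).real (Set.Iic x)
        + T / σ ^ 3 * berryEsseenWeight x :=
      continuous_gaussianReal_real_Iic.add (continuous_berryEsseenWeight.const_mul _)
    refine ge_of_tendsto ((hc.tendsto x).mono_left (nhdsWithin_le_nhds (s := Set.Ioi x))) ?_
    filter_upwards [self_mem_nhdsWithin] with x' hx'
    refine (measureReal_mono ?_).trans (hup x')
    refine Set.Iic_subset_Iio.2 ?_
    have := mul_lt_mul_of_pos_left (Set.mem_Ioi.1 hx') hσ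
    linarith
  rw [abs_le]
  constructor <;> linarith

/-! ### The jump measure of the interference -/

/-- The measure on `(0, ∞)` with density `w`. -/
noncomputable def halfLineDensity (w : ℝ → ℝ) : Measure ℝ :=
  (volume.restrict (Set.Ioi 0)).withDensity fun t => ENNReal.ofReal (w t)

instance (w : ℝ → ℝ) : SFinite (halfLineDensity w) := by
  unfold halfLineDensity; infer_instance

lemma ae_halfLineDensity_pos (w : ℝ → ℝ) : ∀ᵐ t ∂(halfLineDensity w), 0 < t :=
  (withDensity_absolutelyContinuous _ _).ae_le (ae_restrict_mem measurableSet_Ioi)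

lemma integral_halfLineDensity {w : ℝ → ℝ} (hw : Measurable w) (hw0 : ∀ t, 0 ≤ w t)
    (f : ℝ → ℝ) : ∫ t, f t ∂(halfLineDensity w) = ∫ t in Set.Ioi 0, f t * w t := by
  rw [halfLineDensity, integral_withDensity_eq_integral_toReal_smul hw.ennreal_ofReal
    (Eventually.of_forall fun _ => ENNReal.ofReal_lt_top)]
  simp only [ENNReal.toReal_ofReal (hw0 _), smul_eq_mul, mul_comm]

lemma integrable_halfLineDensity {w : ℝ → ℝ} (hw : Measurable w) (hw0 : ∀ t, 0 ≤ w t)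
    {f : ℝ → ℝ} (hf : IntegrableOn (fun t => f t * w t) (Set.Ioi 0)) :
    Integrable f (halfLineDensity w) := by
  rw [halfLineDensity, integrable_withDensity_iff_integrable_smul' hw.ennreal_ofReal
    (Eventually.of_forall fun _ => ENNReal.ofReal_lt_top)]
  simpa only [IntegrableOn, ENNReal.toReal_ofReal (hw0 _), smul_eq_mul, mul_comm] using hf

/-- The law of received powers: the image of distance and fading under `(t, h) ↦ P * h * G t`. -/
noncomputable def receivedPower (P : ℝ) (G w q : ℝ → ℝ) : Measure ℝ :=
  ((halfLineDensity w).prod (halfLineDensity q)).map fun z => P * z.2 * G z.1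

section receivedPower

variable {P : ℝ} {G w q : ℝ → ℝ}

lemma measurable_power (hG : Measurable G) : Measurable fun z : ℝ × ℝ => P * z.2 * G z.1 := by
  fun_prop

lemma ae_receivedPower_nonneg (hP : 0 < P) (hG : Measurable G) (hG0 : ∀ t, 0 ≤ t → 0 ≤ G t) :
    ∀ᵐ y ∂(receivedPower P G w q), 0 ≤ y := by
  rw [receivedPower, ae_map_iff (measurable_power hG).aemeasurable measurableSet_Ici]
  filter_upwards [Measure.quasiMeasurePreserving_fst.ae (ae_halfLineDensity_pos w),
    Measure.quasiMeasurePreserving_snd.ae (ae_halfLineDensity_pos q)] with z h1 h2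
  have := hG0 z.1 h1.le
  positivity

lemma integrable_pow_receivedPower (hG : Measurable G)
    (hw : Measurable w) (hw0 : ∀ t, 0 ≤ w t) (hq : Measurable q) (hq0 : ∀ t, 0 ≤ q t) (k : ℕ)
    (hGw : IntegrableOn (fun t => G t ^ k * w t) (Set.Ioi 0))
    (hhq : IntegrableOn (fun h => h ^ k * q h) (Set.Ioi 0)) :
    Integrable (fun y => y ^ k) (receivedPower P G w q) := by
  rw [receivedPower, integrable_map_measure (by fun_prop) (measurable_power hG).aemeasurable]
  refine (((integrable_halfLineDensity hw hw0 hGw).mul_prod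
    (integrable_halfLineDensity hq hq0 hhq)).const_mul (P ^ k)).congr
    (Eventually.of_forall fun z => ?_)
  simp only [Function.comp_apply, mul_pow]
  ring

lemma integral_pow_receivedPower (hG : Measurable G)
    (hw : Measurable w) (hw0 : ∀ t, 0 ≤ w t) (hq : Measurable q) (hq0 : ∀ t, 0 ≤ q t) (k : ℕ) :
    ∫ y, y ^ k ∂(receivedPower P G w q)
      = P ^ k * ((∫ t in Set.Ioi 0, G t ^ k * w t) * ∫ h in Set.Ioi 0, h ^ k * q h) := by
  rw [receivedPower, integral_map (measurable_power hG).aemeasurable (by fun_prop),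
    ← integral_halfLineDensity hw hw0, ← integral_halfLineDensity hq hq0, ← integral_prod_mul,
    ← integral_const_mul]
  refine integral_congr_ae (Eventually.of_forall fun z => ?_)
  simp only [mul_pow]
  ring

lemma integral_receivedPower (hG : Measurable G)
    (hw : Measurable w) (hw0 : ∀ t, 0 ≤ w t) (hq : Measurable q) (hq0 : ∀ t, 0 ≤ q t)
    {f : ℝ → ℝ} (hf : Integrable f (receivedPower P G w q)) :
    ∫ y, f y ∂(receivedPower P G w q)
      = ∫ t in Set.Ioi 0, ∫ h in Set.Ioi 0, f (P * h * G t) * q h * w t := by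
  have hm := (measurable_power (P := P) hG).aemeasurable
    (μ := (halfLineDensity w).prod (halfLineDensity q))
  have hfm : Integrable (fun z : ℝ × ℝ => f (P * z.2 * G z.1))
      ((halfLineDensity w).prod (halfLineDensity q)) := hf.comp_aemeasurable hm
  rw [receivedPower, integral_map hm hf.1, integral_prod _ hfm, integral_halfLineDensity hw hw0]
  simp only [integral_halfLineDensity hq hq0, integral_mul_const]

end receivedPower

/-! ### Integrability of the path loss -/

lemma integrableOn_pow_mul_of_tail {α ε : ℝ} (hε : 0 < ε) {G p : ℝ → ℝ} (hG_meas : Measurable G)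
    (hG_nonneg : ∀ t, 0 ≤ t → 0 ≤ G t) (hG_bdd : ∃ C : ℝ, ∀ t, 0 ≤ t → G t ≤ C)
    (hG_tail : ∃ K > (0 : ℝ), ∃ B > (0 : ℝ), ∀ t ≥ B, G t ≤ K * t ^ (-α))
    (hp_meas : Measurable p) (hp_nonneg : ∀ t, 0 ≤ p t)
    (hp_loc : ∀ b : ℝ, IntegrableOn p (Set.Icc 0 b))
    (hp_bigO : ∃ C > (0 : ℝ), ∃ B' > (0 : ℝ), ∀ t ≥ B', p t ≤ C * t ^ (α - 1 - ε)) (k : ℕ) :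
    IntegrableOn (fun t => G t ^ (k + 1) * p t) (Set.Ioi 0) := by
  obtain ⟨M, hM⟩ := hG_bdd
  obtain ⟨K, hK, B, hB, hGB⟩ := hG_tail
  obtain ⟨C, hC, B', hB', hpB⟩ := hp_bigO
  have hM0 : 0 ≤ M := (hG_nonneg 0 le_rfl).trans (hM 0 le_rfl)
  set b := max B B'
  have hb : 0 < b := hB.trans_le (le_max_left _ _)
  rw [← Set.Ioc_union_Ioi_eq_Ioi hb.le]
  refine IntegrableOn.union ?_ ?_
  · refine (((hp_loc b).mono_set Set.Ioc_subset_Icc_self).const_mul (M ^ (k + 1))).mono'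
      (by fun_prop) ?_
    filter_upwards [ae_restrict_mem measurableSet_Ioc] with t ht
    have h0 := hG_nonneg t ht.1.le
    have h1 := hp_nonneg t
    rw [Real.norm_of_nonneg (by positivity)]
    have := hM t ht.1.le
    gcongr
  · refine ((integrableOn_Ioi_rpow_of_lt (a := -1 - ε) (by linarith) hb).const_mul
      (M ^ k * (K * C))).mono' (by fun_prop) ?_
    filter_upwards [ae_restrict_mem measurableSet_Ioi] with t ht
    have ht : b < t := ht
    have ht0 : 0 < t := hb.trans ht
    have h0 := hG_nonneg t ht0.le
    have h1 := hp_nonneg t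
    rw [Real.norm_of_nonneg (by positivity)]
    calc G t ^ (k + 1) * p t = G t ^ k * (G t * p t) := by ring
      _ ≤ M ^ k * ((K * t ^ (-α)) * (C * t ^ (α - 1 - ε))) := by
          have h2 := hM t ht0.le
          have h3 := hGB t ((le_max_left _ _).trans ht.le)
          have h4 := hpB t ((le_max_right _ _).trans ht.le)
          refine mul_le_mul (pow_le_pow_left₀ h0 h2 k) ?_ (by positivity) (by positivity)
          exact mul_le_mul h3 h4 h1 (h0.trans h3)
      _ = M ^ k * (K * C) * t ^ (-1 - ε) := by
          rw [show -1 - ε = -α + (α - 1 - ε) by ring, Real.rpow_add ht0]; ring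

lemma integral_sq_mul_pos {q : ℝ → ℝ} (hq_nonneg : ∀ h, 0 ≤ q h)
    (hq_prob : ∫ h in Set.Ioi (0 : ℝ), q h = 1)
    (hq_m2 : IntegrableOn (fun h => h ^ 2 * q h) (Set.Ioi 0)) :
    0 < ∫ h in Set.Ioi (0 : ℝ), h ^ 2 * q h := by
  have hnn : 0 ≤ fun h : ℝ => h ^ 2 * q h := fun h => mul_nonneg (sq_nonneg h) (hq_nonneg h)
  refine (integral_nonneg hnn).lt_of_ne' fun h0 => ?_
  have h1 := (integral_eq_zero_iff_of_nonneg hnn hq_m2).1 h0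
  have h2 : q =ᵐ[volume.restrict (Set.Ioi 0)] 0 := by
    filter_upwards [h1, ae_restrict_mem measurableSet_Ioi] with h hh hpos
    exact (mul_eq_zero.1 hh).resolve_left (pow_ne_zero 2 (ne_of_gt hpos))
  rw [integral_congr_ae h2] at hq_prob
  simp at hq_prob

lemma gaussianReal_real_Iic (x : ℝ) : (gaussianReal 0 1).real (Set.Iic x)
    = (∫ t in Set.Iic x, Real.exp (-t ^ 2 / 2)) / Real.sqrt (2 * Real.pi) := by
  rw [Measure.real, gaussianReal_apply_eq_integral 0 one_ne_zero, ENNReal.toReal_ofReal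
    (integral_nonneg fun t => gaussianPDFReal_nonneg _ _ _), div_eq_inv_mul, ← integral_const_mul]
  simp [gaussianPDFReal]

lemma rpow_three_halves {a : ℝ} (ha : 0 ≤ a) : a ^ (3 / 2 : ℝ) = Real.sqrt a ^ 3 := by
  rw [Real.sqrt_eq_rpow, ← Real.rpow_mul_natCast ha]
  norm_num

theorem gaussian_approximation_rate
    {α ε lam P : ℝ} (hα : 2 < α) (hε : 0 < ε) (hlam : 0 < lam) (hP : 0 < P)
    (G p q : ℝ → ℝ)
    (hG_meas : Measurable G)
    (hG_nonneg : ∀ t, 0 ≤ t → 0 ≤ G t)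
    (hG_bdd : ∃ C : ℝ, ∀ t, 0 ≤ t → G t ≤ C)
    (hG_anti : AntitoneOn G (Set.Ici 0))
    (hG_tail : ∃ K > (0:ℝ), ∃ B > (0:ℝ), ∀ t ≥ B, G t ≤ K * t ^ (-α))
    (hp_meas : Measurable p) (hp_nonneg : ∀ t, 0 ≤ p t)
    (hp_loc : ∀ b : ℝ, IntegrableOn p (Set.Icc 0 b))
    (hp_top : ∫⁻ t in Set.Ioi (0:ℝ), ENNReal.ofReal (p t) = ⊤)
    (hp_bigO : ∃ C > (0:ℝ), ∃ B' > (0:ℝ), ∀ t ≥ B', p t ≤ C * t ^ (α - 1 - ε))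
    (hq_meas : Measurable q) (hq_nonneg : ∀ h, 0 ≤ q h)
    (hq_prob : ∫ h in Set.Ioi (0:ℝ), q h = 1)
    (hq_m1 : IntegrableOn (fun h => h * q h) (Set.Ioi 0))
    (hq_m2 : IntegrableOn (fun h => h ^ 2 * q h) (Set.Ioi 0))
    (hq_m3 : IntegrableOn (fun h => h ^ 3 * q h) (Set.Ioi 0))
    {Ω : Type*} [MeasurableSpace Ω] (μ : Measure Ω) [IsProbabilityMeasure μ]
    (I : Ω → ℝ) (hI_meas : Measurable I) (hI_nonneg : ∀ ω, 0 ≤ I ω)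
    (hI_laplace : ∀ s : ℝ, 0 ≤ s →
      ∫ ω, Real.exp (-(s * I ω)) ∂μ =
        Real.exp (-(lam * ∫ t in Set.Ioi (0:ℝ), ∫ h in Set.Ioi (0:ℝ),
          (1 - Real.exp (-(s * P * h * G t))) * q h * p t)))
    (hG2_pos : 0 < ∫ t in Set.Ioi (0:ℝ), G t ^ 2 * p t) :
    ∀ x : ℝ,
      |(μ {ω | (I ω - ∫ ω', I ω' ∂μ) / Real.sqrt (variance I μ) ≤ x}).toReal -
          (∫ t in Set.Iic (x), Real.exp (-t ^ 2 / 2)) / Real.sqrt (2 * Real.pi)| ≤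
        ((∫ h in Set.Ioi (0:ℝ), h ^ 3 * q h) / (∫ h in Set.Ioi (0:ℝ), h ^ 2 * q h) ^ (3/2 : ℝ) *
          ((∫ t in Set.Ioi (0:ℝ), G t ^ 3 * p t) /
            (∫ t in Set.Ioi (0:ℝ), G t ^ 2 * p t) ^ (3/2 : ℝ)) *
          min 0.4785 (31.935 / (1 + |x| ^ 3))) / Real.sqrt lam := by
  intro x
  have hw : Measurable fun t => lam * p t := hp_meas.const_mul lam
  have hw0 : ∀ t, 0 ≤ lam * p t := fun t => mul_nonneg hlam.le (hp_nonneg t)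
  set ν := receivedPower P G (fun t => lam * p t) q with hν_def
  have hGint : ∀ k : ℕ, IntegrableOn (fun t => G t ^ (k + 1) * (lam * p t)) (Set.Ioi 0) := fun k =>
    ((integrableOn_pow_mul_of_tail hε hG_meas hG_nonneg hG_bdd hG_tail hp_meas hp_nonneg hp_loc
      hp_bigO k).const_mul lam).congr (Eventually.of_forall fun t => by ring)
  have hν : ∀ᵐ y ∂ν, 0 ≤ y := ae_receivedPower_nonneg hP hG_meas hG_nonneg
  have h1 : Integrable (fun y => y) ν := by
    simpa using integrable_pow_receivedPower (P := P) hG_meas hw hw0 hq_meas hq_nonneg 1 (hGint 0)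
      (by simpa using hq_m1)
  have h2 : Integrable (fun y => y ^ 2) ν :=
    integrable_pow_receivedPower hG_meas hw hw0 hq_meas hq_nonneg 2 (hGint 1) hq_m2
  have hcube : (fun y : ℝ => y ^ 3) =ᵐ[ν] fun y => |y| ^ 3 :=
    hν.mono fun y hy => by simp only [abs_of_nonneg hy]
  have h3 : Integrable (fun y => |y| ^ 3) ν :=
    (integrable_pow_receivedPower hG_meas hw hw0 hq_meas hq_nonneg 3 (hGint 2) hq_m3).congr hcube
  have hGk : ∀ k : ℕ, ∫ t in Set.Ioi 0, G t ^ k * (lam * p t)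
      = lam * ∫ t in Set.Ioi 0, G t ^ k * p t := fun k => by
    rw [← integral_const_mul]
    congr 1 with t
    ring
  have hV := integral_pow_receivedPower (P := P) hG_meas hw hw0 hq_meas hq_nonneg 2
  have hT := integral_pow_receivedPower (P := P) hG_meas hw hw0 hq_meas hq_nonneg 3
  rw [← hν_def, hGk] at hV hT
  rw [integral_congr_ae hcube] at hT
  have hH2 := integral_sq_mul_pos hq_nonneg hq_prob hq_m2
  have : IsProbabilityMeasure (μ.map I) := Measure.isProbabilityMeasure_map hI_meas.aemeasurable
  have hρ : ∀ᵐ w ∂(μ.map I), 0 ≤ w :=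
    (ae_map_iff hI_meas.aemeasurable measurableSet_Ici).2 (Eventually.of_forall hI_nonneg)
  have hL : ∀ s : ℝ, 0 ≤ s → ∫ w, Real.exp (-(s * w)) ∂(μ.map I)
      = Real.exp (-∫ y, (1 - Real.exp (-(s * y))) ∂ν) := by
    intro s hs
    rw [integral_map hI_meas.aemeasurable (by fun_prop), hI_laplace s hs,
      integral_receivedPower hG_meas hw hw0 hq_meas hq_nonneg
        (integrable_one_sub_exp_neg hν h1 hs), ← integral_const_mul]
    simp only [← integral_const_mul]
    congr 5 with t
    congr 1 with h
    rw [show s * P * h * G t = s * (P * h * G t) by ring]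
    ring
  obtain ⟨hI1, hm⟩ := integral_eq_of_laplace hρ hν h1 hL
  obtain ⟨hI2, hs⟩ := integral_sq_eq_of_laplace hρ hν h1 h2 hL
  rw [integrable_map_measure (by fun_prop) hI_meas.aemeasurable] at hI1 hI2
  rw [integral_map hI_meas.aemeasurable (by fun_prop)] at hm hs
  have hvar : variance I μ = ∫ y, y ^ 2 ∂ν := by
    rw [variance_eq_sub ((memLp_two_iff_integrable_sq hI_meas.aestronglyMeasurable).2 hI2), hm]
    simp only [Pi.pow_apply, hs]
    ring
  set H2 := ∫ h in Set.Ioi (0 : ℝ), h ^ 2 * q h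
  set H3 := ∫ h in Set.Ioi (0 : ℝ), h ^ 3 * q h
  set G2 := ∫ t in Set.Ioi (0 : ℝ), G t ^ 2 * p t
  set G3 := ∫ t in Set.Ioi (0 : ℝ), G t ^ 3 * p t
  have hσ : Real.sqrt (variance I μ) = Real.sqrt lam * P * Real.sqrt H2 * Real.sqrt G2 := by
    rw [hvar, hV, Real.sqrt_eq_iff_mul_self_eq (by positivity) (by positivity)]
    rw [show Real.sqrt lam * P * Real.sqrt H2 * Real.sqrt G2 *
      (Real.sqrt lam * P * Real.sqrt H2 * Real.sqrt G2) = P ^ 2 * ((Real.sqrt lam ^ 2 *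
        Real.sqrt G2 ^ 2) * Real.sqrt H2 ^ 2) by ring, Real.sq_sqrt hlam.le, Real.sq_sqrt hH2.le,
      Real.sq_sqrt hG2_pos.le]
  have hσ0 : 0 < Real.sqrt (variance I μ) := by rw [hσ]; positivity
  have hmain := real_Iic_sub_le_of_laplace hρ hν h1 h2 h3 hL hσ0
    (by rw [Real.sq_sqrt (variance_nonneg _ _), hvar]) x
  have hset : {ω | (I ω - ∫ ω', I ω' ∂μ) / Real.sqrt (variance I μ) ≤ x}
      = I ⁻¹' Set.Iic (∫ y, y ∂ν + Real.sqrt (variance I μ) * x) := by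
    ext ω
    rw [Set.mem_ofPred_eq, Set.mem_preimage, Set.mem_Iic, div_le_iff₀ hσ0, hm, sub_le_iff_le_add,
      mul_comm x, add_comm]
  rw [measureReal_def, Measure.map_apply hI_meas measurableSet_Iic, ← hset,
    gaussianReal_real_Iic] at hmain
  refine hmain.trans_eq ?_
  rw [hT, hσ, rpow_three_halves hH2.le, rpow_three_halves hG2_pos.le, ← berryEsseenWeight]
  have hl := Real.sqrt_pos.2 hlam
  have hH := Real.sqrt_pos.2 hH2
  have hg := Real.sqrt_pos.2 hG2_pos
  nth_rewrite 1 [← Real.sq_sqrt hlam.le]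
  field_simp
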